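/- arXiv:0909.1663 — 6 statements merged into one kernel-verified Lean document; each statement's English description precedes it below -/
import Mathlib

section
/- Let K be a field extension of ℚ of degree 2, and let x₀, x₁, x₂, x₃ ∈ K, not all zero, be such that x_i² − x_{i−1}² takes the same value for all i = 1, 2, 3 (i.e. the squares x₀², x₁², x₂², x₃² form an arithmetic progression in K). Then x₀ ≠ 0, and, setting q := (x₁/x₀)² − 1, either q = 0 or (3q+2)²/q² lies in the image of ℚ in K. -/
lemma pyth_aux {x y z : ℤ} (h : x ^ 2 + y ^ 2 = z ^ 2) (hc : IsCoprime x y) (hx : Odd x) :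
    ∃ m n : ℤ, x = m ^ 2 - n ^ 2 ∧ y = 2 * m * n ∧ IsCoprime m n := by
  have hp : PythagoreanTriple x y z := by
    unfold PythagoreanTriple; linarith [h, sq x, sq y, sq z]
  obtain ⟨m, n, h1, -, h3, -⟩ :=
    PythagoreanTriple.coprime_classification.mp ⟨hp, Int.isCoprime_iff_gcd_eq_one.mp hc⟩
  refine ⟨m, n, ?_⟩
  rcases h1 with ⟨h1, h2⟩ | ⟨h1, h2⟩
  · exact ⟨h1, h2, Int.isCoprime_iff_gcd_eq_one.mpr h3⟩
  · exfalso
    have : Even x := by rw [h1, mul_assoc]; exact even_two_mul _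
    exact (Int.not_even_iff_odd.mpr hx) this

/-- One descent step, with `x` odd. -/
lemma desc_step {x y a b : ℤ} (hxo : Odd x) (hx : x ≠ 0) (hy : y ≠ 0)
    (hxy : IsCoprime x y) (hab : IsCoprime a b) (h1 : x * y = 2 * (a * b))
    (h2 : x ^ 2 - y ^ 2 = a ^ 2 - b ^ 2) :
    ∃ x' y' a' b' : ℤ, x' ≠ 0 ∧ y' ≠ 0 ∧ IsCoprime x' y' ∧ IsCoprime a' b' ∧
      x' * y' = 2 * (a' * b') ∧ x' ^ 2 - y' ^ 2 = a' ^ 2 - b' ^ 2 ∧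
      (x' * y').natAbs < (x * y).natAbs := by
  have hye : Even y := by
    have : Even (x * y) := by rw [h1]; exact even_two_mul _
    rcases Int.even_mul.mp this with h | h
    · exact absurd h (Int.not_even_iff_odd.mpr hxo)
    · exact h
  obtain ⟨y1, rfl⟩ := hye.two_dvd
  have h3 : x * y1 = a * b := by linarith
  have hy1 : y1 ≠ 0 := by rintro rfl; simp at hy
  have ha : a ≠ 0 := by
    rintro rfl; simp at h3; tauto
  obtain ⟨r, s, t, hst, hr, rfl, rfl⟩ : ∃ r s t : ℤ, IsCoprime s t ∧ r ≠ 0 ∧ x = r * s ∧ a = r * t := by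
    have hg : (Int.gcd x a : ℤ) ≠ 0 := by
      intro h; have := Int.gcd_eq_zero_iff.mp (by exact_mod_cast h); tauto
    refine ⟨Int.gcd x a, x / Int.gcd x a, a / Int.gcd x a, ?_, hg, ?_, ?_⟩
    · exact Int.isCoprime_iff_gcd_eq_one.mpr (Int.gcd_div_gcd_div_gcd
        (Nat.pos_of_ne_zero (by exact_mod_cast hg)))
    · exact (Int.mul_ediv_cancel' (Int.gcd_dvd_left _ _)).symm
    · exact (Int.mul_ediv_cancel' (Int.gcd_dvd_right _ _)).symm
  have h4 : s * y1 = t * b := by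
    apply mul_left_cancel₀ hr; linarith
  have hs : s ≠ 0 := by rintro rfl; simp at hx
  have ht : t ≠ 0 := by rintro rfl; simp at ha
  obtain ⟨k, rfl⟩ : s ∣ b := hst.dvd_of_dvd_mul_left (Dvd.intro _ h4)
  have h5 : y1 = t * k := by
    apply mul_left_cancel₀ hs; linarith
  subst h5
  have hk : k ≠ 0 := by rintro rfl; simp at hy1
  have hrk : IsCoprime r k := (hab.of_mul_left_left).of_mul_right_right
  have hro : Odd r := (Int.odd_mul.mp hxo).1
  have hso : Odd s := (Int.odd_mul.mp hxo).2
  have h6 : r ^ 2 * (s ^ 2 - t ^ 2) = k ^ 2 * (4 * t ^ 2 - s ^ 2) := by linear_combination h2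
  have hrk2 : IsCoprime (k ^ 2) (r ^ 2) := (hrk.pow).symm
  obtain ⟨c, hc⟩ : k ^ 2 ∣ s ^ 2 - t ^ 2 := hrk2.dvd_of_dvd_mul_left (Dvd.intro _ h6.symm)
  have hk2 : 0 < k ^ 2 := by positivity
  have hr2 : 0 < r ^ 2 := by positivity
  have hs2 : 0 < s ^ 2 := by positivity
  have ht2 : 0 < t ^ 2 := by positivity
  have hc' : 4 * t ^ 2 - s ^ 2 = c * r ^ 2 := by
    apply mul_left_cancel₀ hk2.ne'
    rw [← h6, hc]; ring
  have hcpos : 0 < c := by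
    by_contra hcn
    push Not at hcn
    have e1 : k ^ 2 * c ≤ 0 := mul_nonpos_of_nonneg_of_nonpos hk2.le hcn
    have e2 : c * r ^ 2 ≤ 0 := mul_nonpos_of_nonpos_of_nonneg hcn hr2.le
    linarith
  have hc3 : c ∣ 3 := by
    have d1 : c ∣ 3 * s ^ 2 := ⟨4 * k ^ 2 + r ^ 2, by linear_combination 4 * hc + hc'⟩
    have d2 : c ∣ 3 * t ^ 2 := ⟨k ^ 2 + r ^ 2, by linear_combination hc + hc'⟩
    obtain ⟨u, v, huv⟩ : IsCoprime (s ^ 2) (t ^ 2) := hst.pow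
    have : (3 : ℤ) = u * (3 * s ^ 2) + v * (3 * t ^ 2) := by linear_combination -3 * huv
    rw [this]
    exact dvd_add (d1.mul_left _) (d2.mul_left _)
  have hcle : c ≤ 3 := Int.le_of_dvd (by norm_num) hc3
  have hc2 : c = 1 ∨ c = 3 := by
    interval_cases c
    · simp
    · norm_num at hc3
    · simp
  rcases hc2 with rfl | rfl
  · exfalso
    obtain ⟨r1, rfl⟩ := hro
    obtain ⟨s1, rfl⟩ := hso
    ring_nf at hc'
    omega
  · have e1 : r ^ 2 + k ^ 2 = t ^ 2 := by linarith
    have e2 : s ^ 2 = 4 * k ^ 2 + r ^ 2 := by linarith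
    obtain ⟨m, n, f1, f2, f3⟩ := pyth_aux e1 hrk hro
    have hr2k : IsCoprime r (2 * k) := by
      refine IsCoprime.mul_right ?_ hrk
      obtain ⟨j, hj⟩ := hro
      exact ⟨1, -j, by rw [hj]; ring⟩
    obtain ⟨m', n', g1, g2, g3⟩ := pyth_aux (x := r) (y := 2 * k) (z := s) (by linarith) hr2k hro
    have g4 : k = m' * n' := by linarith
    have hmn : m' * n' ≠ 0 := g4 ▸ hk
    refine ⟨m', n', m, n, left_ne_zero_of_mul hmn, right_ne_zero_of_mul hmn, g3, f3, ?_, ?_, ?_⟩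
    · linarith
    · linarith
    · rw [← g4]
      simp only [Int.natAbs_mul]
      have p1 : 0 < r.natAbs := Int.natAbs_pos.mpr hr
      have p2 : 0 < s.natAbs := Int.natAbs_pos.mpr hs
      have p3 : 0 < t.natAbs := Int.natAbs_pos.mpr ht
      have p4 : 0 < k.natAbs := Int.natAbs_pos.mpr hk
      have : 0 < r.natAbs * s.natAbs * t.natAbs := by positivity
      have e : r.natAbs * s.natAbs * ((2 : ℤ).natAbs * (t.natAbs * k.natAbs)) =
        (r.natAbs * s.natAbs * t.natAbs) * (2 * k.natAbs) := by
        have h22 : (2 : ℤ).natAbs = 2 := rfl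
        rw [h22]; ring
      rw [e]
      nlinarith

lemma desc : ∀ (N : ℕ) (x y a b : ℤ), (x * y).natAbs = N → x ≠ 0 → y ≠ 0 →
    IsCoprime x y → IsCoprime a b → x * y = 2 * (a * b) → x ^ 2 - y ^ 2 = a ^ 2 - b ^ 2 →
    False := by
  intro N
  induction N using Nat.strong_induction_on with
  | _ N ih =>
    intro x y a b hN hx hy hxy hab h1 h2
    rcases Int.even_or_odd x with hxe | hxo
    · have hyo : Odd y := by
        by_contra hy'
        have hye := Int.not_odd_iff_even.mp hy'
        have := hxy.isUnit_of_dvd' hxe.two_dvd hye.two_dvd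
        rw [Int.isUnit_iff] at this
        omega
      obtain ⟨x', y', a', b', q1, q2, q3, q4, q5, q6, q7⟩ :=
        desc_step hyo hy hx hxy.symm hab.symm (by linarith) (by linarith)
      rw [mul_comm y x, hN] at q7
      exact ih _ q7 x' y' a' b' rfl q1 q2 q3 q4 q5 q6
    · obtain ⟨x', y', a', b', q1, q2, q3, q4, q5, q6, q7⟩ :=
        desc_step hxo hx hy hxy hab h1 h2
      rw [hN] at q7
      exact ih _ q7 x' y' a' b' rfl q1 q2 q3 q4 q5 q6

lemma euler_int {x y z : ℤ} (hx : x ≠ 0) (hy : y ≠ 0) (hxy : IsCoprime x y)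
    (h : x ^ 4 - x ^ 2 * y ^ 2 + y ^ 4 = z ^ 2) : x ^ 2 = y ^ 2 := by
  by_contra hne
  have hcop : IsCoprime (x ^ 2 - y ^ 2) (x * y) := by
    apply IsCoprime.mul_right
    · have : IsCoprime (-(y ^ 2)) x := (hxy.symm.pow_left).neg_left
      have h' := this.add_mul_left_left x
      have e : -(y ^ 2) + x * x = x ^ 2 - y ^ 2 := by ring
      rwa [e] at h'
    · have : IsCoprime (x ^ 2) y := hxy.pow_left
      have h' := this.add_mul_left_left (-y)
      have e : x ^ 2 + y * (-y) = x ^ 2 - y ^ 2 := by ring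
      rwa [e] at h'
  rcases Int.even_or_odd (x * y) with he | ho
  · have hodd : Odd (x ^ 2 - y ^ 2) := by
      by_contra hy'
      have hye := Int.not_odd_iff_even.mp hy'
      have := hcop.isUnit_of_dvd' hye.two_dvd he.two_dvd
      rw [Int.isUnit_iff] at this
      omega
    obtain ⟨m, n, f1, f2, f3⟩ := pyth_aux (z := z) (by linarith) hcop hodd
    exact desc _ x y m n rfl hx hy hxy f3 (by linarith) f1
  · obtain ⟨m, n, f1, f2, f3⟩ := pyth_aux (z := z) (by linarith) hcop.symm ho
    have hxo := (Int.odd_mul.mp ho).1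
    have hyo := (Int.odd_mul.mp ho).2
    obtain ⟨M, hM⟩ := hxo.add_odd hyo
    obtain ⟨N, hN⟩ := hxo.sub_odd hyo
    have ex : x = M + N := by linarith
    have ey : y = M - N := by linarith
    subst ex ey
    have hMN : IsCoprime M N := by
      obtain ⟨u, v, huv⟩ := hxy
      exact ⟨u + v, u - v, by linear_combination huv⟩
    have hmn : m * n = 2 * (M * N) := by linarith
    have hmn0 : m * n ≠ 0 := by
      intro h0
      apply hne
      linarith
    exact desc _ m n M N rfl (left_ne_zero_of_mul hmn0) (right_ne_zero_of_mul hmn0) f3 hMN hmn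
      (by linarith)

lemma euler_rat {x y z : ℚ} (hx : x ≠ 0) (hy : y ≠ 0)
    (h : x ^ 4 - x ^ 2 * y ^ 2 + y ^ 4 = z ^ 2) : x ^ 2 = y ^ 2 := by
  set w : ℚ := x / y with hw
  have hw0 : w ≠ 0 := div_ne_zero hx hy
  have hxw : x = w * y := by rw [hw]; field_simp
  have hd : (w.den : ℚ) ≠ 0 := by exact_mod_cast w.den_nz
  have hnd : w * w.den = w.num := Rat.mul_den_eq_num w
  have key : IsSquare (w.num ^ 4 - w.num ^ 2 * (w.den : ℤ) ^ 2 + (w.den : ℤ) ^ 4) := by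
    rw [← Rat.isSquare_intCast_iff]
    refine ⟨z / y ^ 2 * w.den ^ 2, ?_⟩
    push_cast
    rw [← hnd]
    have : z / y ^ 2 * w.den ^ 2 * (z / y ^ 2 * w.den ^ 2) = z ^ 2 / y ^ 4 * w.den ^ 4 := by
      field_simp
    rw [this, ← h, hxw]
    field_simp
  obtain ⟨Z, hZ⟩ := key
  have hcop : IsCoprime w.num (w.den : ℤ) := Rat.isCoprime_num_den w
  have := euler_int (z := Z) (Rat.num_ne_zero.mpr hw0) (by exact_mod_cast w.den_nz) hcop
    (by rw [hZ, sq])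
  have h2 : (w.num : ℚ) ^ 2 = (w.den : ℚ) ^ 2 := by exact_mod_cast this
  rw [← hnd, mul_pow] at h2
  have h3 : w ^ 2 = 1 := by
    apply mul_right_cancel₀ (pow_ne_zero 2 hd); linarith
  rw [hxw, mul_pow, h3, one_mul]

lemma quartic_rat {l m s : ℚ} (hs : s ≠ 0)
    (h : l * m * (m - 2 * l) * (l - 2 * m) = s ^ 2) : m = l ∨ m = -l := by
  have hne : l * m * (m - 2 * l) * (l - 2 * m) ≠ 0 := by rw [h]; positivity
  have hA : l * (l - 2 * m) ≠ 0 := by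
    intro h0; apply hne; linear_combination (m * (m - 2 * l)) * h0
  have := euler_rat (x := l * (l - 2 * m)) (y := s) (z := l * (l - 2 * m) * (l ^ 2 - l * m + m ^ 2))
    hA hs (by
      have : s ^ 4 = (s ^ 2) ^ 2 := by ring
      rw [this, ← h]; ring)
  rw [← h] at this
  have h2 : l * (l - 2 * m) * ((m - l) * (m + l)) = 0 := by linear_combination -this
  rcases mul_eq_zero.mp ((mul_eq_zero.mp h2).resolve_left hA) with h | h
  · left; linarith
  · right; linarith

lemma quad_struct (K : Type*) [Field K] [Algebra ℚ K] [CharZero K]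
    (hdeg : Module.finrank ℚ K = 2) :
    ∃ (δ : K) (D : ℚ), δ ^ 2 = (D : K) ∧ (∀ p q : ℚ, (p : K) + q * δ = 0 → p = 0 ∧ q = 0) ∧
      ∀ x : K, ∃ p q : ℚ, x = p + q * δ := by
  have hex : ∃ θ : K, ∀ c : ℚ, (c : K) ≠ θ := by
    by_contra hcon
    push Not at hcon
    have : Module.finrank ℚ K = 1 := by
      rw [finrank_eq_one_iff_of_nonzero' (1 : K) one_ne_zero]
      intro w
      obtain ⟨c, hc⟩ := hcon w
      exact ⟨c, by rw [Algebra.smul_def, eq_ratCast, mul_one, hc]⟩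
    omega
  obtain ⟨θ, hθ⟩ := hex
  have hind : ∀ p q : ℚ, (p : K) + q * θ = 0 → p = 0 ∧ q = 0 := by
    intro p q h
    have hq : q = 0 := by
      by_contra hq
      apply hθ (-p / q)
      have : (q : K) ≠ 0 := by exact_mod_cast hq
      push_cast
      field_simp
      linear_combination -h
    subst hq
    simp at h
    exact ⟨h, rfl⟩
  have hli : LinearIndependent ℚ ![(1 : K), θ] := by
    rw [LinearIndependent.pair_iff]
    intro s t hst
    rw [Algebra.smul_def, Algebra.smul_def, eq_ratCast, eq_ratCast, mul_one] at hst
    exact hind s t hst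
  have hspan := hli.span_eq_top_of_card_eq_finrank (by simp [hdeg])
  have hrep : ∀ x : K, ∃ p q : ℚ, x = p + q * θ := by
    intro x
    have hx : x ∈ Submodule.span ℚ (Set.range ![(1 : K), θ]) := by rw [hspan]; trivial
    rw [Matrix.range_cons, Matrix.range_cons, Matrix.range_empty, Set.union_empty,
      Set.singleton_union, Submodule.mem_span_pair] at hx
    obtain ⟨a, b, hab⟩ := hx
    rw [Algebra.smul_def, Algebra.smul_def, eq_ratCast, eq_ratCast, mul_one] at hab
    exact ⟨a, b, hab.symm⟩
  obtain ⟨a, b, hab⟩ := hrep (θ ^ 2)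
  refine ⟨θ - ((b / 2 : ℚ) : K), a + b ^ 2 / 4, ?_, ?_, ?_⟩
  · push_cast
    linear_combination hab
  · intro p q h
    have := hind (p - q * (b / 2)) q (by push_cast at h ⊢; linear_combination h)
    obtain ⟨h1, h2⟩ := this
    subst h2
    simp at h1
    exact ⟨h1, rfl⟩
  · intro x
    obtain ⟨p, q, hpq⟩ := hrep x
    exact ⟨p + q * (b / 2), q, by rw [hpq]; push_cast; ring⟩

section
variable {K : Type*} [Field K] [CharZero K]

lemma prop_aux {δ : K} {p q p' q' : ℚ} (hY : (p' : K) + q' * δ ≠ 0) (h : p * q' = q * p') :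
    ∃ k : ℚ, (p : K) + q * δ = k * (p' + q' * δ) := by
  by_cases hp : p' = 0
  · have hq : q' ≠ 0 := by
      rintro rfl; simp [hp] at hY
    have hp0 : p = 0 := by
      subst hp; simpa [hq] using h
    refine ⟨q / q', ?_⟩
    have : (q' : K) ≠ 0 := by exact_mod_cast hq
    subst hp hp0
    push_cast; field_simp; ring
  · refine ⟨p / p', ?_⟩
    have : (p' : K) ≠ 0 := by exact_mod_cast hp
    have h' : (p : K) * q' = q * p' := by exact_mod_cast h
    push_cast; field_simp; linear_combination -δ * h'

lemma deg_aux {δ d : K} (hd : d ≠ 0) {p q p' q' n : ℚ} (hn : n ≠ 0) (h : p * q' = q * p')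
    (hs : ((p' : K) + q' * δ) ^ 2 = (p + q * δ) ^ 2 + n * d) :
    ∃ c : ℚ, ((p' : K) + q' * δ) ^ 2 = c * d := by
  by_cases hY : (p' : K) + q' * δ = 0
  · exact ⟨0, by rw [hY]; simp⟩
  · obtain ⟨k, hk⟩ := prop_aux hY h
    rw [hk] at hs
    have hn' : (n : K) ≠ 0 := by exact_mod_cast hn
    set Y : K := (p' : K) + q' * δ
    have hk1 : (1 - k ^ 2 : ℚ) ≠ 0 := by
      intro h0
      have h0' : (1 : K) - (k : K) ^ 2 = 0 := by exact_mod_cast h0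
      apply mul_ne_zero hn' hd
      linear_combination -hs + Y ^ 2 * h0'
    have hk2 : (1 : K) - (k : K) ^ 2 ≠ 0 := by exact_mod_cast hk1
    refine ⟨n / (1 - k ^ 2), ?_⟩
    push_cast
    field_simp
    linear_combination hs

/-- ruling for the form `(1,-1,-1,1)` -/
lemma case_one {x₀ x₁ x₂ x₃ d : K} (hd : d ≠ 0) (h1 : x₁ ^ 2 = x₀ ^ 2 + d)
    (h2 : x₂ ^ 2 = x₀ ^ 2 + 2 * d) (h3 : x₃ ^ 2 = x₀ ^ 2 + 3 * d) (k : ℚ)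
    (hk : x₀ - x₁ = k * (x₂ - x₃)) : ∃ c : ℚ, (x₀ ^ 2 + x₃ ^ 2) ^ 2 = c * d ^ 2 := by
  have hW : x₂ - x₃ ≠ 0 := by
    intro h0; apply hd; linear_combination h2 - h3 - (x₂ + x₃) * h0
  have hZ : x₂ + x₃ = k * (x₀ + x₁) := by
    apply mul_left_cancel₀ hW
    linear_combination (x₀ + x₁) * hk + h1 + h2 - h3
  obtain ⟨S, hS⟩ : ∃ S, S = x₀ + x₁ := ⟨_, rfl⟩
  obtain ⟨W, hW'⟩ : ∃ W, W = x₂ - x₃ := ⟨_, rfl⟩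
  rw [← hS] at hZ
  rw [← hW'] at hk
  have e0 : x₀ = (S + k * W) / 2 := by linear_combination (hk - hS) / 2
  have e1 : x₁ = (S - k * W) / 2 := by linear_combination (-hk - hS) / 2
  have e2 : x₂ = (k * S + W) / 2 := by linear_combination (hZ - hW') / 2
  have e3 : x₃ = (k * S - W) / 2 := by linear_combination (hZ + hW') / 2
  have ed : d = - (k * S * W) := by
    have : d = x₁ ^ 2 - x₀ ^ 2 := by linear_combination -h1
    rw [this, e0, e1]; ring
  have hkSW : (k : K) * S * W ≠ 0 := by rw [ed] at hd; exact neg_ne_zero.mp hd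
  have rel : ((k : K) ^ 2 - 1) * (S ^ 2 - W ^ 2) = -8 * (k * S * W) := by
    have : x₀ ^ 2 + x₂ ^ 2 - 2 * x₁ ^ 2 = 0 := by linear_combination h2 - 2 * h1
    rw [e0, e1, e2] at this
    linear_combination 4 * this
  have hk1 : (k : K) ^ 2 - 1 ≠ 0 := by
    intro h0
    rw [h0] at rel
    apply hkSW
    linear_combination rel / 8
  have hk0 : (k : K) ≠ 0 := by
    intro h0; apply hkSW; rw [h0]; ring
  refine ⟨(1 + k ^ 2) ^ 2 / 16 * (64 / (k ^ 2 - 1) ^ 2 + 4 / k ^ 2), ?_⟩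
  rw [e0, e3, ed]
  push_cast
  field_simp
  linear_combination 16 * (1 + (k : K) ^ 2) ^ 2 * (((k : K) ^ 2 - 1) * (S ^ 2 - W ^ 2)
    - 8 * (k * S * W)) * rel

lemma case_neg {x₀ x₁ x₂ x₃ d : K} (hd : d ≠ 0) (h1 : x₁ ^ 2 = x₀ ^ 2 + d)
    (h2 : x₂ ^ 2 = x₀ ^ 2 + 2 * d) (h3 : x₃ ^ 2 = x₀ ^ 2 + 3 * d) (k : ℚ)
    (hk : x₀ - x₃ = k * (x₁ - x₂)) : ∃ c : ℚ, (x₀ ^ 2 + x₃ ^ 2) ^ 2 = c * d ^ 2 := by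
  have hW : x₁ - x₂ ≠ 0 := by
    intro h0; apply hd; linear_combination h1 - h2 - (x₁ + x₂) * h0
  have hZ : 3 * (x₁ + x₂) = k * (x₀ + x₃) := by
    apply mul_left_cancel₀ hW
    linear_combination (x₀ + x₃) * hk + 3 * h1 - 3 * h2 + h3
  obtain ⟨V, hV⟩ : ∃ V, V = x₀ + x₃ := ⟨_, rfl⟩
  obtain ⟨W, hW'⟩ : ∃ W, W = x₁ - x₂ := ⟨_, rfl⟩
  rw [← hV] at hZ
  rw [← hW'] at hk
  have e0 : x₀ = (V + k * W) / 2 := by linear_combination (hk - hV) / 2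
  have e3 : x₃ = (V - k * W) / 2 := by linear_combination (-hk - hV) / 2
  have e1 : x₁ = (k * V / 3 + W) / 2 := by linear_combination (hZ / 3 - hW') / 2
  have e2 : x₂ = (k * V / 3 - W) / 2 := by linear_combination (hZ / 3 + hW') / 2
  have ed : d = - (k * V * W) / 3 := by
    have : d = (x₃ ^ 2 - x₀ ^ 2) / 3 := by linear_combination -h3 / 3
    rw [this, e0, e3]; ring
  have hkVW : (k : K) * V * W ≠ 0 := by
    intro h0; apply hd; rw [ed, h0]; simp
  have hk0 : (k : K) ≠ 0 := by
    intro h0; apply hkVW; rw [h0]; ring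
  have hW0 : W ≠ 0 := by
    intro h0; apply hkVW; rw [h0]; ring
  have hV0 : V ≠ 0 := by
    intro h0; apply hkVW; rw [h0]; ring
  have rel : (9 - (k : K) ^ 2) * V ^ 2 = 9 * (1 - k ^ 2) * W ^ 2 := by
    have : x₀ ^ 2 + x₃ ^ 2 - x₁ ^ 2 - x₂ ^ 2 = 0 := by linear_combination h3 - h1 - h2
    rw [e0, e1, e2, e3] at this
    linear_combination 18 * this
  have hk9 : (9 - (k : K) ^ 2) ≠ 0 := by
    intro h0
    have h9 : (k : K) ^ 2 = 9 := by linear_combination -h0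
    rw [h9] at rel
    norm_num at rel
    exact hW0 rel
  have hk1 : (1 - (k : K) ^ 2) ≠ 0 := by
    intro h0
    rw [h0] at rel
    have : (9 - (k : K) ^ 2) * V ^ 2 ≠ 0 := mul_ne_zero hk9 (pow_ne_zero _ hV0)
    apply this; rw [rel]; ring
  have hV2 : V ^ 2 = 9 * (1 - k ^ 2) / (9 - k ^ 2) * W ^ 2 := by
    field_simp; linear_combination rel
  refine ⟨(9 * (1 - k ^ 2) / (9 - k ^ 2) + k ^ 2) ^ 2 * 9 / (4 * k ^ 2 *
    (9 * (1 - k ^ 2) / (9 - k ^ 2))), ?_⟩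
  have l1 : x₀ ^ 2 + x₃ ^ 2 = (V ^ 2 + k ^ 2 * W ^ 2) / 2 := by rw [e0, e3]; ring
  have l2 : d ^ 2 = k ^ 2 * V ^ 2 * W ^ 2 / 9 := by rw [ed]; ring
  rw [l1, l2, hV2]
  push_cast
  field_simp
  ring

lemma main_aux {δ : K} {D : ℚ} (hδ : δ ^ 2 = (D : K))
    (hind : ∀ p q : ℚ, (p : K) + q * δ = 0 → p = 0 ∧ q = 0)
    {x₀ x₁ x₂ x₃ d : K} (hd : d ≠ 0) (h1 : x₁ ^ 2 = x₀ ^ 2 + d)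
    (h2 : x₂ ^ 2 = x₀ ^ 2 + 2 * d) (h3 : x₃ ^ 2 = x₀ ^ 2 + 3 * d)
    {p₀ p₁ p₂ p₃ q₀ q₁ q₂ q₃ : ℚ}
    (e0 : x₀ = p₀ + q₀ * δ) (e1 : x₁ = p₁ + q₁ * δ) (e2 : x₂ = p₂ + q₂ * δ)
    (e3 : x₃ = p₃ + q₃ * δ) : ∃ c : ℚ, (x₀ ^ 2 + x₃ ^ 2) ^ 2 = c * d ^ 2 := by
  -- degenerate cases
  have fin : ∀ (j c : ℚ) (y : K), y ^ 2 = x₀ ^ 2 + j * d → y ^ 2 = c * d →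
      ∃ c : ℚ, (x₀ ^ 2 + x₃ ^ 2) ^ 2 = c * d ^ 2 := by
    intro j c y hy hc
    refine ⟨(2 * c + 3 - 2 * j) ^ 2, ?_⟩
    have : x₀ ^ 2 + x₃ ^ 2 = (2 * c + 3 - 2 * j) * d := by linear_combination h3 - 2 * hy + 2 * hc
    rw [this]; push_cast; ring
  by_cases z01 : p₀ * q₁ = q₀ * p₁
  · obtain ⟨c, hc⟩ := deg_aux (δ := δ) hd (n := 1) (by norm_num) z01
      (by rw [← e0, ← e1]; push_cast; linear_combination h1)
    exact fin 1 c x₁ (by push_cast; linear_combination h1) (by rw [e1]; exact hc)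
  by_cases z02 : p₀ * q₂ = q₀ * p₂
  · obtain ⟨c, hc⟩ := deg_aux (δ := δ) hd (n := 2) (by norm_num) z02
      (by rw [← e0, ← e2]; push_cast; linear_combination h2)
    exact fin 2 c x₂ (by push_cast; linear_combination h2) (by rw [e2]; exact hc)
  by_cases z12 : p₁ * q₂ = q₁ * p₂
  · obtain ⟨c, hc⟩ := deg_aux (δ := δ) hd (n := 1) (by norm_num) z12
      (by rw [← e1, ← e2]; push_cast; linear_combination h2 - h1)
    exact fin 2 c x₂ (by push_cast; linear_combination h2) (by rw [e2]; exact hc)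
  by_cases z23 : p₂ * q₃ = q₂ * p₃
  · obtain ⟨c, hc⟩ := deg_aux (δ := δ) hd (n := 1) (by norm_num) z23
      (by rw [← e2, ← e3]; push_cast; linear_combination h3 - h2)
    exact fin 3 c x₃ (by push_cast; linear_combination h3) (by rw [e3]; exact hc)
  -- the two quadrics
  obtain ⟨f1, f2⟩ := hind (p₀ ^ 2 - 2 * p₁ ^ 2 + p₂ ^ 2 + D * (q₀ ^ 2 - 2 * q₁ ^ 2 + q₂ ^ 2))
    (2 * (p₀ * q₀ - 2 * p₁ * q₁ + p₂ * q₂)) (by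
      have : x₀ ^ 2 - 2 * x₁ ^ 2 + x₂ ^ 2 = 0 := by linear_combination h2 - 2 * h1
      rw [e0, e1, e2] at this
      push_cast
      rw [← hδ]
      linear_combination this)
  obtain ⟨g1, g2⟩ := hind (p₁ ^ 2 - 2 * p₂ ^ 2 + p₃ ^ 2 + D * (q₁ ^ 2 - 2 * q₂ ^ 2 + q₃ ^ 2))
    (2 * (p₁ * q₁ - 2 * p₂ * q₂ + p₃ * q₃)) (by
      have : x₁ ^ 2 - 2 * x₂ ^ 2 + x₃ ^ 2 = 0 := by linear_combination h3 - 2 * h2 + h1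
      rw [e1, e2, e3] at this
      push_cast
      rw [← hδ]
      linear_combination this)
  have hD : D ≠ 0 := by
    rintro rfl
    have hδ0 : δ = 0 := by simpa using hδ
    have := hind 0 1 (by rw [hδ0]; simp)
    exact one_ne_zero this.2
  obtain ⟨l, m, hlm, hp⟩ : ∃ l m : ℚ, (l ≠ 0 ∨ m ≠ 0) ∧
      l * (p₀ ^ 2 - 2 * p₁ ^ 2 + p₂ ^ 2) + m * (p₁ ^ 2 - 2 * p₂ ^ 2 + p₃ ^ 2) = 0 := by
    by_cases h0 : p₁ ^ 2 - 2 * p₂ ^ 2 + p₃ ^ 2 = 0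
    · exact ⟨0, 1, by simp, by rw [h0]; ring⟩
    · exact ⟨p₁ ^ 2 - 2 * p₂ ^ 2 + p₃ ^ 2, -(p₀ ^ 2 - 2 * p₁ ^ 2 + p₂ ^ 2), Or.inl h0, by ring⟩
  have hq : l * (q₀ ^ 2 - 2 * q₁ ^ 2 + q₂ ^ 2) + m * (q₁ ^ 2 - 2 * q₂ ^ 2 + q₃ ^ 2) = 0 := by
    apply mul_left_cancel₀ hD
    linear_combination l * f1 + m * g1 - hp
  have hpq : l * (p₀ * q₀ - 2 * p₁ * q₁ + p₂ * q₂) + m * (p₁ * q₁ - 2 * p₂ * q₂ + p₃ * q₃) = 0 := by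
    linear_combination l * f2 / 2 + m * g2 / 2
  obtain ⟨b, hb⟩ : ∃ b, b = m - 2 * l := ⟨_, rfl⟩
  obtain ⟨c, hc⟩ := (⟨_, rfl⟩ : ∃ c, c = l - 2 * m)
  have Pp : l * p₀ ^ 2 + b * p₁ ^ 2 + c * p₂ ^ 2 + m * p₃ ^ 2 = 0 := by
    rw [hb, hc]; linear_combination hp
  have Pq : l * q₀ ^ 2 + b * q₁ ^ 2 + c * q₂ ^ 2 + m * q₃ ^ 2 = 0 := by
    rw [hb, hc]; linear_combination hq
  have Ppq : l * p₀ * q₀ + b * p₁ * q₁ + c * p₂ * q₂ + m * p₃ * q₃ = 0 := by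
    rw [hb, hc]; linear_combination hpq
  have k01 : l * b * (p₀ * q₁ - q₀ * p₁) ^ 2 = c * m * (p₂ * q₃ - q₂ * p₃) ^ 2 := by
    linear_combination (l * q₀ ^ 2 + b * q₁ ^ 2) * Pp - (c * p₂ ^ 2 + m * p₃ ^ 2) * Pq
      - (l * p₀ * q₀ + b * p₁ * q₁ - c * p₂ * q₂ - m * p₃ * q₃) * Ppq
  have w01 := sub_ne_zero.mpr z01
  have w23 := sub_ne_zero.mpr z23
  have hprod : l * m * (m - 2 * l) * (l - 2 * m) =
      (l * b * (p₀ * q₁ - q₀ * p₁) / (p₂ * q₃ - q₂ * p₃)) ^ 2 := by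
    rw [← hb, ← hc]
    field_simp
    linear_combination -(l * b) * k01
  -- nonvanishing
  have hlb : l * b ≠ 0 := by
    intro h0
    rw [h0] at k01
    have hcm : c * m = 0 := by
      have : c * m * (p₂ * q₃ - q₂ * p₃) ^ 2 = 0 := by rw [← k01]; ring
      exact (mul_eq_zero.mp this).resolve_right (pow_ne_zero _ w23)
    rcases mul_eq_zero.mp h0 with hl | hb0 <;> rcases mul_eq_zero.mp hcm with hc0 | hm <;>
      rcases hlm with h | h <;> apply h <;> linarith
  have hs : l * b * (p₀ * q₁ - q₀ * p₁) / (p₂ * q₃ - q₂ * p₃) ≠ 0 :=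
    div_ne_zero (mul_ne_zero hlb w01) w23
  have hl : l ≠ 0 := left_ne_zero_of_mul hlb
  rcases quartic_rat hs hprod with rfl | rfl
  · have hp' : p₀ ^ 2 - p₁ ^ 2 - p₂ ^ 2 + p₃ ^ 2 = 0 := by
      apply mul_left_cancel₀ hl; linear_combination hp
    have hq' : q₀ ^ 2 - q₁ ^ 2 - q₂ ^ 2 + q₃ ^ 2 = 0 := by
      apply mul_left_cancel₀ hl; linear_combination hq
    have hpq' : p₀ * q₀ - p₁ * q₁ - p₂ * q₂ + p₃ * q₃ = 0 := by
      apply mul_left_cancel₀ hl; linear_combination hpq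
    have hmul : ((p₀ - p₁) * (q₂ - q₃) - (q₀ - q₁) * (p₂ - p₃)) *
        ((p₀ - p₁) * (q₂ + q₃) - (q₀ - q₁) * (p₂ + p₃)) = 0 := by
      linear_combination -(p₀ - p₁) ^ 2 * hq' + 2 * (p₀ - p₁) * (q₀ - q₁) * hpq'
        - (q₀ - q₁) ^ 2 * hp'
    rcases mul_eq_zero.mp hmul with h | h
    · have hW : x₂ - x₃ ≠ 0 := by
        intro h0; apply hd; linear_combination h2 - h3 - (x₂ + x₃) * h0
      obtain ⟨k, hk⟩ := prop_aux (δ := δ) (p := p₀ - p₁) (q := q₀ - q₁) (p' := p₂ - p₃)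
        (q' := q₂ - q₃) (by
          intro h0; apply hW; rw [e2, e3]; push_cast at h0; linear_combination h0) (by linarith)
      refine case_one hd h1 h2 h3 k ?_
      rw [e0, e1, e2, e3]; push_cast at hk; linear_combination hk
    · have hW : x₂ + x₃ ≠ 0 := by
        intro h0; apply hd; linear_combination h2 - h3 - (x₂ - x₃) * h0
      obtain ⟨k, hk⟩ := prop_aux (δ := δ) (p := p₀ - p₁) (q := q₀ - q₁) (p' := p₂ + p₃)
        (q' := q₂ + q₃) (by
          intro h0; apply hW; rw [e2, e3]; push_cast at h0; linear_combination h0) (by linarith)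
      have := case_one (x₃ := -x₃) hd h1 h2 (by linear_combination h3) k (by
        rw [e0, e1, e2, e3]; push_cast at hk; linear_combination hk)
      simpa using this
  · have hp' : p₀ ^ 2 - 3 * p₁ ^ 2 + 3 * p₂ ^ 2 - p₃ ^ 2 = 0 := by
      apply mul_left_cancel₀ hl; linear_combination hp
    have hq' : q₀ ^ 2 - 3 * q₁ ^ 2 + 3 * q₂ ^ 2 - q₃ ^ 2 = 0 := by
      apply mul_left_cancel₀ hl; linear_combination hq
    have hpq' : p₀ * q₀ - 3 * p₁ * q₁ + 3 * p₂ * q₂ - p₃ * q₃ = 0 := by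
      apply mul_left_cancel₀ hl; linear_combination hpq
    have hmul : ((p₀ - p₃) * (q₁ - q₂) - (q₀ - q₃) * (p₁ - p₂)) *
        ((p₀ - p₃) * (q₁ + q₂) - (q₀ - q₃) * (p₁ + p₂)) = 0 := by
      linear_combination (-(p₀ - p₃) ^ 2 * hq' + 2 * (p₀ - p₃) * (q₀ - q₃) * hpq'
        - (q₀ - q₃) ^ 2 * hp') / 3
    rcases mul_eq_zero.mp hmul with h | h
    · have hW : x₁ - x₂ ≠ 0 := by
        intro h0; apply hd; linear_combination h1 - h2 - (x₁ + x₂) * h0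
      obtain ⟨k, hk⟩ := prop_aux (δ := δ) (p := p₀ - p₃) (q := q₀ - q₃) (p' := p₁ - p₂)
        (q' := q₁ - q₂) (by
          intro h0; apply hW; rw [e1, e2]; push_cast at h0; linear_combination h0) (by linarith)
      refine case_neg hd h1 h2 h3 k ?_
      rw [e0, e1, e2, e3]; push_cast at hk; linear_combination hk
    · have hW : x₁ + x₂ ≠ 0 := by
        intro h0; apply hd; linear_combination h1 - h2 - (x₁ - x₂) * h0
      obtain ⟨k, hk⟩ := prop_aux (δ := δ) (p := p₀ - p₃) (q := q₀ - q₃) (p' := p₁ + p₂)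
        (q' := q₁ + q₂) (by
          intro h0; apply hW; rw [e1, e2]; push_cast at h0; linear_combination h0) (by linarith)
      exact case_neg (x₂ := -x₂) hd h1 (by linear_combination h2) h3 k (by
        rw [e0, e1, e2, e3]; push_cast at hk; linear_combination hk)

lemma sqrt_aux {δ : K} {D : ℚ} (hδ : δ ^ 2 = (D : K))
    (hind : ∀ p q : ℚ, (p : K) + q * δ = 0 → p = 0 ∧ q = 0)
    {n p q : ℚ} (hn : ¬ IsSquare n) (h : ((p : K) + q * δ) ^ 2 = n) : D * q ^ 2 = n := by
  obtain ⟨f1, f2⟩ := hind (p ^ 2 + D * q ^ 2 - n) (2 * (p * q)) (by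
    push_cast; rw [← hδ]; linear_combination h)
  have hpq : p * q = 0 := by linarith
  rcases mul_eq_zero.mp hpq with rfl | rfl
  · linarith
  · exact absurd ⟨p, by linarith⟩ hn

lemma not_two_three {δ : K} {D : ℚ} (hδ : δ ^ 2 = (D : K))
    (hind : ∀ p q : ℚ, (p : K) + q * δ = 0 → p = 0 ∧ q = 0)
    (hrep : ∀ x : K, ∃ p q : ℚ, x = p + q * δ) {u v : K} (hu : u ^ 2 = 2) (hv : v ^ 2 = 3) :
    False := by
  have n2 : ¬ IsSquare (2 : ℚ) := by norm_num
  have n3 : ¬ IsSquare (3 : ℚ) := by norm_num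
  have n6 : ¬ IsSquare (6 : ℚ) := by norm_num
  obtain ⟨p, q, rfl⟩ := hrep u
  obtain ⟨p', q', rfl⟩ := hrep v
  have h2 := sqrt_aux hδ hind n2 (by rw [hu]; norm_num)
  have h3 := sqrt_aux hδ hind n3 (by rw [hv]; norm_num)
  exact n6 ⟨D * q * q', by linear_combination -(D * q' ^ 2) * h2 - 2 * h3⟩

end

/-- **Four squares in arithmetic progression over a quadratic field.**
If `K/ℚ` is a quadratic extension and `x₀, x₁, x₂, x₃ ∈ K`, not all zero, are such that
`x₀², x₁², x₂², x₃²` form an arithmetic progression, then `x₀ ≠ 0` and, setting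
`q := (x₁/x₀)² − 1`, either `q = 0` or `(3q+2)²/q²` lies in the image of `ℚ` in `K`. -/
theorem four_squares_AP_quadratic_field
    (K : Type*) [Field K] [Algebra ℚ K] (hdeg : Module.finrank ℚ K = 2)
    (x₀ x₁ x₂ x₃ : K)
    (hnz : ¬ (x₀ = 0 ∧ x₁ = 0 ∧ x₂ = 0 ∧ x₃ = 0))
    (hAP : x₁ ^ 2 - x₀ ^ 2 = x₂ ^ 2 - x₁ ^ 2 ∧ x₂ ^ 2 - x₁ ^ 2 = x₃ ^ 2 - x₂ ^ 2) :
    x₀ ≠ 0 ∧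
      (((x₁ / x₀) ^ 2 - 1 = 0) ∨
        (3 * ((x₁ / x₀) ^ 2 - 1) + 2) ^ 2 / ((x₁ / x₀) ^ 2 - 1) ^ 2 ∈
          Set.range (algebraMap ℚ K)) := by
  have : CharZero K := algebraRat.charZero K
  obtain ⟨δ, D, hδ, hind, hrep⟩ := quad_struct K hdeg
  obtain ⟨hA, hB⟩ := hAP
  have hx0 : x₀ ≠ 0 := by
    intro h0
    have hx1 : x₁ ≠ 0 := by
      intro h1
      apply hnz
      have h2 : x₂ ^ 2 = 0 := by rw [h0, h1] at hA; linear_combination -hA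
      have h2' : x₂ = 0 := by simpa using h2
      have h3 : x₃ ^ 2 = 0 := by rw [h1, h2'] at hB; linear_combination -hB
      exact ⟨h0, h1, h2', by simpa using h3⟩
    refine not_two_three hδ hind hrep (u := x₂ / x₁) (v := x₃ / x₁) ?_ ?_
    · rw [div_pow, div_eq_iff (pow_ne_zero 2 hx1)]
      rw [h0] at hA; linear_combination -hA
    · rw [div_pow, div_eq_iff (pow_ne_zero 2 hx1)]
      rw [h0] at hA; linear_combination -hB - 2 * hA
  refine ⟨hx0, ?_⟩
  by_cases hd : x₁ ^ 2 - x₀ ^ 2 = 0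
  · left
    field_simp
    linear_combination hd
  · right
    obtain ⟨p₀, q₀, e0⟩ := hrep x₀
    obtain ⟨p₁, q₁, e1⟩ := hrep x₁
    obtain ⟨p₂, q₂, e2⟩ := hrep x₂
    obtain ⟨p₃, q₃, e3⟩ := hrep x₃
    obtain ⟨c, hc⟩ := main_aux hδ hind (d := x₁ ^ 2 - x₀ ^ 2) hd (by ring)
      (by linear_combination -hA) (by linear_combination -hB - 2 * hA) e0 e1 e2 e3
    refine ⟨c, ?_⟩
    rw [eq_ratCast]
    have hq : (x₁ / x₀) ^ 2 - 1 = (x₁ ^ 2 - x₀ ^ 2) / x₀ ^ 2 := by field_simp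
    have hx3 : x₃ ^ 2 = x₀ ^ 2 + 3 * (x₁ ^ 2 - x₀ ^ 2) := by linear_combination -hB - 2 * hA
    rw [hx3] at hc
    rw [hq]
    generalize x₁ ^ 2 - x₀ ^ 2 = d at hc hd ⊢
    field_simp
    linear_combination -hc
end

section
/- Let K be a field extension of ℚ of degree 2, and let x₀, x₁, x₂, x₃, x₄ ∈ K, not all zero, be such that x_i² − x_{i−1}² takes the same value for all i = 1, 2, 3, 4 (i.e. the squares x₀²,…,x₄² form an arithmetic progression in K). Then x₀ ≠ 0, and q := (x₁/x₀)² − 1 lies in the image of ℚ in K. -/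
/-- `r² - B²` and `r² - 9B²` are both squares. -/
def FSConc (r B : ℤ) : Prop := ∃ s t : ℤ, r ^ 2 - B ^ 2 = s ^ 2 ∧ r ^ 2 - 9 * B ^ 2 = t ^ 2

theorem fs_core {b c a d k : ℤ} (h1 : b ^ 2 - c ^ 2 = k * a ^ 2)
    (h2 : b ^ 2 - 9 * c ^ 2 = k * d ^ 2) (hk : k ∣ 8) :
    FSConc b c ∨ FSConc (3 * c) b ∨ FSConc (3 * a) d ∨ FSConc d a := by
  have hle : k ≤ 8 := Int.le_of_dvd (by norm_num) hk
  have hge : -k ≤ 8 := Int.le_of_dvd (by norm_num) ((neg_dvd).2 hk)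
  have : k = 1 ∨ k = 2 ∨ k = 4 ∨ k = 8 ∨ k = -1 ∨ k = -2 ∨ k = -4 ∨ k = -8 := by
    have : -8 ≤ k := by linarith
    interval_cases k <;> revert hk <;> decide
  rcases this with rfl | rfl | rfl | rfl | rfl | rfl | rfl | rfl
  · left; exact ⟨a, d, by linarith, by linarith⟩
  · right; right; left; exact ⟨2 * b, 6 * c, by linarith, by linarith⟩
  · left; exact ⟨2 * a, 2 * d, by linarith, by linarith⟩
  · right; right; left; exact ⟨b, 3 * c, by linarith, by linarith⟩
  · right; left; exact ⟨d, 3 * a, by linarith, by linarith⟩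
  · right; right; right; exact ⟨2 * c, 2 * b, by linarith, by linarith⟩
  · right; left; exact ⟨2 * d, 6 * a, by linarith, by linarith⟩
  · right; right; right; exact ⟨c, b, by linarith, by linarith⟩

theorem fs_dvd8 {b c k a d : ℤ} (hbc : IsCoprime b c) (h1 : b ^ 2 - c ^ 2 = k * a)
    (h2 : b ^ 2 - 9 * c ^ 2 = k * d) : k ∣ 8 := by
  have hc : IsCoprime (b ^ 2) (c ^ 2) := hbc.pow
  obtain ⟨u, v, huv⟩ := hc
  have e1 : 8 * c ^ 2 = k * (a - d) := by linarith
  have e2 : 8 * b ^ 2 = k * (9 * a - d) := by linarith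
  exact ⟨u * (9 * a - d) + v * (a - d), by
    linear_combination (-8) * huv + u * e2 + v * e1⟩

/-- Splitting step. -/
theorem fs_split {m n p q : ℤ} (hm : m ≠ 0) (hn : n ≠ 0) (hmn : IsCoprime m n)
    (hpq : IsCoprime (3 * p) q)
    (h1 : m * n = p * q) (h2 : m ^ 2 + n ^ 2 = 9 * p ^ 2 + q ^ 2) :
    ∃ r B : ℤ, B ≠ 0 ∧ FSConc r B ∧ |r| < m ^ 2 + n ^ 2 := by
  obtain ⟨a, b, ⟨c, rfl⟩, ⟨d, rfl⟩, rfl⟩ := exists_dvd_and_dvd_of_dvd_mul (Dvd.intro n h1)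
  have hn' : n = c * d := by
    apply mul_left_cancel₀ hm
    rw [h1]; ring
  subst hn'
  have ha : a ≠ 0 := left_ne_zero_of_mul hm
  have hb : b ≠ 0 := right_ne_zero_of_mul hm
  have hc : c ≠ 0 := left_ne_zero_of_mul hn
  have hd : d ≠ 0 := right_ne_zero_of_mul hn
  have hbc : IsCoprime b c := (hmn.of_mul_left_right).of_mul_right_left
  have had : IsCoprime a d :=
    (hpq.of_mul_left_right).of_mul_left_left.of_mul_right_right
  have key : a ^ 2 * (b ^ 2 - 9 * c ^ 2) = d ^ 2 * (b ^ 2 - c ^ 2) := by linarith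
  obtain ⟨k, hk⟩ : a ^ 2 ∣ b ^ 2 - c ^ 2 :=
    (had.pow (m := 2) (n := 2)).dvd_of_dvd_mul_left ⟨_, key.symm⟩
  have hk2 : b ^ 2 - 9 * c ^ 2 = k * d ^ 2 := by
    apply mul_left_cancel₀ (pow_ne_zero 2 ha)
    rw [key, hk]; ring
  have hk1 : b ^ 2 - c ^ 2 = k * a ^ 2 := by rw [hk]; ring
  have pa := Int.one_le_abs ha
  have pb := Int.one_le_abs hb
  have pc := Int.one_le_abs hc
  have pd := Int.one_le_abs hd
  have sq1 : ∀ x y : ℤ, 1 ≤ |x| → 1 ≤ |y| → |x| ≤ (x * y) ^ 2 := by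
    intro x y hx hy
    rw [← sq_abs, abs_mul]
    nlinarith [mul_le_mul hx hy (by norm_num) (by linarith), mul_le_mul_of_nonneg_left hy (abs_nonneg x)]
  have pos : ∀ x y : ℤ, x ≠ 0 → y ≠ 0 → 0 < (x * y) ^ 2 := by
    intro x y hx hy; positivity
  rcases fs_core hk1 hk2 (fs_dvd8 hbc hk1 hk2) with h | h | h | h
  · refine ⟨b, c, hc, h, ?_⟩
    have := sq1 b a pb pa
    have := pos c d hc hd
    rw [mul_comm a b]; linarith
  · refine ⟨3 * c, b, hb, h, ?_⟩
    have := sq1 c a pc pa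
    have := pos b d hb hd
    rw [h2, abs_mul, mul_comm a c]; norm_num; linarith [abs_nonneg c]
  · refine ⟨3 * a, d, hd, h, ?_⟩
    have := sq1 a c pa pc
    have := pos b d hb hd
    rw [h2, abs_mul]; norm_num; linarith [abs_nonneg a]
  · refine ⟨d, a, ha, h, ?_⟩
    have := sq1 d c pd pc
    have := pos a b ha hb
    rw [mul_comm c d]; linarith

theorem fs_no_conc : ∀ (N : ℕ) (r B : ℤ), r.natAbs = N → B ≠ 0 → ¬ FSConc r B := by
  intro N
  induction N using Nat.strong_induction_on with
  | _ N ih =>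
  rintro r B hr hB ⟨s, t, h1, h2⟩
  have hr0 : r ≠ 0 := by
    rintro rfl
    have := sq_nonneg s
    have : 0 < B ^ 2 := by positivity
    linarith
  by_cases hg : Int.gcd r B = 1
  swap
  ·
    obtain ⟨r', B', hg1⟩ : ∃ r' B' : ℤ, r = Int.gcd r B * r' ∧ B = Int.gcd r B * B' := by
      obtain ⟨r', h⟩ := Int.gcd_dvd_left r B
      obtain ⟨B', h'⟩ := Int.gcd_dvd_right r B
      exact ⟨r', B', h, h'⟩
    have hg0 : Int.gcd r B ≠ 0 := by
      intro h; exact hr0 (Int.gcd_eq_zero_iff.1 h).1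
    generalize Int.gcd r B = g at *
    obtain ⟨e1, e2⟩ := hg1
    have hgz : (g : ℤ) ≠ 0 := by exact_mod_cast hg0
    have d1 : (g : ℤ) ∣ s := by
      rw [← Int.pow_dvd_pow_iff (n := 2) (by norm_num)]
      exact ⟨r' ^ 2 - B' ^ 2, by rw [← h1, e1, e2]; ring⟩
    have d2 : (g : ℤ) ∣ t := by
      rw [← Int.pow_dvd_pow_iff (n := 2) (by norm_num)]
      exact ⟨r' ^ 2 - 9 * B' ^ 2, by rw [← h2, e1, e2]; ring⟩
    obtain ⟨s', rfl⟩ := d1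
    obtain ⟨t', rfl⟩ := d2
    refine ih r'.natAbs ?_ r' B' rfl ?_ ⟨s', t', ?_, ?_⟩
    · rw [← hr, e1, Int.natAbs_mul, Int.natAbs_natCast]
      have : 0 < r'.natAbs := by
        rw [Int.natAbs_pos]; rintro rfl; simp at e1; exact hr0 e1
      have : 2 ≤ g := by omega
      nlinarith
    · rintro rfl; simp at e2; exact hB e2
    · apply mul_left_cancel₀ (pow_ne_zero 2 hgz)
      rw [e1, e2] at h1; linarith
    · apply mul_left_cancel₀ (pow_ne_zero 2 hgz)
      rw [e1, e2] at h2; linarith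
  have hco : IsCoprime r B := Int.isCoprime_iff_gcd_eq_one.2 hg
  -- parity : s and t are odd
  have hst : s ^ 2 - t ^ 2 = 8 * B ^ 2 := by linarith
  have hodd : s % 2 = 1 ∧ t % 2 = 1 := by
    have hst2 : s % 2 = t % 2 := by
      have := congrArg (· % 2) hst
      rcases Int.emod_two_eq_zero_or_one s with h | h <;>
      rcases Int.emod_two_eq_zero_or_one t with h' | h' <;>
      simp [pow_two, Int.sub_emod, Int.mul_emod, h, h'] at this ⊢
    rcases Int.emod_two_eq_zero_or_one s with h | h
    · exfalso
      obtain ⟨s', rfl⟩ := Int.dvd_of_emod_eq_zero h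
      obtain ⟨t', rfl⟩ := Int.dvd_of_emod_eq_zero (hst2 ▸ h)
      have e : s' ^ 2 - t' ^ 2 = 2 * B ^ 2 := by linarith
      have hB2 : B % 2 = 0 := by
        by_contra hb
        have hb : B % 4 = 1 ∨ B % 4 = 3 := by omega
        have e4 := congrArg (· % 4) e
        have hs : s' % 4 = 0 ∨ s' % 4 = 1 ∨ s' % 4 = 2 ∨ s' % 4 = 3 := by omega
        have ht : t' % 4 = 0 ∨ t' % 4 = 1 ∨ t' % 4 = 2 ∨ t' % 4 = 3 := by omega
        rcases hb with hb | hb <;> rcases hs with hs | hs | hs | hs <;>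
          rcases ht with ht | ht | ht | ht <;>
          simp [pow_two, Int.sub_emod, Int.mul_emod, hb, hs, ht] at e4
      have hr2 : (2 : ℤ) ∣ r := by
        obtain ⟨B', rfl⟩ := Int.dvd_of_emod_eq_zero hB2
        exact Int.prime_two.dvd_of_dvd_pow (n := 2) ⟨2 * B' ^ 2 + 2 * s' ^ 2, by linarith⟩
      have := hco.isUnit_of_dvd' hr2 (Int.dvd_of_emod_eq_zero hB2)
      revert this; decide
    · exact ⟨h, hst2 ▸ h⟩
  have h3r : ¬ (3 : ℤ) ∣ r := by
    rintro ⟨r', rfl⟩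
    have h3 : ¬ (B % 3 = 0) := by
      intro h
      have := hco.isUnit_of_dvd' (Dvd.intro _ rfl) (Int.dvd_of_emod_eq_zero h)
      revert this; decide
    have e3 := congrArg (· % 3) (show 9 * r' ^ 2 = B ^ 2 + s ^ 2 by linarith)
    have hs : s % 3 = 0 ∨ s % 3 = 1 ∨ s % 3 = 2 := by omega
    have hb : B % 3 = 1 ∨ B % 3 = 2 := by omega
    rcases hb with hb | hb <;> rcases hs with hs | hs | hs <;>
      simp [pow_two, Int.add_emod, Int.mul_emod, hb, hs] at e3
  have hco3 : IsCoprime r (3 * B) :=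
    (((Int.prime_three.coprime_iff_not_dvd).2 h3r).symm).mul_right hco
  -- general coprimality
  have hcopr : ∀ x y : ℤ, IsCoprime r y → r ^ 2 = y ^ 2 + x ^ 2 → Int.gcd x y = 1 := by
    intro x y h e
    rw [← Int.isCoprime_iff_gcd_eq_one]
    have h' : IsCoprime (r ^ 2) y := h.pow_left
    have : IsCoprime (x ^ 2) y := by
      have h2 := h'.add_mul_left_left (-y)
      rwa [show r ^ 2 + y * -y = x ^ 2 by linarith] at h2
    exact (IsCoprime.pow_left_iff (by norm_num)).1 this
  have hrp : 0 < |r| := abs_pos.2 hr0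
  obtain ⟨m, n, -, em, er, gmn, -, -⟩ :=
    PythagoreanTriple.coprime_classification' (x := s) (y := B) (z := |r|)
      (by unfold PythagoreanTriple; rw [abs_mul_abs_self]; linarith)
      (hcopr s B hco (by linarith)) hodd.1 hrp
  obtain ⟨p, q, -, ep, er', gpq, -, -⟩ :=
    PythagoreanTriple.coprime_classification' (x := t) (y := 3 * B) (z := |r|)
      (by unfold PythagoreanTriple; rw [abs_mul_abs_self]; linarith)
      (hcopr t (3 * B) hco3 (by linarith)) hodd.2 hrp
  rw [← Int.isCoprime_iff_gcd_eq_one] at gmn gpq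
  have hm : m ≠ 0 := by rintro rfl; simp at em; exact hB em
  have hn : n ≠ 0 := by rintro rfl; simp at em; exact hB em
  have hpq : 3 * (m * n) = p * q := by
    rw [em] at ep; linarith
  have fin : ∃ r' B' : ℤ, B' ≠ 0 ∧ FSConc r' B' ∧ |r'| < m ^ 2 + n ^ 2 := by
    rcases Int.prime_three.dvd_or_dvd (Dvd.intro _ hpq) with ⟨p', rfl⟩ | ⟨q', rfl⟩
    · exact fs_split (p := p') (q := q) hm hn gmn gpq (by linarith) (by rw [← er, er']; ring)
    · exact fs_split (p := q') (q := p) hm hn gmn gpq.symm (by linarith) (by rw [← er, er']; ring)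
  obtain ⟨r', B', hB', hc', hlt⟩ := fin
  refine ih r'.natAbs ?_ r' B' rfl hB' hc'
  rw [← er] at hlt
  clear er er' ep em hpq
  rw [← hr]
  zify
  exact hlt

/-- The quartic `(r² - B²)(r² - 9B²) = y²`. -/
theorem fs_quartic {r B y : ℤ} (hco : IsCoprime r B) (hr : r ≠ 0) (hB : B ≠ 0)
    (h : (r ^ 2 - B ^ 2) * (r ^ 2 - 9 * B ^ 2) = y ^ 2) : y = 0 := by
  by_contra hy
  have hy2 : y ^ 2 ≠ 0 := pow_ne_zero 2 hy
  have hX : r ^ 2 - B ^ 2 ≠ 0 := by intro h0; exact hy2 (by rw [← h, h0]; ring)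
  have hY : r ^ 2 - 9 * B ^ 2 ≠ 0 := by intro h0; exact hy2 (by rw [← h, h0]; ring)
  have key : ∃ k a d : ℤ, r ^ 2 - B ^ 2 = k * a ^ 2 ∧ r ^ 2 - 9 * B ^ 2 = k * d ^ 2 := by
    generalize r ^ 2 - B ^ 2 = X at *
    generalize r ^ 2 - 9 * B ^ 2 = Y at *
    obtain ⟨g, X', Y', hg, hc, rfl, rfl⟩ : ∃ g X' Y' : ℤ, g ≠ 0 ∧ IsCoprime X' Y' ∧
        X = g * X' ∧ Y = g * Y' := by
      have hg : 0 < Int.gcd X Y := Int.gcd_pos_of_ne_zero_left _ hX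
      obtain ⟨X', Y', hc, h1, h2⟩ := Int.exists_gcd_one hg
      exact ⟨Int.gcd X Y, X', Y', by exact_mod_cast hg.ne', Int.isCoprime_iff_gcd_eq_one.2 hc,
        by rw [mul_comm]; exact h1, by rw [mul_comm]; exact h2⟩
    have : g ∣ y := by
      rw [← Int.pow_dvd_pow_iff (n := 2) (by norm_num)]
      exact ⟨X' * Y', by rw [← h]; ring⟩
    obtain ⟨z, rfl⟩ := this
    have hz : X' * Y' = z ^ 2 := by
      apply mul_left_cancel₀ (pow_ne_zero 2 hg); linarith
    have hc1 := Int.isCoprime_iff_gcd_eq_one.1 hc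
    have hc2 := Int.isCoprime_iff_gcd_eq_one.1 hc.symm
    have hzp : 0 < X' * Y' := by
      rw [hz]; have : z ≠ 0 := right_ne_zero_of_mul hy
      positivity
    obtain ⟨a, ha⟩ := Int.sq_of_gcd_eq_one hc1 hz
    obtain ⟨d, hd⟩ := Int.sq_of_gcd_eq_one hc2 (by rw [mul_comm]; exact hz)
    rcases ha with rfl | rfl <;> rcases hd with rfl | rfl
    · exact ⟨g, a, d, rfl, rfl⟩
    · nlinarith [mul_nonneg (sq_nonneg a) (sq_nonneg d)]
    · nlinarith [mul_nonneg (sq_nonneg a) (sq_nonneg d)]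
    · exact ⟨-g, a, d, by ring, by ring⟩
  obtain ⟨k, a, d, h1, h2⟩ := key
  have ha : a ≠ 0 := by rintro rfl; simp at h1; exact hX h1
  have hd : d ≠ 0 := by rintro rfl; simp at h2; exact hY h2
  rcases fs_core h1 h2 (fs_dvd8 hco h1 h2) with h | h | h | h
  · exact fs_no_conc _ _ _ rfl hB h
  · exact fs_no_conc _ _ _ rfl hr h
  · exact fs_no_conc _ _ _ rfl hd h
  · exact fs_no_conc _ _ _ rfl ha h

theorem fs_sq_of_pos {a b c : ℤ} (ha : 0 < a) (h : IsCoprime a b) (e : a * b = c ^ 2) :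
    ∃ r, a = r ^ 2 := by
  obtain ⟨r, h | h⟩ := Int.sq_of_gcd_eq_one (Int.isCoprime_iff_gcd_eq_one.1 h) e
  · exact ⟨r, h⟩
  · nlinarith [sq_nonneg r]

/-- Elliptic curve, integral version. -/
theorem fs_int {N D V : ℤ} (hD : 0 < D) (hco : IsCoprime N D)
    (h : N * D * ((N - D) * (N - 9 * D)) = V ^ 2) : V = 0 := by
  by_contra hV
  have hVp : 0 < V ^ 2 := by positivity
  have hN : 0 < N := by
    by_contra hN
    have h1 : N * D ≤ 0 := by nlinarith
    have h2 : 0 ≤ (N - D) * (N - 9 * D) := by nlinarith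
    nlinarith
  have c1 : IsCoprime N (N - D) := by
    have := hco.neg_right.add_mul_left_right 1
    rwa [show -D + N * 1 = N - D by ring] at this
  have c2 : IsCoprime D (N - D) := by
    have := hco.symm.add_mul_left_right (-1)
    rwa [show N + D * (-1) = N - D by ring] at this
  have c3 : IsCoprime D (N - 9 * D) := by
    have := hco.symm.add_mul_left_right (-9)
    rwa [show N + D * (-9) = N - 9 * D by ring] at this
  have prime3 : ∀ {x : ℤ}, ¬ (3 ∣ x) → IsCoprime 3 x := fun hx =>
    (Int.prime_three.coprime_iff_not_dvd).2 hx
  by_cases h3 : (3 : ℤ) ∣ N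
  swap
  · have c4 : IsCoprime N (N - 9 * D) := by
      have h9 : IsCoprime N ((3 : ℤ) ^ 2) := (prime3 h3).symm.pow_right
      have := (h9.mul_right hco).neg_right.add_mul_left_right 1
      rwa [show -(3 ^ 2 * D) + N * 1 = N - 9 * D by ring] at this
    obtain ⟨r, rfl⟩ := fs_sq_of_pos hN (hco.mul_right (c1.mul_right c4)) (c := V) (by rw [← h]; ring)
    obtain ⟨B, rfl⟩ := fs_sq_of_pos hD (hco.symm.mul_right (c2.mul_right c3)) (c := V) (by rw [← h]; ring)
    have hr : r ≠ 0 := by rintro rfl; simp at hN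
    have hB : B ≠ 0 := by rintro rfl; simp at hD
    obtain ⟨y, rfl⟩ : r * B ∣ V := by
      rw [← Int.pow_dvd_pow_iff (n := 2) (by norm_num)]
      exact ⟨_, by rw [← h, mul_pow]⟩
    have := fs_quartic (r := r) (B := B) (y := y)
      ((IsCoprime.pow_iff (by norm_num) (by norm_num)).1 hco) hr hB (by
        apply mul_left_cancel₀ (pow_ne_zero 2 (mul_ne_zero hr hB)); linarith)
    exact hV (by rw [this, mul_zero])
  have h3D : IsCoprime (3 : ℤ) D := hco.of_isCoprime_of_dvd_left h3
  obtain ⟨N', rfl⟩ := h3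
  have hco' : IsCoprime N' D := hco.of_mul_left_right
  have hN' : 0 < N' := by linarith
  obtain ⟨V', rfl⟩ : (3 : ℤ) ∣ V := by
    rw [← Int.pow_dvd_pow_iff (n := 2) (by norm_num)]
    exact ⟨N' * D * ((3 * N' - D) * (N' - 3 * D)), by rw [← h]; ring⟩
  have hV' : V' ≠ 0 := right_ne_zero_of_mul hV
  have h' : N' * D * ((3 * N' - D) * (N' - 3 * D)) = V' ^ 2 := by linarith
  have c1' : IsCoprime N' (3 * N' - D) := c1.of_mul_left_right
  have c3' : IsCoprime D (N' - 3 * D) := by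
    have := hco'.symm.add_mul_left_right (-3)
    rwa [show N' + D * (-3) = N' - 3 * D by ring] at this
  by_cases h33 : (3 : ℤ) ∣ N'
  · obtain ⟨M, rfl⟩ := h33
    have hM : 0 < M := by linarith
    obtain ⟨W, rfl⟩ : (3 : ℤ) ∣ V' := by
      rw [← Int.pow_dvd_pow_iff (n := 2) (by norm_num)]
      exact ⟨M * D * ((9 * M - D) * (M - D)), by rw [← h']; ring⟩
    have hW : W ≠ 0 := right_ne_zero_of_mul hV'
    have h'' : M * D * ((9 * M - D) * (M - D)) = W ^ 2 := by linarith
    have hMD : IsCoprime M D := hco'.of_mul_left_right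
    have d1 : IsCoprime M (9 * M - D) := by
      have := c1'.of_mul_left_right
      rwa [show 3 * (3 * M) - D = 9 * M - D by ring] at this
    have d2 : IsCoprime D (9 * M - D) := by
      rwa [show 3 * (3 * M) - D = 9 * M - D by ring] at c2
    have d3 : IsCoprime M (M - D) := by
      have := hMD.neg_right.add_mul_left_right 1
      rwa [show -D + M * 1 = M - D by ring] at this
    have d4 : IsCoprime D (M - D) := by
      have := hMD.symm.add_mul_left_right (-1)
      rwa [show M + D * (-1) = M - D by ring] at this
    obtain ⟨B, rfl⟩ := fs_sq_of_pos hM (hMD.mul_right (d1.mul_right d3)) (c := W)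
      (by rw [← h'']; ring)
    obtain ⟨r, rfl⟩ := fs_sq_of_pos hD (hMD.symm.mul_right (d2.mul_right d4)) (c := W)
      (by rw [← h'']; ring)
    have hr : r ≠ 0 := by rintro rfl; simp at hD
    have hB : B ≠ 0 := by rintro rfl; simp at hM
    obtain ⟨y, rfl⟩ : B * r ∣ W := by
      rw [← Int.pow_dvd_pow_iff (n := 2) (by norm_num)]
      exact ⟨_, by rw [← h'', mul_pow]⟩
    have := fs_quartic (r := r) (B := B) (y := y)
      ((IsCoprime.pow_iff (by norm_num) (by norm_num)).1 hMD).symm hr hB (by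
        apply mul_left_cancel₀ (pow_ne_zero 2 (mul_ne_zero hB hr)); linarith)
    exact hW (by rw [this, mul_zero])
  · have c4' : IsCoprime N' (N' - 3 * D) := by
      have := ((prime3 h33).symm.mul_right hco').neg_right.add_mul_left_right 1
      rwa [show -(3 * D) + N' * 1 = N' - 3 * D by ring] at this
    obtain ⟨r, rfl⟩ := fs_sq_of_pos hN' (hco'.mul_right (c1'.mul_right c4')) (c := V')
      (by rw [← h']; ring)
    obtain ⟨B, rfl⟩ := fs_sq_of_pos hD (hco'.symm.mul_right (c2.mul_right c3')) (c := V')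
      (by rw [← h']; ring)
    have hr3 : ¬ (r % 3 = 0) := fun h0 =>
      h33 (dvd_pow (Int.dvd_of_emod_eq_zero h0) (by norm_num))
    have hB3 : ¬ (B % 3 = 0) := by
      intro h0
      have h2 : (3 : ℤ) ∣ B ^ 2 := dvd_pow (Int.dvd_of_emod_eq_zero h0) (by norm_num)
      have := h3D.isUnit_of_dvd' dvd_rfl h2
      revert this; decide
    obtain ⟨y, rfl⟩ : r * B ∣ V' := by
      rw [← Int.pow_dvd_pow_iff (n := 2) (by norm_num)]
      exact ⟨_, by rw [← h', mul_pow]⟩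
    have hy : (3 * r ^ 2 - B ^ 2) * (r ^ 2 - 3 * B ^ 2) = y ^ 2 := by
      apply mul_left_cancel₀ (pow_ne_zero 2 (left_ne_zero_of_mul hV')); linarith
    have e3 := congrArg (· % 3)
      (show y ^ 2 + B ^ 2 * r ^ 2 = 3 * (r ^ 4 + B ^ 4 - 3 * r ^ 2 * B ^ 2) by linarith)
    have hs : y % 3 = 0 ∨ y % 3 = 1 ∨ y % 3 = 2 := by omega
    have hb : B % 3 = 1 ∨ B % 3 = 2 := by omega
    have hrr : r % 3 = 1 ∨ r % 3 = 2 := by omega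
    rcases hb with hb | hb <;> rcases hs with hs | hs | hs <;> rcases hrr with hrr | hrr <;>
      simp [pow_two, Int.add_emod, Int.mul_emod, hb, hs, hrr] at e3

/-- The elliptic curve `v² = w (w - 1) (w - 9)` has only the 2-torsion rational points. -/
theorem fs_rat {w v : ℚ} (h : v ^ 2 = w * (w - 1) * (w - 9)) : v = 0 := by
  have hD : (0 : ℤ) < w.den := by exact_mod_cast w.pos
  have hDq : (w.den : ℚ) ≠ 0 := by exact_mod_cast w.den_nz
  have hco : IsCoprime w.num (w.den : ℤ) := Rat.isCoprime_num_den w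
  have hw : w = w.num / w.den := (Rat.num_div_den w).symm
  have hq : ((w.num * w.den * ((w.num - w.den) * (w.num - 9 * w.den)) : ℤ) : ℚ)
      = (v * w.den ^ 2) ^ 2 := by
    push_cast
    rw [mul_pow, h]
    have : (w.num : ℚ) = w * w.den := (Rat.mul_den_eq_num w).symm
    rw [this]; ring
  have hsq : IsSquare (w.num * w.den * ((w.num - w.den) * (w.num - 9 * w.den)) : ℤ) := by
    rw [← Rat.isSquare_intCast_iff]
    exact ⟨_, by rw [hq, pow_two]⟩
  obtain ⟨V, hV⟩ := hsq
  have := fs_int hD hco (V := V) (by rw [hV, pow_two])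
  rw [this] at hV
  rw [hV] at hq
  have h0 : (v * w.den ^ 2) ^ 2 = 0 := by rw [← hq]; simp
  have h1 := pow_eq_zero_iff (two_ne_zero) |>.1 h0
  rcases mul_eq_zero.1 h1 with h | h
  · exact h
  · exact absurd h (pow_ne_zero 2 hDq)


theorem fs_quad {K : Type*} [Field K] [Algebra ℚ K] (hdeg : Module.finrank ℚ K = 2)
    (X : K) (hX : X ∉ Set.range (algebraMap ℚ K)) (Y : K) :
    ∃ m n : ℚ, Y = algebraMap ℚ K m * X + algebraMap ℚ K n := by
  have hli : LinearIndependent ℚ ![X, 1] := by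
    rw [LinearIndependent.pair_iff]
    intro s t h
    rw [Algebra.smul_def, Algebra.smul_def, mul_one] at h
    have hs : s = 0 := by
      by_contra hs
      apply hX
      refine ⟨-t / s, ?_⟩
      have : algebraMap ℚ K s ≠ 0 := by rwa [Ne, map_eq_zero_iff _ (algebraMap ℚ K).injective]
      rw [map_div₀, map_neg]
      field_simp
      linear_combination -h
    subst hs
    rw [map_zero, zero_mul, zero_add, map_eq_zero_iff _ (algebraMap ℚ K).injective] at h
    exact ⟨rfl, h⟩
  have : FiniteDimensional ℚ K := Module.finite_of_finrank_pos (by rw [hdeg]; norm_num)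
  have hsp := hli.span_eq_top_of_card_eq_finrank' (by simp [hdeg])
  have hY : Y ∈ Submodule.span ℚ (Set.range ![X, 1]) := hsp ▸ Submodule.mem_top
  rw [Matrix.range_cons, Matrix.range_cons, Matrix.range_empty, Set.union_empty,
    Set.singleton_union, Submodule.mem_span_pair] at hY
  obtain ⟨m, n, h⟩ := hY
  exact ⟨m, n, by rw [← h, Algebra.smul_def, Algebra.smul_def, mul_one]⟩

theorem fs_indep {K : Type*} [Field K] [Algebra ℚ K]
    {X : K} (hX : X ∉ Set.range (algebraMap ℚ K)) {s t : ℚ}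
    (h : algebraMap ℚ K s * X + algebraMap ℚ K t = 0) : s = 0 ∧ t = 0 := by
  have hs : s = 0 := by
    by_contra hs
    apply hX
    refine ⟨-t / s, ?_⟩
    have : algebraMap ℚ K s ≠ 0 := by rwa [Ne, map_eq_zero_iff _ (algebraMap ℚ K).injective]
    rw [map_div₀, map_neg]
    field_simp
    linear_combination -h
  subst hs
  rw [map_zero, zero_mul, zero_add, map_eq_zero_iff _ (algebraMap ℚ K).injective] at h
  exact ⟨rfl, h⟩

theorem fs_four {K : Type*} [Field K] [Algebra ℚ K] (hdeg : Module.finrank ℚ K = 2)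
    {s u y : K} (hu : s ^ 2 - 1 = u ^ 2) (hy : s ^ 2 - 9 = y ^ 2) :
    ∃ a : ℚ, s ^ 2 = algebraMap ℚ K a := by
  have : CharZero K := algebraRat.charZero K
  have n1 : s + u ≠ 0 := by
    intro h
    have : (1 : K) = 0 := by linear_combination (s - u) * h - hu
    norm_num at this
  have n2 : s + y ≠ 0 := by
    intro h
    have : (9 : K) = 0 := by linear_combination (s - y) * h - hy
    norm_num at this
  have n3 : u + y ≠ 0 := by
    intro h
    have : (8 : K) = 0 := by linear_combination (u - y) * h + hu - hy
    norm_num at this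
  obtain ⟨X, hX⟩ : ∃ X, X = (s + u) * (s + y) := ⟨_, rfl⟩
  obtain ⟨Y, hY⟩ : ∃ Y, Y = (s + u) * (s + y) * (u + y) := ⟨_, rfl⟩
  have hX1 : X - 1 = (s + u) * (u + y) := by rw [hX]; linear_combination hu
  have hX9 : X - 9 = (s + y) * (u + y) := by rw [hX]; linear_combination hy
  have hY0 : Y ≠ 0 := by rw [hY]; exact mul_ne_zero (mul_ne_zero n1 n2) n3
  have hX0 : X ≠ 0 := by rw [hX]; exact mul_ne_zero n1 n2
  have hX10 : X - 1 ≠ 0 := by rw [hX1]; exact mul_ne_zero n1 n3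
  have hX90 : X - 9 ≠ 0 := by rw [hX9]; exact mul_ne_zero n2 n3
  have hE : Y ^ 2 = X * (X - 1) * (X - 9) := by rw [hX1, hX9, hX, hY]; ring
  have k0 : X ^ 2 - 9 = 2 * Y * s := by
    have : (s + u) * (s + y) * ((s - u) * (s - y)) = 9 := by
      linear_combination ((s + y) * (s - y)) * hu + hy
    rw [hX, hY]; linear_combination this
  have k1 : (X - 1) ^ 2 + 8 = 2 * Y * u := by
    have : (s + u) * (u + y) * ((u - s) * (u - y)) = -8 := by
      linear_combination (-(u + y) * (u - y)) * hu + hu - hy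
    rw [hX1, hY]; linear_combination this
  have k9 : (X - 9) ^ 2 - 72 = 2 * Y * y := by
    have : (s + y) * (u + y) * ((y - s) * (y - u)) = 72 := by
      linear_combination (-(u + y) * (y - u)) * hy + 9 * hy - 9 * hu
    rw [hX9, hY]; linear_combination this
  by_cases hr : X ∈ Set.range (algebraMap ℚ K)
  · obtain ⟨x, rfl⟩ := hr
    refine ⟨(x ^ 2 - 9) ^ 2 / (4 * (x * (x - 1) * (x - 9))), ?_⟩
    simp only [map_div₀, map_mul, map_sub, map_pow, map_one, map_ofNat]
    rw [← hE, k0]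
    field_simp
    norm_num
  · obtain ⟨m, n, hmn⟩ := fs_quad hdeg X hr Y
    obtain ⟨T, M, hTM⟩ := fs_quad hdeg X hr (X ^ 2)
    -- third intersection point
    have hc := hE
    rw [hmn] at hc
    have hlin : algebraMap ℚ K ((T ^ 2 + M - 10 * T + 9) - (m ^ 2 * T + 2 * m * n)) * X
        + algebraMap ℚ K ((T * M - 10 * M) - (m ^ 2 * M + n ^ 2)) = 0 := by
      simp only [map_mul, map_sub, map_add, map_pow, map_ofNat]
      linear_combination (-(X - 10 + algebraMap ℚ K T) + (algebraMap ℚ K m) ^ 2) * hTM - hc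
    obtain ⟨i1, i2⟩ := fs_indep hr hlin
    have he : (m * (10 + m ^ 2 - T) + n) ^ 2 =
        (10 + m ^ 2 - T) * ((10 + m ^ 2 - T) - 1) * ((10 + m ^ 2 - T) - 9) := by
      linear_combination (-(10 + m ^ 2 - T)) * i1 - i2
    have h0 := fs_rat he
    rw [h0] at he
    obtain ⟨e, hedef⟩ : ∃ e, e = 10 + m ^ 2 - T := ⟨_, rfl⟩
    rw [← hedef] at h0 he
    have hY' : Y = algebraMap ℚ K m * (X - algebraMap ℚ K e) := by
      rw [hmn]
      have : n = -(m * e) := by linarith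
      rw [this, map_neg, map_mul]; ring
    have hm : algebraMap ℚ K m ≠ 0 := by
      intro h; rw [h] at hY'; simp at hY'; exact hY0 hY'
    have hcase : e = 0 ∨ e = 1 ∨ e = 9 := by
      have : e * (e - 1) * (e - 9) = 0 := by rw [← he]; ring
      rcases mul_eq_zero.1 this with h | h
      · rcases mul_eq_zero.1 h with h | h
        · exact Or.inl h
        · exact Or.inr (Or.inl (by linarith))
      · exact Or.inr (Or.inr (by linarith))
    rcases hcase with rfl | rfl | rfl
    · have hz : (X ^ 2 - 10 * X + 9) = algebraMap ℚ K m ^ 2 * X := by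
        apply mul_left_cancel₀ hX0
        rw [hY', map_zero] at hE
        linear_combination -hE
      refine ⟨((m ^ 2 + 10) ^ 2 - 36) / (4 * m ^ 2), ?_⟩
      simp only [map_div₀, map_mul, map_sub, map_add, map_pow, map_one, map_ofNat]
      rw [eq_div_iff (mul_ne_zero (by norm_num) (pow_ne_zero 2 hm))]
      apply mul_left_cancel₀ (pow_ne_zero 2 hX0)
      rw [hY', map_zero] at k0
      linear_combination (-(2 * (algebraMap ℚ K m * (X - 0)) * s) - (X ^ 2 - 9)) * k0
        + (X ^ 2 + 9 + (algebraMap ℚ K m ^ 2 + 10) * X) * hz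
    · have hz : X * (X - 9) = algebraMap ℚ K m ^ 2 * (X - 1) := by
        apply mul_left_cancel₀ hX10
        rw [hY', map_one] at hE
        linear_combination -hE
      refine ⟨((m ^ 2 + 7) ^ 2 + 32) / (4 * m ^ 2) + 1, ?_⟩
      simp only [map_div₀, map_mul, map_sub, map_add, map_pow, map_one, map_ofNat]
      rw [← sub_eq_iff_eq_add, hu,
        eq_div_iff (mul_ne_zero (by norm_num) (pow_ne_zero 2 hm))]
      apply mul_left_cancel₀ (pow_ne_zero 2 hX10)
      rw [hY', map_one] at k1
      linear_combination (-(2 * (algebraMap ℚ K m * (X - 1)) * u) - ((X - 1) ^ 2 + 8)) * k1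
        + ((X - 1) ^ 2 - 8 + (algebraMap ℚ K m ^ 2 + 7) * (X - 1)) * hz
    · have hz : X * (X - 1) = algebraMap ℚ K m ^ 2 * (X - 9) := by
        apply mul_left_cancel₀ hX90
        rw [hY', map_ofNat] at hE
        linear_combination -hE
      refine ⟨((m ^ 2 - 17) ^ 2 - 288) / (4 * m ^ 2) + 9, ?_⟩
      simp only [map_div₀, map_mul, map_sub, map_add, map_pow, map_one, map_ofNat]
      rw [← sub_eq_iff_eq_add, hy,
        eq_div_iff (mul_ne_zero (by norm_num) (pow_ne_zero 2 hm))]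
      apply mul_left_cancel₀ (pow_ne_zero 2 hX90)
      rw [hY', map_ofNat] at k9
      linear_combination (-(2 * (algebraMap ℚ K m * (X - 9)) * y) - ((X - 9) ^ 2 - 72)) * k9
        + ((X - 9) ^ 2 + 72 + (algebraMap ℚ K m ^ 2 - 17) * (X - 9)) * hz

/-- `√2` and `√3` do not both lie in a quadratic field. -/
theorem fs_two_three {K : Type*} [Field K] [Algebra ℚ K] (hdeg : Module.finrank ℚ K = 2)
    {a b : K} (ha : a ^ 2 = 2) (hb : b ^ 2 = 3) : False := by
  have inj := (algebraMap ℚ K).injective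
  have nsq : ∀ n : ℕ, ¬ IsSquare n → ∀ x : ℚ, x ^ 2 ≠ n := by
    intro n hn x hx
    exact hn (Rat.isSquare_natCast_iff.1 ⟨x, by rw [← hx, pow_two]⟩)
  have n2 : ¬ IsSquare (2 : ℕ) := Nat.prime_two.prime.not_isSquare
  have n3 : ¬ IsSquare (3 : ℕ) := Nat.prime_three.prime.not_isSquare
  have n6 : ¬ IsSquare (6 : ℕ) := by
    rintro ⟨r, hr⟩
    have : r < 3 := by nlinarith
    interval_cases r <;> omega
  have har : a ∉ Set.range (algebraMap ℚ K) := by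
    rintro ⟨x, rfl⟩
    refine nsq 2 n2 x (inj ?_)
    rw [map_pow, ha]; simp
  obtain ⟨m, n, h⟩ := fs_quad hdeg a har b
  have hl : algebraMap ℚ K (2 * m * n) * a + algebraMap ℚ K (2 * m ^ 2 + n ^ 2 - 3) = 0 := by
    rw [h] at hb
    simp only [map_mul, map_sub, map_add, map_pow, map_ofNat]
    linear_combination hb - algebraMap ℚ K m ^ 2 * ha
  obtain ⟨h1, h2⟩ := fs_indep har hl
  rcases mul_eq_zero.1 h1 with h0 | h0
  · have hm : m = 0 := by linarith
    subst hm
    exact nsq 3 n3 n (by push_cast; linarith)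
  · subst h0
    exact nsq 6 n6 (2 * m) (by push_cast; linarith)


/-- **Five squares in arithmetic progression over a quadratic field are defined over ℚ.**
If `K/ℚ` is a quadratic extension and `x₀, …, x₄ ∈ K`, not all zero, are such that
`x₀², …, x₄²` form an arithmetic progression, then `x₀ ≠ 0` and
`q := (x₁/x₀)² − 1` lies in the image of `ℚ` in `K`. -/
theorem five_squares_AP_quadratic_field_rational_ratio
    (K : Type*) [Field K] [Algebra ℚ K] (hdeg : Module.finrank ℚ K = 2)
    (x₀ x₁ x₂ x₃ x₄ : K)
    (hnz : ¬ (x₀ = 0 ∧ x₁ = 0 ∧ x₂ = 0 ∧ x₃ = 0 ∧ x₄ = 0))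
    (hAP : x₁ ^ 2 - x₀ ^ 2 = x₂ ^ 2 - x₁ ^ 2 ∧ x₂ ^ 2 - x₁ ^ 2 = x₃ ^ 2 - x₂ ^ 2 ∧
      x₃ ^ 2 - x₂ ^ 2 = x₄ ^ 2 - x₃ ^ 2) :
    x₀ ≠ 0 ∧ (x₁ / x₀) ^ 2 - 1 ∈ Set.range (algebraMap ℚ K) := by
  obtain ⟨h1, h2, h3⟩ := hAP
  have : CharZero K := algebraRat.charZero K
  obtain ⟨d, hd⟩ : ∃ d, d = x₁ ^ 2 - x₀ ^ 2 := ⟨_, rfl⟩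
  have e1 : x₁ ^ 2 = x₀ ^ 2 + d := by rw [hd]; ring
  have e2 : x₂ ^ 2 = x₀ ^ 2 + 2 * d := by linear_combination -h1 - 2 * hd
  have e3 : x₃ ^ 2 = x₀ ^ 2 + 3 * d := by linear_combination -h2 - 2 * h1 - 3 * hd
  have e4 : x₄ ^ 2 = x₀ ^ 2 + 4 * d := by linear_combination -h3 - 2 * h2 - 3 * h1 - 4 * hd
  clear h1 h2 h3 hd
  have hx0 : x₀ ≠ 0 := by
    rintro rfl
    by_cases hd : d = 0
    · subst hd
      simp at e1 e2 e3 e4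
      exact hnz ⟨rfl, e1, e2, e3, e4⟩
    · have hx1 : x₁ ≠ 0 := by
        rintro rfl
        apply hd; linear_combination -e1
      refine fs_two_three hdeg (a := x₂ / x₁) (b := x₃ / x₁) ?_ ?_
      · rw [div_pow, div_eq_iff (pow_ne_zero 2 hx1)]; linear_combination e2 - 2 * e1
      · rw [div_pow, div_eq_iff (pow_ne_zero 2 hx1)]; linear_combination e3 - 3 * e1
  refine ⟨hx0, ?_⟩
  by_cases hd : d = 0
  · refine ⟨0, ?_⟩
    subst hd
    rw [div_pow, e1, add_zero, div_self (pow_ne_zero 2 hx0)]; simp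
  obtain ⟨a, ha⟩ := fs_four hdeg (s := 2 * x₀ ^ 2 / d + 3) (u := 2 * (x₁ * x₂) / d)
    (y := 2 * (x₀ * x₃) / d)
    (by field_simp; rw [e1, e2]; ring)
    (by field_simp; rw [e3]; ring)
  obtain ⟨b, hb⟩ := fs_four hdeg (s := 2 * x₀ ^ 2 / d + 5) (u := 2 * (x₂ * x₃) / d)
    (y := 2 * (x₁ * x₄) / d)
    (by field_simp; rw [e2, e3]; ring)
    (by field_simp; rw [e1, e4]; ring)
  have ht : x₀ ^ 2 / d = algebraMap ℚ K ((b - a - 16) / 8) := by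
    simp only [map_div₀, map_sub, map_ofNat]
    rw [← ha, ← hb]
    ring
  refine ⟨((b - a - 16) / 8)⁻¹, ?_⟩
  rw [map_inv₀, ← ht, div_pow, e1]
  field_simp
  ring
end

section
/- Let D be a squarefree integer with D ≠ 1, and let x₀,…,x₄ ∈ ℚ(√D) be such that x₀², x₁², x₂², x₃², x₄² form a non-constant arithmetic progression. Then, up to equivalence, the progression is of type {3}: there exist c ∈ ℚ(√D), c ≠ 0, and rational numbers X₀,…,X₄ such that either (c·x_i)² = X_i² for i ∈ {0,1,2,4} and (c·x₃)² = D·X₃², or (c·x_{4−i})² = X_i² for i ∈ {0,1,2,4} and (c·x₁)² = D·X₃². -/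
namespace FiveSq

/-- Four-number lemma. -/
lemma four_numbers {A B a b : ℤ} (hA : A ≠ 0) (h : A * B = a * b) :
    ∃ P Q R S : ℤ, A = P * Q ∧ B = R * S ∧ a = P * R ∧ b = Q * S := by
  obtain ⟨P, Q, ⟨R, hR⟩, ⟨S, hS⟩, hPQ⟩ := exists_dvd_and_dvd_of_dvd_mul (Dvd.intro B h)
  refine ⟨P, Q, R, S, hPQ, ?_, hR, hS⟩
  apply mul_left_cancel₀ hA
  rw [h, hR, hS, hPQ]; ring

/-- If `c² x = y²` with `c ≠ 0` then `x` is a square. -/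
lemma sq_of_mul_sq {c x y : ℤ} (hc : c ≠ 0) (h : c ^ 2 * x = y ^ 2) : ∃ t, x = t ^ 2 := by
  obtain ⟨t, ht⟩ := (Int.pow_dvd_pow_iff two_ne_zero).1 (Dvd.intro x h)
  refine ⟨t, ?_⟩
  apply mul_left_cancel₀ (pow_ne_zero 2 hc)
  rw [h, ht]; ring

lemma natAbs_lt_of_factor {q P Z : ℤ} (hq : q ≠ 0) (h : q = 2 * P * Z) : P.natAbs < q.natAbs := by
  have h2 : q.natAbs = 2 * P.natAbs * Z.natAbs := by
    rw [h, Int.natAbs_mul, Int.natAbs_mul]; rfl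
  have hZ : 0 < Z.natAbs := by
    rw [Int.natAbs_pos]; rintro rfl; simp at h; exact hq h
  have hP : 0 < P.natAbs := by
    rw [Int.natAbs_pos]; rintro rfl; simp at h; exact hq h
  rw [h2]; nlinarith

lemma sum_sq_not_dvd_three {r q : ℤ} (hc : IsCoprime r q) : ¬ (3 : ℤ) ∣ r ^ 2 + q ^ 2 := by
  intro h
  have h1 : r % 3 = 0 ∧ q % 3 = 0 := by
    have h0 : (r ^ 2 + q ^ 2) % 3 = 0 := Int.emod_eq_zero_of_dvd h
    have hr : r % 3 = 0 ∨ r % 3 = 1 ∨ r % 3 = 2 := by omega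
    have hq : q % 3 = 0 ∨ q % 3 = 1 ∨ q % 3 = 2 := by omega
    rcases hr with hr | hr | hr <;> rcases hq with hq | hq | hq <;>
      simp [pow_two, Int.add_emod, Int.mul_emod, hr, hq] at h0 ⊢
  have h2 := hc.isUnit_of_dvd' (Int.dvd_of_emod_eq_zero h1.1) (Int.dvd_of_emod_eq_zero h1.2)
  rw [Int.isUnit_iff] at h2; omega

/-- Descent for the curve 24a: `(r² + q²)(r² + 4q²)` is a square. -/
lemma descent_24a (n : ℕ) : ∀ r q t : ℤ, q.natAbs = n → IsCoprime r q → r % 2 = 1 →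
    (r ^ 2 + q ^ 2) * (r ^ 2 + 4 * q ^ 2) = t ^ 2 → q = 0 := by
  induction n using Nat.strong_induction_on with
  | _ n ih =>
  intro r q t hn hc hr ht
  by_contra hq
  have hr0 : r ≠ 0 := by rintro rfl; simp at hr
  have hcop : IsCoprime (r ^ 2 + q ^ 2) (r ^ 2 + 4 * q ^ 2) := by
    obtain ⟨a, b, hab⟩ : IsCoprime (r ^ 2) (q ^ 2) := hc.pow
    obtain ⟨c, d, hcd⟩ : IsCoprime 3 (r ^ 2 + q ^ 2) :=
      (Int.prime_three.coprime_iff_not_dvd).2 (sum_sq_not_dvd_three hc)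
    refine ⟨d + c * (4 * a - b), c * (b - a), ?_⟩
    linear_combination hcd + 3 * c * hab
  have hpos1 : 0 < r ^ 2 + q ^ 2 := by positivity
  have hpos2 : 0 < r ^ 2 + 4 * q ^ 2 := by positivity
  obtain ⟨p, hp⟩ : ∃ p : ℤ, 0 < p ∧ r ^ 2 + q ^ 2 = p ^ 2 := by
    obtain ⟨p, hp | hp⟩ := Int.sq_of_isCoprime hcop ht
    · refine ⟨|p|, abs_pos.2 ?_, by rw [sq_abs, hp]⟩
      rintro rfl; simp at hp; nlinarith
    · nlinarith [sq_nonneg p]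
  obtain ⟨s, hs⟩ : ∃ s : ℤ, 0 < s ∧ r ^ 2 + 4 * q ^ 2 = s ^ 2 := by
    obtain ⟨p, hp | hp⟩ := Int.sq_of_isCoprime hcop.symm (by rw [mul_comm]; exact ht)
    · refine ⟨|p|, abs_pos.2 ?_, by rw [sq_abs, hp]⟩
      rintro rfl; simp at hp; nlinarith
    · nlinarith [sq_nonneg p]
  have hr2 : IsCoprime r 2 := by
    refine ⟨1, -(r / 2), ?_⟩; omega
  have t1 : PythagoreanTriple r (2 * q) s := by
    unfold PythagoreanTriple; linear_combination hs.2
  have t2 : PythagoreanTriple r q p := by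
    unfold PythagoreanTriple; linear_combination hp.2
  obtain ⟨A, B, h1, h2, -, h3, h4, -⟩ := t1.coprime_classification'
    (Int.isCoprime_iff_gcd_eq_one.1 (hr2.mul_right hc)) hr hs.1
  obtain ⟨a, b, h5, h6, -, h7, h8, -⟩ := t2.coprime_classification'
    (Int.isCoprime_iff_gcd_eq_one.1 hc) hr hp.1
  have hqAB : q = A * B := by linarith
  have hA0 : A ≠ 0 := by rintro rfl; simp at hqAB; exact hq hqAB
  have hB0 : B ≠ 0 := by rintro rfl; simp at hqAB; exact hq hqAB
  have hAB : IsCoprime A B := Int.isCoprime_iff_gcd_eq_one.2 h3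
  rcases h4 with ⟨hA, hB⟩ | ⟨hA, hB⟩
  · obtain ⟨A', rfl⟩ : ∃ A', A = 2 * A' := ⟨A / 2, by omega⟩
    have hA'0 : A' ≠ 0 := by rintro rfl; simp at hA0
    obtain ⟨P, Q, R, S, rfl, rfl, rfl, rfl⟩ := four_numbers (A := A') (B := B) (a := a) (b := b)
      hA'0 (by linarith)
    have hR0 : R ≠ 0 := by rintro rfl; simp at hB0
    have hP0 : P ≠ 0 := by rintro rfl; simp at hA'0
    have hS : S % 2 = 1 := by
      rcases Int.emod_two_eq_zero_or_one S with h | h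
      · rw [Int.mul_emod, h] at hB; simp at hB
      · exact h
    obtain ⟨t', ht'⟩ := sq_of_mul_sq (c := R) (x := (S ^ 2 + P ^ 2) * (S ^ 2 + 4 * P ^ 2))
      (y := Q * (S ^ 2 + 4 * P ^ 2)) hR0 (by
        linear_combination (-(S ^ 2 + 4 * P ^ 2)) * (h1.symm.trans h5))
    have hcSP : IsCoprime S P := (hAB.of_mul_left_right.of_mul_left_left.of_mul_right_right).symm
    exact hP0 (ih P.natAbs (hn ▸ natAbs_lt_of_factor (Z := Q * (R * S)) hq (by rw [hqAB]; ring))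
      S P t' rfl hcSP hS ht')
  · obtain ⟨B', rfl⟩ : ∃ B', B = 2 * B' := ⟨B / 2, by omega⟩
    have hB'0 : B' ≠ 0 := by rintro rfl; simp at hB0
    obtain ⟨P, Q, R, S, rfl, rfl, rfl, rfl⟩ := four_numbers (A := B') (B := A) (a := a) (b := b)
      hB'0 (by linarith)
    have hS0 : P ≠ 0 := by rintro rfl; simp at hB'0
    have hQ0 : Q ≠ 0 := by rintro rfl; simp at hB'0
    have hR : R % 2 = 1 := by
      rcases Int.emod_two_eq_zero_or_one R with h | h
      · rw [Int.mul_emod, h] at hA; simp at hA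
      · exact h
    obtain ⟨t', ht'⟩ := sq_of_mul_sq (c := P) (x := (R ^ 2 + Q ^ 2) * (R ^ 2 + 4 * Q ^ 2))
      (y := S * (R ^ 2 + Q ^ 2)) hS0 (by
        linear_combination (-(R ^ 2 + Q ^ 2)) * (h1.symm.trans h5))
    have hcRQ : IsCoprime R Q := hAB.of_mul_left_left.of_mul_right_right.of_mul_right_right
    exact hQ0 (ih Q.natAbs (hn ▸ natAbs_lt_of_factor (Z := P * (R * S)) hq (by rw [hqAB]; ring))
      R Q t' rfl hcRQ hR ht')


lemma odd_of_mul_left {R S : ℤ} (h : (R * S) % 2 = 1) : R % 2 = 1 := by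
  rcases Int.emod_two_eq_zero_or_one R with h' | h'
  · rw [Int.mul_emod, h'] at h; simp at h
  · exact h'

/-- Two coprime integers whose product is a nonzero square are both `ε` times a square. -/
lemma both_sq {X Y t : ℤ} (hc : IsCoprime X Y) (h : X * Y = t ^ 2) (ht : t ≠ 0) :
    (∃ p s : ℤ, X = p ^ 2 ∧ Y = s ^ 2) ∨ (∃ p s : ℤ, X = -p ^ 2 ∧ Y = -s ^ 2) := by
  have hpos : 0 < X * Y := by rw [h]; positivity
  obtain ⟨p, hp⟩ := Int.sq_of_isCoprime hc h
  obtain ⟨s, hs⟩ := Int.sq_of_isCoprime hc.symm (by rw [mul_comm]; exact h)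
  rcases hp with hp | hp <;> rcases hs with hs | hs
  · exact Or.inl ⟨p, s, hp, hs⟩
  · exfalso; rw [hp, hs] at hpos; nlinarith [mul_nonneg (sq_nonneg p) (sq_nonneg s)]
  · exfalso; rw [hp, hs] at hpos; nlinarith [mul_nonneg (sq_nonneg p) (sq_nonneg s)]
  · exact Or.inr ⟨p, s, hp, hs⟩

/-- One step of the 48a descent, first class. -/
lemma step_48a_one {A B a b : ℤ} (hAB : IsCoprime A B) (hA0 : A ≠ 0) (hB0 : B ≠ 0)
    (hA : A % 2 = 0) (hB : B % 2 = 1) (h1 : A * B = 2 * a * b)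
    (h2 : A ^ 2 + B ^ 2 = a ^ 2 + b ^ 2) :
    ∃ r q t : ℤ, q.natAbs < (A * B).natAbs ∧ q ≠ 0 ∧ t ≠ 0 ∧ IsCoprime r q ∧ r % 2 = 1 ∧
      (r ^ 2 - q ^ 2) * (r ^ 2 - 4 * q ^ 2) = t ^ 2 := by
  obtain ⟨A', rfl⟩ : ∃ A', A = 2 * A' := ⟨A / 2, by omega⟩
  have hA'0 : A' ≠ 0 := by rintro rfl; simp at hA0
  obtain ⟨P, Q, R, S, rfl, rfl, rfl, rfl⟩ := four_numbers (A := A') (B := B) (a := a) (b := b)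
    hA'0 (by linarith)
  have hR0 : R ≠ 0 := by rintro rfl; simp at hB0
  have hS0 : S ≠ 0 := by rintro rfl; simp at hB0
  have hP0 : P ≠ 0 := by rintro rfl; simp at hA'0
  have hQ0 : Q ≠ 0 := by rintro rfl; simp at hA'0
  have hR : R % 2 = 1 := odd_of_mul_left hB
  have key : P ^ 2 * (R ^ 2 - 4 * Q ^ 2) = S ^ 2 * (R ^ 2 - Q ^ 2) := by
    linear_combination -h2
  obtain ⟨t, ht⟩ := sq_of_mul_sq (c := P) (x := (R ^ 2 - Q ^ 2) * (R ^ 2 - 4 * Q ^ 2))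
      (y := S * (R ^ 2 - Q ^ 2)) hP0 (by linear_combination (R ^ 2 - Q ^ 2) * key)
  have hRQ : IsCoprime R Q :=
    (hAB.of_mul_left_right.of_mul_left_right.of_mul_right_left).symm
  refine ⟨R, Q, t, ?_, hQ0, ?_, hRQ, hR, ht⟩
  · exact natAbs_lt_of_factor (Z := P * (R * S)) (mul_ne_zero hA0 hB0) (by ring)
  · rintro rfl
    have h4 : R ^ 2 - 4 * Q ^ 2 ≠ 0 := by
      intro h
      have : R ^ 2 % 2 = 1 := by rw [pow_two, Int.mul_emod, hR]; rfl
      omega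
    have h5 : R ^ 2 - Q ^ 2 = 0 := by
      rcases mul_eq_zero.1 (ht.trans (by norm_num)) with h | h
      · exact h
      · exact absurd h h4
    rw [h5] at key
    exact (mul_ne_zero (pow_ne_zero 2 hP0) h4) (key.trans (by ring))

/-- One step of the 48a descent, second class (after parametrization), with `f` even. -/
lemma step_48a_two {f g p q : ℤ} (hfg : IsCoprime f g) (hp0 : p ≠ 0)
    (hf : f % 2 = 0) (hg : g % 2 = 1) (h1 : p ^ 2 = f * g * (2 * f - g) * (f - 2 * g))
    (hq : q = f ^ 2 - f * g + g ^ 2) :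
    ∃ r q' t : ℤ, q'.natAbs < q.natAbs ∧ q' ≠ 0 ∧ t ≠ 0 ∧ IsCoprime r q' ∧ r % 2 = 1 ∧
      (r ^ 2 - q' ^ 2) * (r ^ 2 - 4 * q' ^ 2) = t ^ 2 := by
  obtain ⟨F, rfl⟩ : ∃ F, f = 2 * F := ⟨f / 2, by omega⟩
  obtain ⟨p', hp'⟩ := sq_of_mul_sq (c := 2) (x := F * g * ((4 * F - g) * (F - g))) (y := p)
    two_ne_zero (by linear_combination -h1)
  have hp'0 : p' ≠ 0 := by
    rintro rfl
    apply hp0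
    have : p ^ 2 = 0 := by linear_combination h1 + 4 * hp'
    exact pow_eq_zero_iff (two_ne_zero) |>.1 this
  have hFg : IsCoprime F g := hfg.of_mul_left_right
  have hg2 : IsCoprime g 2 := ⟨1, -(g / 2), by omega⟩
  have hg4 : IsCoprime g 4 := by
    have := hg2.mul_right hg2
    norm_num at this; exact this
  have c1 : IsCoprime F (4 * F - g) := by
    obtain ⟨a, b, h⟩ := hFg
    exact ⟨a + 4 * b, -b, by linear_combination h⟩
  have c2 : IsCoprime F (F - g) := by
    obtain ⟨a, b, h⟩ := hFg
    exact ⟨a + b, -b, by linear_combination h⟩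
  have c3 : IsCoprime g (4 * F - g) := by
    obtain ⟨a, b, h⟩ := hg4.mul_right hFg.symm
    exact ⟨a + b, b, by linear_combination h⟩
  have c4 : IsCoprime g (F - g) := by
    obtain ⟨a, b, h⟩ := hFg
    exact ⟨a + b, a, by linear_combination h⟩
  have c5 : IsCoprime (F * g) ((4 * F - g) * (F - g)) :=
    (c1.mul_right c2).mul_left (c3.mul_right c4)
  have hpos : 0 < p' ^ 2 := by positivity
  obtain ⟨y1, y2, hy1, hy2⟩ : ∃ y1 y2 : ℤ, F * g = y1 ^ 2 ∧ (4 * F - g) * (F - g) = y2 ^ 2 := by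
    rcases both_sq c5 hp' hp'0 with h | ⟨y1, y2, hy1, hy2⟩
    · exact h
    · exfalso; nlinarith [sq_nonneg y1, sq_nonneg y2, sq_nonneg F, sq_nonneg g]
  have hy10 : y1 ≠ 0 := by
    rintro rfl
    rw [hy1] at hp'; simp at hp'; exact hp'0 ((pow_eq_zero_iff two_ne_zero).1 hp'.symm)
  have hy20 : y2 ≠ 0 := by
    rintro rfl
    rw [hy2] at hp'; simp at hp'; exact hp'0 ((pow_eq_zero_iff two_ne_zero).1 hp'.symm)
  have hF0 : F ≠ 0 := by
    rintro rfl; simp at hy1; exact hy10 ((pow_eq_zero_iff two_ne_zero).1 hy1.symm)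
  have main : ∀ x y : ℤ, F ^ 2 = (x ^ 2) ^ 2 → g ^ 2 = (y ^ 2) ^ 2 → F * g = x ^ 2 * y ^ 2 →
      IsCoprime (x ^ 2) (y ^ 2) →
      ∃ r q' t : ℤ, q'.natAbs < q.natAbs ∧ q' ≠ 0 ∧ t ≠ 0 ∧ IsCoprime r q' ∧ r % 2 = 1 ∧
      (r ^ 2 - q' ^ 2) * (r ^ 2 - 4 * q' ^ 2) = t ^ 2 := by
    intro x y hx hy hxy hcop
    have hx0 : x ≠ 0 := by
      rintro rfl; apply hF0; simpa using hx
    refine ⟨y, x, y2, ?_, hx0, hy20, ((IsCoprime.pow_iff two_pos two_pos).1 hcop).symm, ?_, ?_⟩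
    · have hx1 : 1 ≤ |x| := Int.one_le_abs hx0
      have h3 : |x| < |q| := by
        have e1 : 3 * (|x|) ^ 4 ≤ q := by
          have : |x| ^ 4 = F ^ 2 := by rw [hx, ← pow_mul, Even.pow_abs (by decide)]
          rw [this, hq]; nlinarith [sq_nonneg (F - g)]
        have e2 : |x| ≤ |x| ^ 4 := le_self_pow₀ hx1 (by norm_num)
        have e3 := le_abs_self q
        linarith
      rw [← Int.natCast_natAbs, ← Int.natCast_natAbs] at h3
      exact_mod_cast h3
    · rcases Int.emod_two_eq_zero_or_one y with h | h
      · exfalso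
        have : g ^ 2 % 2 = 0 := by
          rw [hy]; simp [pow_two, Int.mul_emod, h]
        rw [pow_two, Int.mul_emod, hg] at this; simp at this
      · exact h
    · rw [← hy2]; linear_combination (-4) * hx - hy + 5 * hxy
  rcases both_sq hFg hy1 hy10 with ⟨x, y, hx, hy⟩ | ⟨x, y, hx, hy⟩
  · exact main x y (by rw [hx]) (by rw [hy]) (by rw [hx, hy]) (by rw [← hx, ← hy]; exact hFg)
  · refine main x y (by rw [hx]; ring) (by rw [hy]; ring) (by rw [hx, hy]; ring) ?_
    have := hFg.neg_neg
    rw [hx, hy] at this; simpa using this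

/-- One step of the 48a descent, second class. -/
lemma step_48a_three {r q p s : ℤ} (hq : 0 < q) (hc : IsCoprime r q) (hr : r % 2 = 1)
    (hp0 : p ≠ 0) (hs0 : s ≠ 0) (h1 : r ^ 2 - q ^ 2 = -(3 * p ^ 2))
    (h2 : r ^ 2 - 4 * q ^ 2 = -(3 * s ^ 2)) (h3 : (3 : ℤ) ∣ 2 * q - r) :
    ∃ r' q' t : ℤ, q'.natAbs < q.natAbs ∧ q' ≠ 0 ∧ t ≠ 0 ∧ IsCoprime r' q' ∧ r' % 2 = 1 ∧
      (r' ^ 2 - q' ^ 2) * (r' ^ 2 - 4 * q' ^ 2) = t ^ 2 := by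
  obtain ⟨h, hh⟩ := h3
  have hprod : h * (2 * q + r) = s ^ 2 := by
    have : 3 * (h * (2 * q + r)) = 3 * s ^ 2 := by linear_combination (-(2 * q + r)) * hh - h2
    linarith
  have hr2 : IsCoprime r 2 := ⟨1, -(r / 2), by omega⟩
  have hcop : IsCoprime h (2 * q + r) := by
    have e1 : IsCoprime (2 * q - r) (2 * q + r) := by
      have e2 : IsCoprime (2 * q - r) r := by
        obtain ⟨a, b, e⟩ := hr2.mul_right hc
        exact ⟨b, a + b, by linear_combination e⟩
      have e3 : IsCoprime (2 * q - r) 2 := ⟨-1, q - (r / 2), by omega⟩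
      obtain ⟨a, b, e⟩ := e3.mul_right e2
      exact ⟨a - b, b, by linear_combination e⟩
    rw [hh] at e1
    exact e1.of_mul_left_right
  rcases both_sq hcop hprod hs0 with ⟨α, β, hα, hβ⟩ | ⟨α, β, hα, hβ⟩
  swap
  · exfalso; nlinarith [sq_nonneg α, sq_nonneg β]
  have hαo : α % 2 = 1 := by
    rcases Int.emod_two_eq_zero_or_one α with e | e
    · exfalso
      have : h % 2 = 0 := by rw [hα]; simp [pow_two, Int.mul_emod, e]
      omega
    · exact e
  have hβo : β % 2 = 1 := by
    rcases Int.emod_two_eq_zero_or_one β with e | e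
    · exfalso
      have : (2 * q + r) % 2 = 0 := by rw [hβ]; simp [pow_two, Int.mul_emod, e]
      omega
    · exact e
  obtain ⟨f, g, rfl, rfl⟩ : ∃ f g : ℤ, α = f - g ∧ β = f + g :=
    ⟨(β + α) / 2, (β - α) / 2, by omega, by omega⟩
  have hqf : q = f ^ 2 - f * g + g ^ 2 := by
    have : 4 * q = 4 * (f ^ 2 - f * g + g ^ 2) := by linear_combination hh + 3 * hα + hβ
    linarith
  have hrf : r = -f ^ 2 - g ^ 2 + 4 * f * g := by linear_combination hβ - 2 * hqf
  have hpf : p ^ 2 = f * g * (2 * f - g) * (f - 2 * g) := by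
    rw [hqf, hrf] at h1
    have : 3 * p ^ 2 = 3 * (f * g * (2 * f - g) * (f - 2 * g)) := by linear_combination h1
    linarith
  have hfg : IsCoprime f g := by
    obtain ⟨a, b, e⟩ := hc
    exact ⟨a * (-f + 4 * g) + b * (f - g), a * (-g) + b * g, by
      rw [hqf, hrf] at e; linear_combination e⟩
  rcases Int.emod_two_eq_zero_or_one f with e | e
  · exact step_48a_two hfg hp0 e (by omega) hpf hqf
  · exact step_48a_two hfg.symm hp0 (f := g) (g := f) (by omega) e (by rw [hpf]; ring)
      (by rw [hqf]; ring)

/-- Descent for the curve 48a: `(r² - q²)(r² - 4q²)` is a nonzero square. -/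
lemma descent_48a (n : ℕ) : ∀ r q t : ℤ, q.natAbs = n → IsCoprime r q → r % 2 = 1 → t ≠ 0 →
    (r ^ 2 - q ^ 2) * (r ^ 2 - 4 * q ^ 2) = t ^ 2 → q = 0 := by
  induction n using Nat.strong_induction_on with
  | _ n ih =>
  intro r₀ q₀ t hn hc₀ hr₀ ht0 ht₀
  by_contra hq₀
  suffices hmain : ∃ r' q' t : ℤ, q'.natAbs < q₀.natAbs ∧ q' ≠ 0 ∧ t ≠ 0 ∧ IsCoprime r' q' ∧
      r' % 2 = 1 ∧ (r' ^ 2 - q' ^ 2) * (r' ^ 2 - 4 * q' ^ 2) = t ^ 2 by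
    obtain ⟨r', q', t', k1, k2, k3, k4, k5, k6⟩ := hmain
    exact k2 (ih q'.natAbs (hn ▸ k1) r' q' t' rfl k4 k5 k3 k6)
  obtain ⟨q, hqq, hq⟩ : ∃ q, q = |q₀| ∧ 0 < q := ⟨_, rfl, abs_pos.2 hq₀⟩
  obtain ⟨r, hrr⟩ : ∃ r, r = |r₀| := ⟨_, rfl⟩
  have hc : IsCoprime r q := by rw [hrr, hqq]; exact hc₀.abs_abs
  have hr : r % 2 = 1 := by
    rcases abs_choice r₀ with h | h <;> rw [h] at hrr <;> omega
  have hrpos : 0 < r := by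
    have : 0 ≤ r := by rw [hrr]; exact abs_nonneg _
    omega
  have ht : (r ^ 2 - q ^ 2) * (r ^ 2 - 4 * q ^ 2) = t ^ 2 := by
    rw [hrr, hqq, sq_abs, sq_abs]; exact ht₀
  have hnat : q₀.natAbs = q.natAbs := by rw [hqq, Int.natAbs_abs]
  rw [hnat]
  have hrsq : r ^ 2 % 4 = 1 := by
    have : r % 4 = 1 ∨ r % 4 = 3 := by omega
    rcases this with h | h <;> simp [pow_two, Int.mul_emod, h]
  have sq4 : ∀ z : ℤ, z ^ 2 % 4 = 0 ∨ z ^ 2 % 4 = 1 := by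
    intro z
    have : z % 4 = 0 ∨ z % 4 = 1 ∨ z % 4 = 2 ∨ z % 4 = 3 := by omega
    rcases this with h | h | h | h <;> simp [pow_two, Int.mul_emod, h]
  obtain ⟨u, v, huv⟩ : IsCoprime (r ^ 2) (q ^ 2) := hc.pow
  have hr2 : IsCoprime r 2 := ⟨1, -(r / 2), by omega⟩
  by_cases h3 : (3 : ℤ) ∣ r ^ 2 - q ^ 2
  · obtain ⟨X, hX⟩ := h3
    obtain ⟨Y, hY⟩ : ∃ Y, r ^ 2 - 4 * q ^ 2 = 3 * Y := ⟨X - q ^ 2, by linarith⟩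
    have hcop : IsCoprime X Y := by
      refine ⟨4 * u + v, -(u + v), ?_⟩
      have e1 : r ^ 2 = 4 * X - Y := by linarith
      have e2 : q ^ 2 = X - Y := by linarith
      rw [e1, e2] at huv; linear_combination huv
    have ht9 : (3 : ℤ) ^ 2 * (X * Y) = t ^ 2 := by rw [← ht, hX, hY]; ring
    obtain ⟨t', ht'⟩ := sq_of_mul_sq three_ne_zero ht9
    have ht'0 : t' ≠ 0 := by
      rintro rfl
      rw [ht'] at ht9; simp at ht9; exact ht0 ((pow_eq_zero_iff two_ne_zero).1 ht9.symm)
    rcases both_sq hcop ht' ht'0 with ⟨p, s, hp, hs⟩ | ⟨p, s, hp, hs⟩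
    · exfalso
      have := sq4 s
      omega
    · have hp0 : p ≠ 0 := by
        rintro rfl; rw [hp] at ht'; simp at ht'; exact ht'0 ((pow_eq_zero_iff two_ne_zero).1 ht'.symm)
      have hs0 : s ≠ 0 := by
        rintro rfl; rw [hs] at ht'; simp at ht'; exact ht'0 ((pow_eq_zero_iff two_ne_zero).1 ht'.symm)
      have hdvd : (3 : ℤ) ∣ (2 * q - r) * (2 * q - -r) := ⟨-Y, by linear_combination -hY⟩
      rcases Int.prime_three.dvd_or_dvd hdvd with h | h
      · exact step_48a_three hq hc hr hp0 hs0 (by rw [hX, hp]; ring) (by rw [hY, hs]; ring) h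
      · exact step_48a_three (r := -r) hq hc.neg_left (by omega) hp0 hs0
          (by rw [neg_sq, hX, hp]; ring) (by rw [neg_sq, hY, hs]; ring) h
  · have hcop : IsCoprime (r ^ 2 - q ^ 2) (r ^ 2 - 4 * q ^ 2) := by
      obtain ⟨c, d, hcd⟩ := (Int.prime_three.coprime_iff_not_dvd).2 h3
      refine ⟨d + c * (4 * u + v), -(c * (u + v)), ?_⟩
      linear_combination hcd + 3 * c * huv
    rcases both_sq hcop ht ht0 with ⟨p, s, hp, hs⟩ | ⟨p, s, hp, hs⟩
    · have hp0 : p ≠ 0 := by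
        rintro rfl; rw [hp] at ht; simp at ht; exact ht0 ((pow_eq_zero_iff two_ne_zero).1 ht.symm)
      have hso : s % 2 = 1 := by
        rcases Int.emod_two_eq_zero_or_one s with e | e
        · exfalso
          have : s ^ 2 % 2 = 0 := by simp [pow_two, Int.mul_emod, e]
          omega
        · exact e
      have t1 : PythagoreanTriple s (2 * q) r := by
        unfold PythagoreanTriple; linear_combination -hs
      have hcs : IsCoprime s (2 * q) := by
        have e1 : IsCoprime (s ^ 2) ((2 * q) ^ 2) := by
          obtain ⟨a, b, e⟩ := (hr2.mul_right hc).pow (m := 2) (n := 2)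
          exact ⟨a, a + b, by linear_combination e - a * hs⟩
        exact (IsCoprime.pow_iff two_pos two_pos).1 e1
      obtain ⟨A, B, k1, k2, k3, k4, k5, -⟩ := t1.coprime_classification'
        (Int.isCoprime_iff_gcd_eq_one.1 hcs) hso hrpos
      have hqAB : q = A * B := by linarith
      have hA0 : A ≠ 0 := by rintro rfl; simp at hqAB; omega
      have hB0 : B ≠ 0 := by rintro rfl; simp at hqAB; omega
      have hqe : q % 2 = 0 := by
        rw [hqAB]
        rcases k5 with ⟨h, h'⟩ | ⟨h, h'⟩ <;> simp [Int.mul_emod, h, h']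
      have hpo : p % 2 = 1 := by
        rcases Int.emod_two_eq_zero_or_one p with e | e
        · exfalso
          have : p ^ 2 % 2 = 0 := by simp [pow_two, Int.mul_emod, e]
          have : q ^ 2 % 2 = 0 := by simp [pow_two, Int.mul_emod, hqe]
          omega
        · exact e
      have t2 : PythagoreanTriple p q r := by
        unfold PythagoreanTriple; linear_combination -hp
      have hcp : IsCoprime p q := by
        have e1 : IsCoprime (p ^ 2) (q ^ 2) :=
          ⟨u, u + v, by linear_combination huv - u * hp⟩
        exact (IsCoprime.pow_iff two_pos two_pos).1 e1
      obtain ⟨a, b, l1, l2, l3, l4, l5, -⟩ := t2.coprime_classification'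
        (Int.isCoprime_iff_gcd_eq_one.1 hcp) hpo hrpos
      have hAB : IsCoprime A B := Int.isCoprime_iff_gcd_eq_one.2 k4
      rcases k5 with ⟨h, h'⟩ | ⟨h, h'⟩
      · rw [hqAB]
        exact step_48a_one hAB hA0 hB0 h h' (hqAB.symm.trans l2) (k3.symm.trans l3)
      · rw [hqAB, mul_comm A B]
        exact step_48a_one hAB.symm hB0 hA0 h' h (by rw [mul_comm B A]; exact hqAB.symm.trans l2)
          (by rw [add_comm]; exact k3.symm.trans l3)
    · exfalso
      have := sq4 s
      omega


lemma int_sq_of_rat {n : ℤ} {x : ℚ} (h : (n : ℚ) = x ^ 2) : ∃ t : ℤ, n = t ^ 2 := by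
  have : IsSquare (n : ℚ) := ⟨x, by rw [h, pow_two]⟩
  obtain ⟨t, ht⟩ := Rat.isSquare_intCast_iff.1 this
  exact ⟨t, by rw [ht, pow_two]⟩

lemma coprime_num_den (v : ℚ) : IsCoprime v.num (v.den : ℤ) := by
  rw [Int.isCoprime_iff_gcd_eq_one]; exact v.reduced

lemma rat_24a {v p s : ℚ} (h1 : v ^ 2 + 1 = p ^ 2) (h2 : v ^ 2 + 4 = s ^ 2) : v = 0 := by
  have hd : (v.den : ℚ) ≠ 0 := by exact_mod_cast v.den_ne_zero
  have hv : v * v.den = v.num := Rat.mul_den_eq_num v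
  have hc := coprime_num_den v
  obtain ⟨t, ht⟩ := int_sq_of_rat
    (n := (v.num ^ 2 + (v.den : ℤ) ^ 2) * (v.num ^ 2 + 4 * (v.den : ℤ) ^ 2))
    (x := p * s * v.den ^ 2) (by
      push_cast
      rw [← hv]
      linear_combination (v.den : ℚ) ^ 4 * ((v ^ 2 + 4) * h1 + p ^ 2 * h2))
  rcases Int.emod_two_eq_zero_or_one v.num with h | h
  · obtain ⟨r, hr⟩ : ∃ r, v.num = 2 * r := ⟨v.num / 2, by omega⟩
    rw [hr] at hc ht
    have hodd : (v.den : ℤ) % 2 = 1 := by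
      rcases Int.emod_two_eq_zero_or_one (v.den : ℤ) with h' | h'
      · exfalso
        have := hc.isUnit_of_dvd' (Dvd.intro r rfl) (Int.dvd_of_emod_eq_zero h')
        rw [Int.isUnit_iff] at this; omega
      · exact h'
    obtain ⟨t', ht'⟩ := sq_of_mul_sq (c := 2)
      (x := ((v.den : ℤ) ^ 2 + r ^ 2) * ((v.den : ℤ) ^ 2 + 4 * r ^ 2)) (y := t) two_ne_zero
      (by rw [← ht]; ring)
    have := descent_24a r.natAbs (v.den : ℤ) r t' rfl hc.of_mul_left_right.symm hodd ht'
    rw [this] at hr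
    exact Rat.num_eq_zero.1 (by simpa using hr)
  · have := descent_24a _ _ _ t rfl hc h ht
    exact absurd (by exact_mod_cast this) v.den_ne_zero

lemma four_sq {u y : ℚ} (h : y ^ 2 = (u ^ 2 - 1) * (u ^ 2 - 9)) : y = 0 ∨ u = 0 := by
  by_cases hu : u = 0
  · exact Or.inr hu
  · left
    have h0 : y / (2 * u) = 0 := by
      apply rat_24a (p := (u - 3 / u) / 2) (s := (u + 3 / u) / 2)
      · field_simp; linear_combination h
      · field_simp; linear_combination h
    simpa [hu] using h0

lemma four_sq' {u y : ℚ} (h : y ^ 2 = (u ^ 2 - 1) * (u ^ 2 - 4)) : y = 0 ∨ u = 0 := by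
  by_contra! hne
  obtain ⟨hy, hu⟩ := hne
  have hd : (u.den : ℚ) ≠ 0 := by exact_mod_cast u.den_ne_zero
  have hv : u * u.den = u.num := Rat.mul_den_eq_num u
  have hc := coprime_num_den u
  have e : (((u.num ^ 2 - (u.den : ℤ) ^ 2) * (u.num ^ 2 - 4 * (u.den : ℤ) ^ 2) : ℤ) : ℚ)
      = (y * u.den ^ 2) ^ 2 := by
    push_cast
    rw [← hv]
    linear_combination -(u.den : ℚ) ^ 4 * h
  obtain ⟨t, ht⟩ := int_sq_of_rat e
  have ht0 : t ≠ 0 := by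
    rintro rfl
    rw [ht] at e
    have : y * (u.den : ℚ) ^ 2 = 0 := by
      have := e.symm; simpa using this
    exact (mul_ne_zero hy (pow_ne_zero 2 hd)) this
  rcases Int.emod_two_eq_zero_or_one u.num with h | h
  · obtain ⟨r, hr⟩ : ∃ r, u.num = 2 * r := ⟨u.num / 2, by omega⟩
    rw [hr] at hc ht
    have hodd : (u.den : ℤ) % 2 = 1 := by
      rcases Int.emod_two_eq_zero_or_one (u.den : ℤ) with h' | h'
      · exfalso
        have := hc.isUnit_of_dvd' (Dvd.intro r rfl) (Int.dvd_of_emod_eq_zero h')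
        rw [Int.isUnit_iff] at this; omega
      · exact h'
    obtain ⟨t', ht'⟩ := sq_of_mul_sq (c := 2)
      (x := ((u.den : ℤ) ^ 2 - r ^ 2) * ((u.den : ℤ) ^ 2 - 4 * r ^ 2)) (y := t) two_ne_zero
      (by rw [← ht]; ring)
    have ht'0 : t' ≠ 0 := by
      rintro rfl
      apply ht0
      have : t ^ 2 = 0 := by linear_combination 4 * ht' - ht
      exact (pow_eq_zero_iff two_ne_zero).1 this
    have := descent_48a r.natAbs (u.den : ℤ) r t' rfl hc.of_mul_left_right.symm hodd ht'0 ht'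
    rw [this] at hr
    exact hu (Rat.num_eq_zero.1 (by simpa using hr))
  · have := descent_48a _ _ _ t rfl hc h ht0 ht
    exact absurd (by exact_mod_cast this) u.den_ne_zero

/-- The rational core of the non-rational case: `T`, `N` are trace and norm of a quadratic
irrationality `u`, and the third intersection point `ρ` of a parabola with the quartic gives a
rational point on it. -/
lemma rat_core {T N β γ ρ n₁ n₃ : ℚ} (hβ : β ≠ 0)
    (hid : ∀ X : ℚ, (X ^ 2 + β * X + γ) ^ 2 - (X ^ 2 - 1) * (X ^ 2 - 9) =
      2 * β * (X - ρ) * (X ^ 2 - T * X + N))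
    (h1 : (1 - T + N) * (1 + T + N) = n₁ ^ 2) (h3 : (9 - 3 * T + N) * (9 + 3 * T + N) = n₃ ^ 2)
    (hn1 : n₁ ≠ 0) (hn3 : n₃ ≠ 0) : False := by
  have e1 := hid 1
  have e2 := hid (-1)
  have e3 := hid 3
  have e4 := hid (-3)
  have e5 := hid ρ
  have f1 : ((1 + β + γ) * (1 - β + γ)) ^ 2 = (2 * β * n₁) ^ 2 * (ρ ^ 2 - 1) := by
    have a1 : (1 + β + γ) ^ 2 = 2 * β * (1 - ρ) * (1 - T + N) := by linear_combination e1
    have a2 : (1 - β + γ) ^ 2 = 2 * β * (-1 - ρ) * (1 + T + N) := by linear_combination e2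
    rw [mul_pow, a1, a2, mul_pow, ← h1]; ring
  have f3 : ((9 + 3 * β + γ) * (9 - 3 * β + γ)) ^ 2 = (2 * β * n₃) ^ 2 * (ρ ^ 2 - 9) := by
    have a1 : (9 + 3 * β + γ) ^ 2 = 2 * β * (3 - ρ) * (9 - 3 * T + N) := by linear_combination e3
    have a2 : (9 - 3 * β + γ) ^ 2 = 2 * β * (-3 - ρ) * (9 + 3 * T + N) := by
      linear_combination e4
    rw [mul_pow, a1, a2, mul_pow, ← h3]; ring
  have p1 : 0 < (2 * β * n₁) ^ 2 := by positivity
  have p3 : 0 < (2 * β * n₃) ^ 2 := by positivity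
  have hy : (ρ ^ 2 + β * ρ + γ) ^ 2 = (ρ ^ 2 - 1) * (ρ ^ 2 - 9) := by linear_combination e5
  have hge1 : 0 ≤ ρ ^ 2 - 1 := by
    by_contra hlt
    push Not at hlt
    have := mul_neg_of_pos_of_neg p1 hlt
    rw [← f1] at this; exact absurd this (not_lt.2 (sq_nonneg _))
  have hge3 : 0 ≤ ρ ^ 2 - 9 := by
    by_contra hlt
    push Not at hlt
    have := mul_neg_of_pos_of_neg p3 hlt
    rw [← f3] at this; exact absurd this (not_lt.2 (sq_nonneg _))
  rcases four_sq hy with h | h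
  · rw [h] at hy
    have h9 : ρ ^ 2 - 9 = 0 := by
      rcases mul_eq_zero.1 (hy.symm.trans (by norm_num)) with k | k
      · linarith
      · exact k
    have h8 : ρ ^ 2 - 1 = 8 := by linarith
    rw [h8] at f1
    have hsq : ((1 + β + γ) * (1 - β + γ) / (2 * β * n₁)) ^ 2 = 8 := by
      rw [div_pow, f1]; field_simp
    have : ¬ IsSquare (8 : ℚ) := by norm_num
    exact this ⟨_, by rw [← pow_two, hsq]⟩
  · rw [h] at hge1; norm_num at hge1

section field

variable {K : Type*} [Field K] [CharZero K]

/-- The non-rational case for four squares. -/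
lemma nonrational {s : K} {D : ℚ} (hs : s ^ 2 = (D : K)) (hD : ∀ q : ℚ, q ^ 2 ≠ D)
    (hbasis : ∀ z : K, ∃ a b : ℚ, z = a + b * s)
    (hind : ∀ a b : ℚ, (a : K) + b * s = 0 → a = 0 ∧ b = 0)
    {u w₁ w₃ : K} (h1 : w₁ ^ 2 = u ^ 2 - 1) (h3 : w₃ ^ 2 = u ^ 2 - 9)
    (hu : ∀ q : ℚ, u ≠ q) : ∃ q : ℚ, u ^ 2 = q := by
  obtain ⟨a, b, hab⟩ := hbasis u
  have hb : b ≠ 0 := by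
    rintro rfl
    exact hu a (by simpa using hab)
  have norm_sq : ∀ (m : ℚ) (w : K), w ^ 2 = u ^ 2 - (m : K) ^ 2 → ∃ n : ℚ, n ≠ 0 ∧
      (m ^ 2 - m * (2 * a) + (a ^ 2 - D * b ^ 2)) * (m ^ 2 + m * (2 * a) + (a ^ 2 - D * b ^ 2))
        = n ^ 2 := by
    intro m w hw
    obtain ⟨c, e, hce⟩ := hbasis w
    have h := hind (c ^ 2 + D * e ^ 2 - (a ^ 2 + D * b ^ 2 - m ^ 2)) (2 * c * e - 2 * a * b) (by
      push_cast
      rw [hab, hce] at hw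
      linear_combination hw + ((b : K) ^ 2 - e ^ 2) * hs)
    have heq : (m ^ 2 - m * (2 * a) + (a ^ 2 - D * b ^ 2)) *
        (m ^ 2 + m * (2 * a) + (a ^ 2 - D * b ^ 2)) = (c ^ 2 - D * e ^ 2) ^ 2 := by
      linear_combination (-(c ^ 2 + D * e ^ 2 + (a ^ 2 + D * b ^ 2 - m ^ 2))) * h.1 +
        D * (2 * c * e + 2 * a * b) * h.2
    refine ⟨c ^ 2 - D * e ^ 2, ?_, heq⟩
    intro h0
    rw [h0] at heq
    rcases mul_eq_zero.1 (heq.trans (by norm_num)) with k | k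
    · apply hD ((m - a) / b)
      rw [div_pow, div_eq_iff (pow_ne_zero 2 hb)]; linear_combination k
    · apply hD ((m + a) / b)
      rw [div_pow, div_eq_iff (pow_ne_zero 2 hb)]; linear_combination k
  obtain ⟨n₁, hn1, hN1⟩ := norm_sq 1 w₁ (by rw [h1]; norm_num)
  obtain ⟨n₃, hn3, hN3⟩ := norm_sq 3 w₃ (by rw [h3]; norm_num)
  -- the parabola
  obtain ⟨β, γ, hy⟩ : ∃ β γ : ℚ, w₁ * w₃ = u ^ 2 + β * u + γ := by
    obtain ⟨e, f, hef⟩ := hbasis (w₁ * w₃ - u ^ 2)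
    refine ⟨f / b, e - f / b * a, ?_⟩
    have hb' : (b : K) ≠ 0 := by exact_mod_cast hb
    have : (f : K) / b * b = f := div_mul_cancel₀ _ hb'
    push_cast
    linear_combination hef - (f : K) / b * hab - s * this
  have hcub : (2 * β : K) * u ^ 3 + (β ^ 2 + 2 * γ + 10) * u ^ 2 + 2 * β * γ * u + (γ ^ 2 - 9) = 0 := by
    have e : (w₁ * w₃) ^ 2 = (u ^ 2 - 1) * (u ^ 2 - 9) := by rw [mul_pow, h1, h3]
    rw [hy] at e
    linear_combination e
  by_cases hβ : β = 0
  · subst hβ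
    have h10 : (10 + 2 * γ) ≠ 0 := by
      intro h
      have hγ : γ = -5 := by linarith
      rw [hγ] at hcub
      push_cast at hcub
      have : (16 : K) = 0 := by linear_combination hcub
      norm_num at this
    refine ⟨(9 - γ ^ 2) / (10 + 2 * γ), ?_⟩
    have h10' : (10 + 2 * γ : K) ≠ 0 := by exact_mod_cast h10
    push_cast at hcub ⊢
    rw [eq_div_iff h10']
    linear_combination hcub
  · exfalso
    have hmin : u ^ 2 = 2 * a * u - (a ^ 2 - D * b ^ 2) := by
      rw [hab]; linear_combination (b : K) ^ 2 * hs
    obtain ⟨ρ, hρ⟩ : ∃ ρ : ℚ, β ^ 2 + 2 * γ + 10 + 2 * β * (2 * a) + 2 * β * ρ = 0 :=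
      ⟨-(β ^ 2 + 2 * γ + 10 + 2 * β * (2 * a)) / (2 * β), by field_simp; ring⟩
    have hρK : (β : K) ^ 2 + 2 * γ + 10 + 2 * β * (2 * a) + 2 * β * ρ = 0 := by exact_mod_cast hρ
    have hlin : ((2 * β * γ - 2 * β * (a ^ 2 - D * b ^ 2) - 2 * β * ρ * (2 * a) : ℚ) : K) * u +
        ((γ ^ 2 - 9 + 2 * β * ρ * (a ^ 2 - D * b ^ 2) : ℚ) : K) = 0 := by
      push_cast
      linear_combination hcub - 2 * β * (u - ρ) * hmin - u ^ 2 * hρK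
    generalize hA : 2 * β * γ - 2 * β * (a ^ 2 - D * b ^ 2) - 2 * β * ρ * (2 * a) = A at hlin
    generalize hB : γ ^ 2 - 9 + 2 * β * ρ * (a ^ 2 - D * b ^ 2) = B at hlin
    have hA0 : A = 0 := by
      by_contra hne
      have hne' : (A : K) ≠ 0 := by exact_mod_cast hne
      apply hu (-B / A)
      push_cast
      rw [eq_div_iff hne']; linear_combination hlin
    have hB0 : B = 0 := by
      rw [hA0] at hlin
      have : (B : K) = 0 := by simpa using hlin
      exact_mod_cast this
    refine rat_core (T := 2 * a) (N := a ^ 2 - D * b ^ 2) (ρ := ρ) (γ := γ) hβ ?_ (n₁ := n₁)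
      (n₃ := n₃) (by rw [← hN1]; ring) (by rw [← hN3]; ring) hn1 hn3
    intro X
    rw [hA0] at hA
    rw [hB0] at hB
    linear_combination X ^ 2 * hρ + X * hA + hB

end field


/-- `z` is a rational square or `D` times a rational square. -/
def SqOrD (D z : ℚ) : Prop := ∃ g : ℚ, z = g ^ 2 ∨ z = D * g ^ 2

lemma two_nonsq {D α β : ℚ} (h1 : SqOrD D α) (h2 : SqOrD D β) (n1 : ¬ IsSquare α)
    (n2 : ¬ IsSquare β) (n3 : ¬ IsSquare (α * β)) : False := by
  obtain ⟨g, hg | hg⟩ := h1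
  · exact n1 ⟨g, by rw [hg, pow_two]⟩
  · obtain ⟨k, hk | hk⟩ := h2
    · exact n2 ⟨k, by rw [hk, pow_two]⟩
    · exact n3 ⟨D * g * k, by rw [hg, hk]; ring⟩

lemma not_isSquare_of_neg {z : ℚ} (h : z < 0) : ¬ IsSquare z := by
  rintro ⟨g, hg⟩
  nlinarith [mul_self_nonneg g]

lemma not_sq_three_quarters : ¬ IsSquare (3 / 4 : ℚ) := by
  rintro ⟨g, hg⟩
  have : ¬ IsSquare (3 : ℚ) := by norm_num
  exact this ⟨2 * g, by linear_combination 4 * hg⟩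

/-- The rational case: all types but `{1}` and `{3}` are excluded. -/
lemma rat_types {D x : ℚ}
    (h01 : SqOrD D (x * (x + 1))) (h02 : SqOrD D (x * (x + 2)))
    (h12 : SqOrD D ((x + 1) * (x + 2))) (h13 : SqOrD D ((x + 1) * (x + 3)))
    (h23 : SqOrD D ((x + 2) * (x + 3))) (h24 : SqOrD D ((x + 2) * (x + 4)))
    (h34 : SqOrD D ((x + 3) * (x + 4))) :
    x + 2 ≠ 0 ∧ ∃ g₀ g₁ g₃ g₄ : ℚ, x * (x + 2) = g₀ ^ 2 ∧ (x + 2) * (x + 4) = g₄ ^ 2 ∧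
      (((x + 1) * (x + 2) = g₁ ^ 2 ∧ (x + 2) * (x + 3) = D * g₃ ^ 2) ∨
       ((x + 1) * (x + 2) = D * g₁ ^ 2 ∧ (x + 2) * (x + 3) = g₃ ^ 2)) := by
  have q2 : ¬ IsSquare (2 : ℚ) := by norm_num
  have q3 : ¬ IsSquare (3 : ℚ) := by norm_num
  have q6 : ¬ IsSquare (6 : ℚ) := by norm_num
  have z0 : x ≠ 0 := by
    rintro rfl
    norm_num at h12 h13
    exact two_nonsq h12 h13 q2 q3 (by norm_num)
  have z1 : x + 1 ≠ 0 := by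
    intro h
    obtain rfl : x = -1 := by linarith
    norm_num at h02 h23
    exact two_nonsq h02 h23 (not_isSquare_of_neg (by norm_num)) q2
      (not_isSquare_of_neg (by norm_num))
  have z2 : x + 2 ≠ 0 := by
    intro h
    obtain rfl : x = -2 := by linarith
    norm_num at h13 h01
    exact two_nonsq h13 h01 (not_isSquare_of_neg (by norm_num)) q2
      (not_isSquare_of_neg (by norm_num))
  have z3 : x + 3 ≠ 0 := by
    intro h
    obtain rfl : x = -3 := by linarith
    norm_num at h24 h12
    exact two_nonsq h24 h12 (not_isSquare_of_neg (by norm_num)) q2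
      (not_isSquare_of_neg (by norm_num))
  have z4 : x + 4 ≠ 0 := by
    intro h
    obtain rfl : x = -4 := by linarith
    norm_num at h23 h13
    exact two_nonsq h23 h13 q2 q3 (by norm_num)
  have z5 : 2 * x + 3 ≠ 0 := by
    intro h
    obtain rfl : x = -3 / 2 := by linarith
    norm_num at h12 h01
    exact two_nonsq h12 h01 (not_isSquare_of_neg (by norm_num)) not_sq_three_quarters
      (not_isSquare_of_neg (by norm_num))
  have z6 : 2 * x + 5 ≠ 0 := by
    intro h
    obtain rfl : x = -5 / 2 := by linarith
    norm_num at h23 h34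
    exact two_nonsq h23 h34 (not_isSquare_of_neg (by norm_num)) not_sq_three_quarters
      (not_isSquare_of_neg (by norm_num))
  have n1 : ∀ Y : ℚ, x * (x + 2) * ((x + 1) * (x + 2)) * ((x + 2) * (x + 3)) ≠ Y ^ 2 := by
    intro Y hY
    have hY0 : Y ≠ 0 := by
      rintro rfl
      simp [z0, z1, z2, z3] at hY
    rcases four_sq (u := 2 * x + 3) (y := 4 * Y / (x + 2)) (by
      rw [div_pow, div_eq_iff (pow_ne_zero 2 z2)]; linear_combination -16 * hY) with k | k
    · simp [hY0, z2] at k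
    · exact z5 k
  have n2 : ∀ Y : ℚ, (x + 1) * (x + 2) * ((x + 2) * (x + 3)) * ((x + 2) * (x + 4)) ≠ Y ^ 2 := by
    intro Y hY
    have hY0 : Y ≠ 0 := by
      rintro rfl
      simp [z4, z1, z2, z3] at hY
    rcases four_sq (u := 2 * x + 5) (y := 4 * Y / (x + 2)) (by
      rw [div_pow, div_eq_iff (pow_ne_zero 2 z2)]; linear_combination -16 * hY) with k | k
    · simp [hY0, z2] at k
    · exact z6 k
  have n3 : ∀ Y : ℚ, x * (x + 2) * ((x + 1) * (x + 2)) * ((x + 2) * (x + 3)) *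
      ((x + 2) * (x + 4)) ≠ Y ^ 2 := by
    intro Y hY
    have hY0 : Y ≠ 0 := by
      rintro rfl
      simp [z0, z4, z1, z2, z3] at hY
    rcases four_sq' (u := x + 2) (y := Y / (x + 2) ^ 2) (by
      rw [div_pow, div_eq_iff (pow_ne_zero 2 (pow_ne_zero 2 z2))]
      linear_combination -hY) with k | k
    · simp [hY0, z2] at k
    · exact z2 k
  refine ⟨z2, ?_⟩
  obtain ⟨g₀, h0⟩ := h02
  obtain ⟨g₁, h1⟩ := h12
  obtain ⟨g₃, h3⟩ := h23
  obtain ⟨g₄, h4⟩ := h24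
  refine ⟨g₀, g₁, g₃, g₄, ?_⟩
  rcases h0 with h0 | h0 <;> rcases h1 with h1 | h1 <;> rcases h3 with h3 | h3 <;>
    rcases h4 with h4 | h4 <;> rw [h0, h1, h3] at n1 <;> rw [h1, h3, h4] at n2 <;>
    rw [h0, h1, h3, h4] at n3 <;>
    first
    | exact ⟨h0, h4, Or.inl ⟨h1, h3⟩⟩
    | exact ⟨h0, h4, Or.inr ⟨h1, h3⟩⟩
    | (exfalso; apply n1 (g₀ * g₁ * g₃); ring1)
    | (exfalso; apply n1 (D * g₀ * g₁ * g₃); ring1)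
    | (exfalso; apply n2 (g₁ * g₃ * g₄); ring1)
    | (exfalso; apply n2 (D * g₁ * g₃ * g₄); ring1)
    | (exfalso; apply n3 (g₀ * g₁ * g₃ * g₄); ring1)
    | (exfalso; apply n3 (D * g₀ * g₁ * g₃ * g₄); ring1)
    | (exfalso; apply n3 (D ^ 2 * g₀ * g₁ * g₃ * g₄); ring1)

lemma sqOrD_of_sq {K : Type*} [Field K] [CharZero K] {s : K} {D : ℚ} (hs : s ^ 2 = (D : K))
    (hbasis : ∀ z : K, ∃ a b : ℚ, z = a + b * s)
    (hind : ∀ a b : ℚ, (a : K) + b * s = 0 → a = 0 ∧ b = 0)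
    {z : ℚ} {w : K} (h : w ^ 2 = z) : SqOrD D z := by
  obtain ⟨a, b, rfl⟩ := hbasis w
  obtain ⟨k1, k2⟩ := hind (a ^ 2 + D * b ^ 2 - z) (2 * a * b) (by
    push_cast
    linear_combination h - (b : K) ^ 2 * hs)
  rcases mul_eq_zero.1 k2 with k | k
  · have ha : a = 0 := by linarith
    subst ha
    exact ⟨b, Or.inr (by linarith)⟩
  · subst k
    exact ⟨a, Or.inl (by linarith)⟩

end FiveSq

/-- **Non-constant arithmetic progressions of five squares over `ℚ(√D)` are of type `{3}`.**
If `x₀², …, x₄²` is a non-constant arithmetic progression in `ℚ(√D)` (here `K` is any field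
realizing `ℚ(√D)`, i.e. a quadratic extension of `ℚ` containing a square root `s` of `D`),
then, up to multiplying by the square of a nonzero constant and possibly reversing the
progression, all terms but the fourth are squares of rationals and the fourth is `D` times
the square of a rational. -/
theorem five_squares_AP_type_three
    (D : ℤ) (hD : Squarefree D) (hD1 : D ≠ 1)
    (K : Type*) [Field K] [Algebra ℚ K] (hdeg : Module.finrank ℚ K = 2)
    (s : K) (hs : s ^ 2 = (D : K))
    (x₀ x₁ x₂ x₃ x₄ : K)
    (hAP : x₁ ^ 2 - x₀ ^ 2 = x₂ ^ 2 - x₁ ^ 2 ∧ x₂ ^ 2 - x₁ ^ 2 = x₃ ^ 2 - x₂ ^ 2 ∧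
      x₃ ^ 2 - x₂ ^ 2 = x₄ ^ 2 - x₃ ^ 2)
    (hnc : x₁ ^ 2 - x₀ ^ 2 ≠ 0) :
    ∃ c : K, c ≠ 0 ∧ ∃ X₀ X₁ X₂ X₃ X₄ : ℚ,
      (((c * x₀) ^ 2 = algebraMap ℚ K (X₀ ^ 2) ∧
        (c * x₁) ^ 2 = algebraMap ℚ K (X₁ ^ 2) ∧
        (c * x₂) ^ 2 = algebraMap ℚ K (X₂ ^ 2) ∧
        (c * x₃) ^ 2 = (D : K) * algebraMap ℚ K (X₃ ^ 2) ∧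
        (c * x₄) ^ 2 = algebraMap ℚ K (X₄ ^ 2)) ∨
      ((c * x₄) ^ 2 = algebraMap ℚ K (X₀ ^ 2) ∧
        (c * x₃) ^ 2 = algebraMap ℚ K (X₁ ^ 2) ∧
        (c * x₂) ^ 2 = algebraMap ℚ K (X₂ ^ 2) ∧
        (c * x₁) ^ 2 = (D : K) * algebraMap ℚ K (X₃ ^ 2) ∧
        (c * x₀) ^ 2 = algebraMap ℚ K (X₄ ^ 2))) := by
  have : CharZero K := algebraRat.charZero K
  obtain ⟨E, hE⟩ : ∃ E : ℚ, E = (D : ℚ) := ⟨_, rfl⟩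
  have hsE : s ^ 2 = (E : K) := by rw [hs, hE]; simp
  have hDE : (D : K) = (E : K) := by rw [hE]; simp
  have hDsq : ∀ q : ℚ, q ^ 2 ≠ E := by
    intro q hq
    obtain ⟨t, ht⟩ := FiveSq.int_sq_of_rat (n := D) (x := q) (by rw [hq, hE])
    have hunit : IsUnit t := hD t ⟨1, by rw [ht]; ring⟩
    rcases Int.isUnit_iff.1 hunit with h | h <;> rw [h] at ht <;> norm_num at ht <;> exact hD1 ht
  have hind : ∀ a b : ℚ, (a : K) + b * s = 0 → a = 0 ∧ b = 0 := by
    intro a b hab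
    have hb : b = 0 := by
      by_contra hb
      apply hDsq (a / b)
      have hbK : (b : K) ≠ 0 := by exact_mod_cast hb
      have h1 : (a : K) ^ 2 = E * b ^ 2 := by
        linear_combination ((a : K) - b * s) * hab + (b : K) ^ 2 * hsE
      have h2 : a ^ 2 = E * b ^ 2 := by exact_mod_cast h1
      rw [div_pow, div_eq_iff (pow_ne_zero 2 hb), h2]
    subst hb
    exact ⟨by simpa using hab, rfl⟩
  have hbasis : ∀ z : K, ∃ a b : ℚ, z = a + b * s := by
    have hli : LinearIndependent ℚ ![(1 : K), s] := by
      rw [LinearIndependent.pair_iff]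
      intro a b hab
      apply hind a b
      rw [Algebra.smul_def, Algebra.smul_def] at hab
      simpa using hab
    have hspan := hli.span_eq_top_of_card_eq_finrank (by simp [hdeg])
    intro z
    have hz : z ∈ Submodule.span ℚ (Set.range ![(1 : K), s]) := by rw [hspan]; trivial
    rw [Matrix.range_cons, Matrix.range_cons, Matrix.range_empty, Set.union_empty,
      Set.singleton_union, Submodule.mem_span_pair] at hz
    obtain ⟨a, b, hab⟩ := hz
    refine ⟨a, b, ?_⟩
    rw [← hab, Algebra.smul_def, Algebra.smul_def]
    simp
  obtain ⟨hA1, hA2, hA3⟩ := hAP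
  obtain ⟨d, hd⟩ : ∃ d, d = x₁ ^ 2 - x₀ ^ 2 := ⟨_, rfl⟩
  rw [← hd] at hnc hA1
  obtain ⟨x, hx⟩ : ∃ x, x = x₀ ^ 2 / d := ⟨_, rfl⟩
  have e0 : x₀ ^ 2 = d * x := by rw [hx]; field_simp
  have e1 : x₁ ^ 2 = d * (x + 1) := by linear_combination e0 - hd
  have e2 : x₂ ^ 2 = d * (x + 2) := by linear_combination e1 - hA1
  have e3 : x₃ ^ 2 = d * (x + 3) := by linear_combination e2 - hA2 - hA1
  have e4 : x₄ ^ 2 = d * (x + 4) := by linear_combination e3 - hA3 - hA2 - hA1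
  have pair : ∀ {y z a b : K}, y ^ 2 = d * a → z ^ 2 = d * b → (y * z / d) ^ 2 = a * b := by
    intro y z a b hy hz
    rw [div_pow, mul_pow, hy, hz]; field_simp
  have hrat : ∃ q : ℚ, x = q := by
    by_contra! hno
    obtain ⟨q₁, hq₁⟩ := FiveSq.nonrational hsE hDsq hbasis hind (u := 2 * x + 3)
      (w₁ := 2 * (x₁ * x₂ / d)) (w₃ := 2 * (x₀ * x₃ / d))
      (by rw [mul_pow, pair e1 e2]; ring) (by rw [mul_pow, pair e0 e3]; ring)
      (by
        intro q hq
        apply hno ((q - 3) / 2)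
        push_cast
        linear_combination hq / 2)
    obtain ⟨q₂, hq₂⟩ := FiveSq.nonrational hsE hDsq hbasis hind (u := 2 * x + 5)
      (w₁ := 2 * (x₂ * x₃ / d)) (w₃ := 2 * (x₁ * x₄ / d))
      (by rw [mul_pow, pair e2 e3]; ring) (by rw [mul_pow, pair e1 e4]; ring)
      (by
        intro q hq
        apply hno ((q - 5) / 2)
        push_cast
        linear_combination hq / 2)
    apply hno ((q₂ - q₁ - 16) / 8)
    push_cast
    linear_combination (hq₂ - hq₁) / 8
  obtain ⟨X, rfl⟩ := hrat
  have sq : ∀ {z : ℚ} {w : K}, w ^ 2 = z → FiveSq.SqOrD E z :=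
    fun h => FiveSq.sqOrD_of_sq hsE hbasis hind h
  obtain ⟨z2, g₀, g₁, g₃, g₄, h0, h4, h13⟩ := FiveSq.rat_types (D := E) (x := X)
    (sq (by rw [pair e0 e1]; push_cast; ring)) (sq (by rw [pair e0 e2]; push_cast; ring))
    (sq (by rw [pair e1 e2]; push_cast; ring)) (sq (by rw [pair e1 e3]; push_cast; ring))
    (sq (by rw [pair e2 e3]; push_cast; ring)) (sq (by rw [pair e2 e4]; push_cast; ring))
    (sq (by rw [pair e3 e4]; push_cast; ring))
  have z2K : (X : K) + 2 ≠ 0 := by exact_mod_cast z2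
  have hx2 : x₂ ≠ 0 := by
    rintro rfl
    exact mul_ne_zero hnc z2K (by rw [← e2]; norm_num)
  have fin : ∀ {y : K} {a R g : ℚ}, y ^ 2 = d * a → a * (X + 2) = R * g ^ 2 →
      (x₂⁻¹ * y) ^ 2 = (R : K) * algebraMap ℚ K ((g / (X + 2)) ^ 2) := by
    intro y a R g hy ha
    have haK : (a : K) * (X + 2) = R * g ^ 2 := by exact_mod_cast ha
    rw [mul_pow, inv_pow, hy, e2, eq_ratCast]
    push_cast
    field_simp
    linear_combination haK
  have fin1 : ∀ {y : K} {a g : ℚ}, y ^ 2 = d * a → a * (X + 2) = g ^ 2 →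
      (x₂⁻¹ * y) ^ 2 = algebraMap ℚ K ((g / (X + 2)) ^ 2) := by
    intro y a g hy ha
    have := fin (R := 1) hy (by rw [ha]; ring)
    simpa using this
  have e1' : x₁ ^ 2 = d * ((X + 1 : ℚ) : K) := by rw [e1]; push_cast; ring
  have e2' : x₂ ^ 2 = d * ((X + 2 : ℚ) : K) := by rw [e2]; push_cast; ring
  have e3' : x₃ ^ 2 = d * ((X + 3 : ℚ) : K) := by rw [e3]; push_cast; ring
  have e4' : x₄ ^ 2 = d * ((X + 4 : ℚ) : K) := by rw [e4]; push_cast; ring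
  rw [hDE]
  rcases h13 with ⟨h1, h3⟩ | ⟨h1, h3⟩
  · exact ⟨x₂⁻¹, inv_ne_zero hx2, g₀ / (X + 2), g₁ / (X + 2), (X + 2) / (X + 2), g₃ / (X + 2),
      g₄ / (X + 2), Or.inl ⟨fin1 e0 h0, fin1 e1' h1, fin1 e2' (by ring),
        fin e3' (by rw [← h3]; ring), fin1 e4' (by rw [← h4]; ring)⟩⟩
  · exact ⟨x₂⁻¹, inv_ne_zero hx2, g₄ / (X + 2), g₃ / (X + 2), (X + 2) / (X + 2), g₁ / (X + 2),
      g₀ / (X + 2), Or.inr ⟨fin1 e4' (by rw [← h4]; ring), fin1 e3' (by rw [← h3]; ring),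
        fin1 e2' (by ring), fin e1' h1, fin1 e0 h0⟩⟩
end

section
/- Let D be a squarefree integer with D ≠ 1. There exists a non-constant arithmetic progression of five squares x₀²,…,x₄² with x₀,…,x₄ ∈ ℚ(√D) if and only if there exists a nonzero tuple (X₀,X₁,X₂,X₃,X₄) ∈ ℚ⁵ satisfying X₀² − 2X₁² + X₂² = 0, X₁² − 2X₂² + D·X₃² = 0 and X₂² − 2D·X₃² + X₄² = 0 (i.e. if and only if C_D(ℚ) ≠ ∅). -/
lemma four_num {X y m n : ℤ} (h : X * y = m * n) (hX : X ≠ 0) :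
    ∃ a b c d : ℤ, X = a * b ∧ y = c * d ∧ m = a * c ∧ n = b * d := by
  obtain ⟨a, hh⟩ : ∃ a : ℤ, a = (Int.gcd X m : ℤ) := ⟨_, rfl⟩
  have hg : Int.gcd X m ≠ 0 := by
    intro h0; exact hX (Int.gcd_eq_zero_iff.1 h0).1
  have ha : a ≠ 0 := by rw [hh]; exact_mod_cast hg
  obtain ⟨b, hb⟩ : a ∣ X := hh ▸ Int.gcd_dvd_left ..
  obtain ⟨c, hc⟩ : a ∣ m := hh ▸ Int.gcd_dvd_right ..
  have hcop : IsCoprime b c := by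
    have hbez := Int.gcd_eq_gcd_ab X m
    rw [← hh] at hbez
    refine ⟨Int.gcdA X m, Int.gcdB X m, ?_⟩
    apply mul_left_cancel₀ ha
    linear_combination -hbez - Int.gcdA X m * hb - Int.gcdB X m * hc
  have h2 : b * y = c * n := by
    apply mul_left_cancel₀ ha
    linear_combination h - y * hb + n * hc
  obtain ⟨d, hd⟩ : c ∣ y := hcop.symm.dvd_of_dvd_mul_left ⟨n, h2⟩
  have hb0 : c ≠ 0 ∨ c = 0 := (em _).symm
  by_cases hc0 : c = 0
  · -- then b is a unit
    subst hc0
    have hbu : IsUnit b := isCoprime_zero_right.1 hcop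
    obtain ⟨b', hb'⟩ := hbu.exists_right_inv
    refine ⟨a, b, 0, b' * n, hb, by simpa using hd, hc, ?_⟩
    linear_combination -n * hb'
  · refine ⟨a, b, c, d, hb, hd, hc, ?_⟩
    apply mul_left_cancel₀ hc0
    rw [← h2, hd]; ring

lemma k_lemma {a d A B b c : ℤ} (had : IsCoprime a d) (ha : a ≠ 0) (h : a ^ 2 * A = d ^ 2 * B)
    (hbc : IsCoprime b c) {u v u' v' : ℤ} (hb : u * A + v * B = 3 * b ^ 2)
    (hc : u' * A + v' * B = 3 * c ^ 2) :
    ∃ k : ℤ, (k = 1 ∨ k = -1 ∨ k = 3 ∨ k = -3) ∧ B = k * a ^ 2 ∧ A = k * d ^ 2 := by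
  obtain ⟨k, hk⟩ : a ^ 2 ∣ B := (had.pow (m := 2) (n := 2)).dvd_of_dvd_mul_left ⟨A, h.symm⟩
  have hA : A = k * d ^ 2 := by
    apply mul_left_cancel₀ (pow_ne_zero 2 ha)
    rw [h, hk]; ring
  refine ⟨k, ?_, by rw [hk]; ring, hA⟩
  have h3 : k ∣ 3 := by
    obtain ⟨r, s, hrs⟩ := hbc.pow (m := 2) (n := 2)
    refine ⟨r * (u * d ^ 2 + v * a ^ 2) + s * (u' * d ^ 2 + v' * a ^ 2), ?_⟩
    rw [hA, hk] at hb hc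
    linear_combination -3 * hrs - r * hb - s * hc
  have h4 : k.natAbs ∣ 3 := Int.natAbs_dvd_natAbs.2 h3
  rcases (Nat.dvd_prime Nat.prime_three).1 h4 with h | h <;> omega

lemma sq_mod4 (a : ℤ) : (a % 2 = 0 ∧ a ^ 2 % 4 = 0) ∨ (a % 2 = 1 ∧ a ^ 2 % 8 = 1) := by
  rcases Int.even_or_odd' a with ⟨k, rfl | rfl⟩
  · left; constructor
    · omega
    · ring_nf; omega
  · right; refine ⟨by omega, ?_⟩
    obtain ⟨r, hr⟩ := (Int.even_mul_succ_self k)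
    have : (2 * k + 1) ^ 2 = 8 * r + 1 := by linear_combination 4 * hr
    omega

lemma not_both_even {a b : ℤ} (h : IsCoprime a b) (ha : a % 2 = 0) (hb : b % 2 = 0) : False := by
  obtain ⟨r, s, h⟩ := h
  obtain ⟨x, rfl⟩ := Int.dvd_of_emod_eq_zero ha
  obtain ⟨y, rfl⟩ := Int.dvd_of_emod_eq_zero hb
  have : 2 * (r * x + s * y) = 1 := by linear_combination h
  omega

lemma abs_lt_aux {x y : ℤ} (hx : x ≠ 0) (hy : y ≠ 0) : x.natAbs < (2 * (x * y)).natAbs := by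
  rw [Int.natAbs_mul, Int.natAbs_mul]
  have := Int.natAbs_pos.2 hx
  have := Int.natAbs_pos.2 hy
  simp only [Int.reduceAbs]
  nlinarith

/-- step for `d² + a²`, `d² + 4a²` -/
lemma step1' {X q m n : ℤ} (h1 : X * q = m * n) (h2 : (2 * X) ^ 2 - q ^ 2 = m ^ 2 - n ^ 2)
    (hpq : IsCoprime (2 * X) q) (hmn : IsCoprime m n) (h0 : X * q ≠ 0) :
    ∃ a b c d : ℤ, a ≠ 0 ∧ d % 2 = 1 ∧ IsCoprime a d ∧ b ^ 2 = a ^ 2 + d ^ 2 ∧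
      c ^ 2 = 4 * a ^ 2 + d ^ 2 ∧ a.natAbs < (2 * (X * q)).natAbs := by
  obtain ⟨a, b, c, d, rfl, rfl, rfl, rfl⟩ := four_num h1 (left_ne_zero_of_mul h0)
  have ha : a ≠ 0 := by rintro rfl; simp at h0
  have hb : b ≠ 0 := by rintro rfl; simp at h0
  have hodd : (c * d) % 2 = 1 := by
    by_contra hc
    exact not_both_even hpq (by omega) (by omega)
  have hcd := Int.odd_mul.1 (Int.odd_iff.2 hodd)
  have hc := Int.odd_iff.1 hcd.1
  have hd := Int.odd_iff.1 hcd.2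
  have had : IsCoprime a d := (hmn.of_mul_left_left).of_mul_right_right
  have hcb : IsCoprime c b := (hmn.of_mul_left_right).of_mul_right_left
  obtain ⟨k, hk, hB, hA⟩ := k_lemma (A := 4 * b ^ 2 - c ^ 2) (B := c ^ 2 - b ^ 2) had ha
    (by linear_combination h2) hcb.symm (u := 1) (v := 1) (u' := 1) (v' := 4) (by ring) (by ring)
  refine ⟨a, b, c, d, ha, hd, had, ?_⟩
  have hpos : 0 < a ^ 2 := by positivity
  have hposb : 0 < b ^ 2 := by positivity
  have hs : 3 * b ^ 2 = k * (a ^ 2 + d ^ 2) := by linear_combination hB + hA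
  have hlt : a.natAbs < (2 * (a * b * (c * d))).natAbs := by
    rw [show a * b * (c * d) = a * (b * (c * d)) by ring]
    refine abs_lt_aux ha (mul_ne_zero hb ?_)
    exact right_ne_zero_of_mul h0
  rcases hk with rfl | rfl | rfl | rfl
  · exfalso
    rcases sq_mod4 c with h | h <;> rcases sq_mod4 d with h' | h' <;> omega
  · nlinarith
  · exact ⟨by linarith, by linarith, hlt⟩
  · nlinarith

lemma step1 {p q m n : ℤ} (h1 : p * q = 2 * (m * n)) (h2 : p ^ 2 - q ^ 2 = m ^ 2 - n ^ 2)
    (hpq : IsCoprime p q) (hmn : IsCoprime m n) (h0 : p * q ≠ 0) :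
    ∃ a b c d : ℤ, a ≠ 0 ∧ d % 2 = 1 ∧ IsCoprime a d ∧ b ^ 2 = a ^ 2 + d ^ 2 ∧
      c ^ 2 = 4 * a ^ 2 + d ^ 2 ∧ a.natAbs < (p * q).natAbs := by
  have he : Even (p * q) := ⟨m * n, by rw [h1]; ring⟩
  rcases Int.even_mul.1 he with ⟨X, hX⟩ | ⟨X, hX⟩
  · obtain rfl : p = 2 * X := by omega
    have := step1' (X := X) (q := q) (m := m) (n := n) (by linarith) h2 hpq hmn
      (by intro h; apply h0; linear_combination 2 * h)
    rwa [show 2 * X * q = 2 * (X * q) by ring]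
  · obtain rfl : q = 2 * X := by omega
    have := step1' (X := X) (q := p) (m := n) (n := m) (by linarith) (by linarith) hpq.symm hmn.symm
      (by intro h; apply h0; linear_combination 2 * h)
    rwa [show p * (2 * X) = 2 * (X * p) by ring]

lemma pyth {x y z : ℤ} (h : x ^ 2 + y ^ 2 = z ^ 2) (hc : IsCoprime x y) (hx : x % 2 = 1) :
    ∃ m n : ℤ, x = m ^ 2 - n ^ 2 ∧ y = 2 * m * n ∧ z ^ 2 = (m ^ 2 + n ^ 2) ^ 2 ∧ IsCoprime m n ∧
      Even (m * n) := by
  have hz : z ≠ 0 := by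
    rintro rfl
    have : x = 0 := by nlinarith [sq_nonneg x, sq_nonneg y]
    omega
  have hp : PythagoreanTriple x y |z| := by
    unfold PythagoreanTriple
    rw [abs_mul_abs_self]; linarith
  obtain ⟨m, n, h1, h2, h3, h4, h5, h6⟩ :=
    hp.coprime_classification' (Int.isCoprime_iff_gcd_eq_one.1 hc) hx (abs_pos.2 hz)
  refine ⟨m, n, h1, h2, by rw [← h3, sq_abs], Int.isCoprime_iff_gcd_eq_one.2 h4, ?_⟩
  rw [Int.even_mul, Int.even_iff, Int.even_iff]
  tauto

lemma G1 : ∀ N : ℕ, ∀ a b c d : ℤ, a.natAbs = N → a ≠ 0 → d % 2 = 1 → IsCoprime a d →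
    b ^ 2 = a ^ 2 + d ^ 2 → c ^ 2 = 4 * a ^ 2 + d ^ 2 → False := by
  intro N
  induction N using Nat.strong_induction_on with
  | _ N ih =>
  intro a b c d hN ha hd had hb hc
  obtain ⟨m, n, h1, h2, -, h4, -⟩ := pyth (x := d) (y := a) (z := b) (by linarith) had.symm hd
  have hd2 : IsCoprime (2 : ℤ) d := by
    refine ⟨-(d / 2), 1, ?_⟩; omega
  obtain ⟨p, q, g1, g2, -, g4, -⟩ := pyth (x := d) (y := 2 * a) (z := c) (by linarith)
    (hd2.mul_left had).symm hd
  have hpq : p * q = a := by linarith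
  obtain ⟨a', b', c', d', k1, k2, k3, k4, k5, k6⟩ := step1 (p := p) (q := q) (m := m) (n := n)
    (by linarith) (by linarith) g4 h4 (by rw [hpq]; exact ha)
  exact ih a'.natAbs (by rw [← hN, ← hpq]; exact k6) a' b' c' d' rfl k1 k2 k3 k4 k5

lemma step1_false {p q m n : ℤ} (h1 : p * q = 2 * (m * n)) (h2 : p ^ 2 - q ^ 2 = m ^ 2 - n ^ 2)
    (hpq : IsCoprime p q) (hmn : IsCoprime m n) : p * q = 0 := by
  by_contra h0
  obtain ⟨a', b', c', d', k1, k2, k3, k4, k5, k6⟩ := step1 h1 h2 hpq hmn h0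
  exact G1 _ a' b' c' d' rfl k1 k2 k3 k4 k5

lemma F1_int {x y z : ℤ} (hc : IsCoprime x y) (h : x ^ 4 - x ^ 2 * y ^ 2 + y ^ 4 = z ^ 2) :
    x * y = 0 ∨ x ^ 2 = y ^ 2 := by
  have hcop : IsCoprime (x ^ 2 - y ^ 2) (x * y) := by
    apply IsCoprime.mul_right
    · have : IsCoprime (y ^ 2) x := hc.symm.pow_left
      obtain ⟨r, s, hrs⟩ := this
      exact ⟨-r, s + r * x, by linear_combination hrs⟩
    · have : IsCoprime (x ^ 2) y := hc.pow_left
      obtain ⟨r, s, hrs⟩ := this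
      exact ⟨r, s + r * y, by linear_combination hrs⟩
  rcases Int.emod_two_eq_zero_or_one (x * y) with he | ho
  · left
    have hodd : (x ^ 2 - y ^ 2) % 2 = 1 := by
      by_contra h'
      exact not_both_even hcop (by omega) he
    obtain ⟨m, n, h1, h2, -, h4, -⟩ := pyth (z := z) (by linear_combination h) hcop hodd
    exact step1_false (by linarith) h1 hc h4
  · right
    obtain ⟨m, n, h1, h2, -, h4, -⟩ := pyth (z := z) (by linear_combination h) hcop.symm ho
    have ho' := Int.odd_mul.1 (Int.odd_iff.2 ho)
    obtain ⟨u, rfl⟩ := ho'.1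
    obtain ⟨v, rfl⟩ := ho'.2
    have hrs : IsCoprime (u + v + 1) (u - v) := by
      obtain ⟨r, s, hrs⟩ := hc
      exact ⟨r + s, r - s, by linear_combination hrs⟩
    have := step1_false (p := m) (q := n) (m := u + v + 1) (n := u - v) (by linarith)
      (by linarith) h4 hrs
    linarith

/-- step for `a² + 3e²`, `a² + 4e²` -/
lemma step2' {α β γ δ : ℤ} (h : α ^ 2 * (γ ^ 2 - 4 * β ^ 2) = δ ^ 2 * (γ ^ 2 - β ^ 2))
    (h1 : IsCoprime α δ) (h2 : IsCoprime β γ) (hα : α ≠ 0) (hβ : β ≠ 0) (hγ : γ ≠ 0) (hδ : δ ≠ 0) :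
    ∃ a b c e : ℤ, e ≠ 0 ∧ IsCoprime a e ∧ b ^ 2 = a ^ 2 + 4 * e ^ 2 ∧ c ^ 2 = a ^ 2 + 3 * e ^ 2 ∧
      e.natAbs < (2 * (α * β * γ * δ)).natAbs := by
  obtain ⟨k, hk, hB, hA⟩ := k_lemma (A := γ ^ 2 - 4 * β ^ 2) (B := γ ^ 2 - β ^ 2) h1 hα
    h h2 (u := -1) (v := 1) (u' := -1) (v' := 4) (by ring) (by ring)
  have key : ∀ {a b c : ℤ}, IsCoprime b c → ∀ k, b ^ 2 = a ^ 2 + k * c ^ 2 → IsCoprime a c := by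
    intro a b c hbc k hh
    have : IsCoprime (b ^ 2) c := hbc.pow_left
    obtain ⟨r, s, hrs⟩ := this
    exact ⟨r * a, s + r * k * c, by linear_combination hrs - r * hh⟩
  have half : ∀ {x y : ℤ}, x ≠ 0 → y ≠ 0 → (2 * x) * y ≠ 0 → x.natAbs < (2 * ((2 * x) * y)).natAbs := by
    intro x y hx hy _
    rw [show 2 * x * y = x * (2 * y) by ring]
    exact abs_lt_aux hx (by simpa using hy)
  rcases hk with rfl | rfl | rfl | rfl
  · refine ⟨δ, γ, α, β, hβ, key h2.symm 4 (by linarith), by linarith, by linarith, ?_⟩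
    rw [show α * β * γ * δ = β * (α * γ * δ) by ring]
    exact abs_lt_aux hβ (by positivity)
  · have hev : γ % 2 = 0 ∧ δ % 2 = 0 := by
      rcases sq_mod4 γ with h | h <;> rcases sq_mod4 δ with h' | h' <;> omega
    obtain ⟨g, rfl⟩ := Int.dvd_of_emod_eq_zero hev.1
    obtain ⟨e, rfl⟩ := Int.dvd_of_emod_eq_zero hev.2
    have hg : g ≠ 0 := by rintro rfl; simp at hγ
    refine ⟨α, β, e, g, hg, ?_, by linarith, by linarith, ?_⟩
    · exact key (h2.of_mul_right_right) 4 (by linarith)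
    · rw [show α * β * (2 * g) * (2 * e) = g * (α * β * (4 * e)) by ring]
      exact abs_lt_aux hg (by intro h; apply hδ; simpa [hα, hβ] using h)
  · have hev : γ % 2 = 0 ∧ δ % 2 = 0 := by
      rcases sq_mod4 γ with h | h <;> rcases sq_mod4 δ with h' | h' <;> omega
    obtain ⟨g, rfl⟩ := Int.dvd_of_emod_eq_zero hev.1
    obtain ⟨e, rfl⟩ := Int.dvd_of_emod_eq_zero hev.2
    have he : e ≠ 0 := by rintro rfl; simp at hδ
    refine ⟨β, α, g, e, he, ?_, by linarith, by linarith, ?_⟩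
    · exact key (h1.of_mul_right_right) 4 (by linarith)
    · rw [show α * β * (2 * g) * (2 * e) = e * (α * β * (4 * g)) by ring]
      exact abs_lt_aux he (by intro h; apply hγ; simpa [hα, hβ] using h)
  · refine ⟨γ, δ, β, α, hα, key h1.symm 4 (by linarith), by linarith, by linarith, ?_⟩
    rw [show α * β * γ * δ = α * (β * γ * δ) by ring]
    exact abs_lt_aux hα (by positivity)

lemma step2'' {M n p q : ℤ} (h1 : M * n = p * q) (h2 : p ^ 2 + q ^ 2 = (2 * M) ^ 2 + n ^ 2)
    (hmn : IsCoprime (2 * M) n) (hpq : IsCoprime p q) (h0 : M * n ≠ 0) :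
    ∃ a b c e : ℤ, e ≠ 0 ∧ IsCoprime a e ∧ b ^ 2 = a ^ 2 + 4 * e ^ 2 ∧ c ^ 2 = a ^ 2 + 3 * e ^ 2 ∧
      e.natAbs < (2 * (M * n)).natAbs := by
  obtain ⟨a, b, c, d, rfl, rfl, rfl, rfl⟩ := four_num h1 (left_ne_zero_of_mul h0)
  have ha : a ≠ 0 := by rintro rfl; simp at h0
  have hb : b ≠ 0 := by rintro rfl; simp at h0
  have hc : c ≠ 0 := by rintro rfl; simp at h0
  have hd : d ≠ 0 := by rintro rfl; simp at h0
  have had : IsCoprime a d := (hpq.of_mul_left_left).of_mul_right_right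
  have hcb : IsCoprime c b := (hpq.of_mul_left_right).of_mul_right_left
  have := step2' (α := a) (β := b) (γ := c) (δ := d) (by linear_combination h2) had hcb.symm ha hb hc hd
  rwa [show a * b * (c * d) = a * b * c * d by ring]

lemma step2 {m n p q : ℤ} (h1 : m * n = 2 * (p * q)) (h2 : p ^ 2 + q ^ 2 = m ^ 2 + n ^ 2)
    (hmn : IsCoprime m n) (hpq : IsCoprime p q) (h0 : m * n ≠ 0) :
    ∃ a b c e : ℤ, e ≠ 0 ∧ IsCoprime a e ∧ b ^ 2 = a ^ 2 + 4 * e ^ 2 ∧ c ^ 2 = a ^ 2 + 3 * e ^ 2 ∧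
      e.natAbs < (m * n).natAbs := by
  have he : Even (m * n) := ⟨p * q, by rw [h1]; ring⟩
  rcases Int.even_mul.1 he with ⟨X, hX⟩ | ⟨X, hX⟩
  · obtain rfl : m = 2 * X := by omega
    have := step2'' (M := X) (n := n) (p := p) (q := q) (by linarith) h2 hmn hpq
      (by intro h; apply h0; linear_combination 2 * h)
    rwa [show 2 * X * n = 2 * (X * n) by ring]
  · obtain rfl : n = 2 * X := by omega
    have := step2'' (M := X) (n := m) (p := p) (q := q) (by linarith) (by linarith) hmn.symm hpq
      (by intro h; apply h0; linear_combination 2 * h)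
    rwa [show m * (2 * X) = 2 * (X * m) by ring]

lemma G2 : ∀ N : ℕ, ∀ a b c e : ℤ, e.natAbs = N → e ≠ 0 → IsCoprime a e →
    b ^ 2 = a ^ 2 + 4 * e ^ 2 → c ^ 2 = a ^ 2 + 3 * e ^ 2 → False := by
  intro N
  induction N using Nat.strong_induction_on with
  | _ N ih =>
  intro a b c e hN he hae hb hc
  have ha : a % 2 = 1 := by
    rcases sq_mod4 a with h | h
    · rcases sq_mod4 e with h' | h'
      · exact (not_both_even hae h.1 h'.1).elim
      · rcases sq_mod4 c with h'' | h'' <;> omega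
    · exact h.1
  have ha2 : IsCoprime (2 : ℤ) a := by
    refine ⟨-(a / 2), 1, ?_⟩; omega
  obtain ⟨m, n, h1, h2, h3, h4, h5⟩ := pyth (x := a) (y := 2 * e) (z := b) (by linarith)
    (ha2.symm.mul_right hae) ha
  have hmn : m * n = e := by linarith
  rw [hmn, Int.even_iff] at h5
  have hcod : c % 2 = 1 := by
    rcases sq_mod4 a with h | h <;> rcases sq_mod4 e with h' | h' <;> rcases sq_mod4 c with h'' | h'' <;> omega
  have hce : IsCoprime c e := by
    have : IsCoprime (a ^ 2) e := hae.pow_left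
    obtain ⟨r, s, hrs⟩ := this
    exact ⟨r * c, s - r * 3 * e, by linear_combination hrs + r * hc⟩
  obtain ⟨p, q, g1, g2, g3, g4, -⟩ := pyth (x := c) (y := e) (z := b) (by linarith) hce hcod
  have hs : p ^ 2 + q ^ 2 = m ^ 2 + n ^ 2 :=
    (pow_left_inj₀ (by positivity) (by positivity) two_ne_zero).1 (g3.symm.trans h3)
  obtain ⟨a', b', c', e', k1, k2, k3, k4, k5⟩ := step2 (p := p) (q := q) (m := m) (n := n)
    (by linarith) hs h4 g4 (by rw [hmn]; exact he)
  exact ih e'.natAbs (by rw [← hN, ← hmn]; exact k5) a' b' c' e' rfl k1 k2 k3 k4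

lemma F1_rat {w z : ℚ} (h : w ^ 4 - w ^ 2 + 1 = z ^ 2) : w = 0 ∨ w ^ 2 = 1 := by
  have hd : (w.den : ℚ) ≠ 0 := by exact_mod_cast w.den_nz
  have hw : w * w.den = w.num := Rat.mul_den_eq_num w
  have hsq : IsSquare (((w.num ^ 4 - w.num ^ 2 * w.den ^ 2 + w.den ^ 4 : ℤ)) : ℚ) := by
    refine ⟨z * w.den ^ 2, ?_⟩
    push_cast
    rw [← hw]
    linear_combination (w.den : ℚ) ^ 4 * h
  obtain ⟨r, hr⟩ := Rat.isSquare_intCast_iff.1 hsq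
  rcases F1_int (x := w.num) (y := w.den) (z := r) (by
    rw [Int.isCoprime_iff_gcd_eq_one]; exact w.reduced) (by rw [hr]; ring) with h | h
  · left
    have : w.num = 0 := by simpa using h
    exact Rat.num_eq_zero.1 this
  · right
    have h' : (w.num : ℚ) ^ 2 = w.den ^ 2 := by exact_mod_cast h
    rw [← hw] at h'
    apply mul_right_cancel₀ (pow_ne_zero 2 hd)
    linear_combination h'

lemma F2_rat {w z : ℚ} (h : (w ^ 2 - 1) * (w ^ 2 - 4) = z ^ 2) : w = 0 ∨ w ^ 2 = 1 ∨ w ^ 2 = 4 := by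
  by_contra! hh
  obtain ⟨hw0, hw1, hw4⟩ := hh
  have hw1' : w ^ 2 - 1 ≠ 0 := sub_ne_zero.2 hw1
  have hw4' : w ^ 2 - 4 ≠ 0 := sub_ne_zero.2 hw4
  have hz0 : z ≠ 0 := by
    rintro rfl
    rw [zero_pow two_ne_zero] at h
    exact (mul_ne_zero hw1' hw4') h
  obtain ⟨ρ, hρ⟩ : ∃ ρ : ℚ, ρ = z / (w ^ 2 - 1) := ⟨_, rfl⟩
  have hρ0 : ρ ≠ 0 := by rw [hρ]; exact div_ne_zero hz0 hw1'
  have e : w ^ 2 - 4 = ρ ^ 2 * (w ^ 2 - 1) := by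
    rw [hρ]; field_simp; linear_combination h
  have hd : (w.den : ℚ) ≠ 0 := by exact_mod_cast w.den_nz
  have hw : w * w.den = w.num := Rat.mul_den_eq_num w
  have hd' : (ρ.den : ℚ) ≠ 0 := by exact_mod_cast ρ.den_nz
  have hρ' : ρ * ρ.den = ρ.num := Rat.mul_den_eq_num ρ
  have hint : (ρ.den : ℤ) ^ 2 * (w.num ^ 2 - 4 * (w.den : ℤ) ^ 2)
      = ρ.num ^ 2 * (w.num ^ 2 - (w.den : ℤ) ^ 2) := by
    have : ((ρ.den : ℚ)) ^ 2 * ((w.num : ℚ) ^ 2 - 4 * (w.den : ℚ) ^ 2)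
      = (ρ.num : ℚ) ^ 2 * ((w.num : ℚ) ^ 2 - (w.den : ℚ) ^ 2) := by
      rw [← hw, ← hρ']
      linear_combination (w.den : ℚ) ^ 2 * (ρ.den : ℚ) ^ 2 * e
    exact_mod_cast this
  obtain ⟨a', b', c', e', k1, k2, k3, k4, k5⟩ := step2' hint
    (by rw [isCoprime_comm, Int.isCoprime_iff_gcd_eq_one]; exact ρ.reduced)
    (by rw [isCoprime_comm, Int.isCoprime_iff_gcd_eq_one]; exact w.reduced)
    (by exact_mod_cast ρ.den_nz) (by exact_mod_cast w.den_nz)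
    (Rat.num_ne_zero.2 hw0) (Rat.num_ne_zero.2 hρ0)
  exact G2 _ a' b' c' e' rfl k1 k2 k3 k4

/-- rational points on `y² = t(t+1)(t+2)(t+3)` -/
lemma ptsA {t y : ℚ} (hm : t * (t + 1) * (t + 2) * (t + 3) = y ^ 2) :
    t = 0 ∨ t = -1 ∨ t = -2 ∨ t = -3 ∨ t = -3/2 := by
  by_contra! hh
  obtain ⟨h0, h1, h2, h3, h4⟩ := hh
  obtain ⟨Z, hZ⟩ : ∃ Z : ℚ, Z = 6 / t + 3 := ⟨_, rfl⟩
  obtain ⟨Y, hY⟩ : ∃ Y : ℚ, Y = 6 * y / t ^ 2 := ⟨_, rfl⟩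
  have hZt : Z * t = 3 * (t + 2) := by rw [hZ]; field_simp; ring
  have hZ0 : Z ≠ 0 := by
    rintro rfl
    apply h2; linarith
  have hE : Z * (Z + 3) * (Z - 1) = Y ^ 2 := by
    rw [hZ, hY]; field_simp; linear_combination 36 * hm
  have hF : (Y / (2 * Z)) ^ 4 - (Y / (2 * Z)) ^ 2 + 1 = ((Z ^ 2 + 3) / (4 * Z)) ^ 2 := by
    have : (Y / (2 * Z)) ^ 2 = (Z + 3) * (Z - 1) / (4 * Z) := by
      rw [div_pow, ← hE]; field_simp; ring
    rw [show (Y / (2 * Z)) ^ 4 = ((Y / (2 * Z)) ^ 2) ^ 2 by ring, this]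
    field_simp; ring
  rcases F1_rat hF with h | h
  · have hY0 : Y = 0 := by
      rcases div_eq_zero_iff.1 h with h | h
      · exact h
      · exact absurd (by linarith) hZ0
    rw [hY] at hY0
    have hy : y = 0 := by
      rcases div_eq_zero_iff.1 hY0 with h | h
      · linarith
      · exact absurd (pow_eq_zero_iff two_ne_zero |>.1 h) h0
    have : t * (t + 1) * (t + 2) * (t + 3) ≠ 0 := by
      refine mul_ne_zero (mul_ne_zero (mul_ne_zero h0 ?_) ?_) ?_
      · intro h; apply h1; linarith
      · intro h; apply h2; linarith
      · intro h; apply h3; linarith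
    apply this; rw [hm, hy]; norm_num
  · rw [div_pow, ← hE, div_eq_one_iff_eq (by positivity)] at h
    have : Z * ((Z - 3) * (Z + 1)) = 0 := by linear_combination h
    rcases mul_eq_zero.1 ((mul_eq_zero.1 this).resolve_left hZ0) with h | h
    · have : Z = 3 := by linarith
      rw [this] at hZt; linarith
    · have : Z = -1 := by linarith
      rw [this] at hZt; apply h4; linarith

/-- rational points on `y² = t(t+1)(t+3)(t+4)` -/
lemma ptsB {t y : ℚ} (hm : t * (t + 1) * (t + 3) * (t + 4) = y ^ 2) :
    t = 0 ∨ t = -1 ∨ t = -2 ∨ t = -3 ∨ t = -4 := by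
  by_contra! hh
  obtain ⟨h0, h1, h2, h3, h4⟩ := hh
  obtain ⟨V, hV⟩ : ∃ V : ℚ, V = 12 / t + 3 := ⟨_, rfl⟩
  obtain ⟨Y, hY⟩ : ∃ Y : ℚ, Y = 12 * y / t ^ 2 := ⟨_, rfl⟩
  have hVt : V * t = 3 * (t + 4) := by rw [hV]; field_simp; ring
  have hV0 : V ≠ 0 := by
    rintro rfl
    apply h4; linarith
  have hE : V * (V + 9) * (V + 1) = Y ^ 2 := by
    rw [hV, hY]; field_simp; linear_combination 144 * hm
  have hF : ((Y / (2 * V)) ^ 2 - 1) * ((Y / (2 * V)) ^ 2 - 4) = ((V ^ 2 - 9) / (4 * V)) ^ 2 := by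
    have : (Y / (2 * V)) ^ 2 = (V + 9) * (V + 1) / (4 * V) := by
      rw [div_pow, ← hE]; field_simp; ring
    rw [this]
    field_simp; ring
  have fin : V ≠ 3 ∧ V ≠ -3 := by
    constructor
    · rintro rfl; linarith
    · rintro rfl; apply h2; linarith
  rcases F2_rat hF with h | h | h
  · have hY0 : Y = 0 := by
      rcases div_eq_zero_iff.1 h with h | h
      · exact h
      · exact absurd (by linarith) hV0
    rw [hY] at hY0
    have hy : y = 0 := by
      rcases div_eq_zero_iff.1 hY0 with h | h
      · linarith
      · exact absurd (pow_eq_zero_iff two_ne_zero |>.1 h) h0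
    have : t * (t + 1) * (t + 3) * (t + 4) ≠ 0 := by
      refine mul_ne_zero (mul_ne_zero (mul_ne_zero h0 ?_) ?_) ?_
      · intro h; apply h1; linarith
      · intro h; apply h3; linarith
      · intro h; apply h4; linarith
    apply this; rw [hm, hy]; norm_num
  · rw [div_pow, ← hE, div_eq_one_iff_eq (by positivity)] at h
    have : V * ((V + 3) ^ 2) = 0 := by linear_combination h
    have := (pow_eq_zero_iff two_ne_zero).1 ((mul_eq_zero.1 this).resolve_left hV0)
    exact fin.2 (by linarith)
  · rw [div_pow, ← hE, div_eq_iff (by positivity)] at h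
    have : V * ((V - 3) ^ 2) = 0 := by linear_combination h
    have := (pow_eq_zero_iff two_ne_zero).1 ((mul_eq_zero.1 this).resolve_left hV0)
    exact fin.1 (by linarith)

lemma fourAP {z0 z1 z2 z3 E F : ℚ} (h0 : z0 ^ 2 = E) (h1 : z1 ^ 2 = E + F)
    (h2 : z2 ^ 2 = E + 2 * F) (h3 : z3 ^ 2 = E + 3 * F) : F = 0 := by
  by_contra hF
  have n2 : ¬ IsSquare (2 : ℚ) := by norm_num
  have hp : ∀ {a b : ℚ}, a ^ 2 + b ^ 2 = 0 → a ^ 2 = 0 := by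
    intro a b h; nlinarith [sq_nonneg a, sq_nonneg b]
  have h22 : ∀ {a b : ℚ}, b ^ 2 ≠ 0 → a ^ 2 = 2 * b ^ 2 → False := by
    intro a b hb h
    apply n2
    refine ⟨a / b, ?_⟩
    rw [← sq, div_pow, h, mul_div_assoc, div_self hb, mul_one]
  have hy : (E / F) * (E / F + 1) * (E / F + 2) * (E / F + 3) = (z0 * z1 * z2 * z3 / F ^ 2) ^ 2 := by
    rw [div_pow, mul_pow, mul_pow, mul_pow, h0, h1, h2, h3]; field_simp
  rcases ptsA hy with h | h | h | h | h <;> rw [div_eq_iff hF] at h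
  · exact h22 (a := z2) (b := z1) (by rw [h1, h]; simpa using hF) (by rw [h1, h2, h]; ring)
  · have := hp (a := z0) (b := z2) (by rw [h0, h2, h]; ring)
    rw [h0, h] at this; apply hF; linarith
  · have := hp (a := z1) (b := z3) (by rw [h1, h3, h]; ring)
    rw [h1, h] at this; apply hF; linarith
  · exact h22 (a := z1) (b := z2) (by rw [h2, h]; intro h'; apply hF; linarith)
      (by rw [h1, h2, h]; ring)
  · have := hp (a := z0) (b := z3) (by rw [h0, h3, h]; ring)
    rw [h0, h] at this; apply hF; linarith

lemma K1 {K : Type*} [Field K] [CharZero K] (t : K)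
    (hb : ∀ x : K, ∃ a b : ℚ, x = a + b * t)
    (hi : ∀ a b : ℚ, (a : K) + b * t = 0 → a = 0 ∧ b = 0)
    {d x0 x1 x2 x3 : K} (hd : d ≠ 0) (h0 : x0 ^ 2 = d * t) (h1 : x1 ^ 2 = d * (t + 1))
    (h2 : x2 ^ 2 = d * (t + 2)) (h3 : x3 ^ 2 = d * (t + 3)) :
    ∃ q : ℚ, t ^ 2 + 3 * t = q := by
  obtain ⟨Q, P, hPQ⟩ := hb (t ^ 2)
  obtain ⟨g, h, hgh⟩ := hb d
  obtain ⟨v, u, hy⟩ := hb (x0 * x1 * x2 * x3 / d ^ 2)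
  have hN : ∀ a b : ℚ, a ^ 2 + P * a * b - Q * b ^ 2 = 0 → a = 0 ∧ b = 0 := by
    intro a b hab
    have hab' : (a : K) ^ 2 + P * a * b - Q * b ^ 2 = 0 := by exact_mod_cast hab
    have : ((a : K) + b * t) * (((a + b * P : ℚ) : K) + ((-b : ℚ) : K) * t) = 0 := by
      push_cast
      linear_combination hab' - (b : K) ^ 2 * hPQ
    rcases mul_eq_zero.1 this with h | h
    · exact hi _ _ h
    · have := hi _ _ h
      have hb0 : b = 0 := by linarith [this.2]
      refine ⟨?_, hb0⟩
      have := this.1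
      rw [hb0] at this; linarith
  have hnd : g ^ 2 + P * g * h - Q * h ^ 2 ≠ 0 := by
    intro h0
    obtain ⟨rfl, rfl⟩ := hN _ _ h0
    apply hd; rw [hgh]; simp
  have hNj : ∀ j : ℚ, j ^ 2 + P * j - Q ≠ 0 := by
    intro j hj
    have := (hN j 1 (by linarith)).2
    norm_num at this
  have hnorm : ∀ (x : K) (j : ℚ), x ^ 2 = d * (t + j) →
      ∃ n : ℚ, n ^ 2 = (g ^ 2 + P * g * h - Q * h ^ 2) * (j ^ 2 + P * j - Q) := by
    intro x j hx
    obtain ⟨a, b, rfl⟩ := hb x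
    have := hi (a ^ 2 + Q * b ^ 2 - (g * j + h * Q)) (2 * a * b + P * b ^ 2 - (g + h * j + h * P)) (by
      push_cast
      rw [hgh] at hx
      linear_combination hx - ((b : K) ^ 2 - h) * hPQ)
    obtain ⟨e1, e2⟩ := this
    refine ⟨a ^ 2 + P * a * b - Q * b ^ 2, ?_⟩
    have e1' : a ^ 2 + Q * b ^ 2 = g * j + h * Q := by linarith
    have e2' : 2 * a * b + P * b ^ 2 = g + h * j + h * P := by linarith
    have : (a ^ 2 + P * a * b - Q * b ^ 2) ^ 2 = (a ^ 2 + Q * b ^ 2) ^ 2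
      + P * (a ^ 2 + Q * b ^ 2) * (2 * a * b + P * b ^ 2) - Q * (2 * a * b + P * b ^ 2) ^ 2 := by ring
    rw [this, e1', e2']; ring
  have hf : (x0 * x1 * x2 * x3 / d ^ 2) ^ 2 = t * (t + 1) * (t + 2) * (t + 3) := by
    rw [div_pow, mul_pow, mul_pow, mul_pow, h0, h1, h2, h3]; field_simp
  obtain ⟨α, hα⟩ : ∃ α : ℚ, α = u - P := ⟨_, rfl⟩
  obtain ⟨β, hβ⟩ : ∃ β : ℚ, β = v - Q := ⟨_, rfl⟩
  have hy' : x0 * x1 * x2 * x3 / d ^ 2 = t ^ 2 + α * t + β := by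
    rw [hy, hα, hβ]; push_cast; linear_combination -hPQ
  rw [hy'] at hf
  obtain ⟨c, hc⟩ : ∃ c : ℚ, c = 6 - 2 * α := ⟨_, rfl⟩
  obtain ⟨e, he⟩ : ∃ e : ℚ, e = 11 - α ^ 2 - 2 * β + c * P := ⟨_, rfl⟩
  have hrem := hi (-β ^ 2 + Q * e) (6 - 2 * α * β + Q * c + P * e) (by
    have hc' : (c : K) = 6 - 2 * α := by rw [hc]; push_cast; ring
    have he' : (e : K) = 11 - α ^ 2 - 2 * β + c * P := by rw [he]; push_cast; ring
    push_cast
    linear_combination -hf - ((c : K) * t + e) * hPQ + t ^ 3 * hc' + t ^ 2 * he')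
  obtain ⟨r0, r1⟩ := hrem
  have hev : ∀ j : ℚ, j * (j - 1) * (j - 2) * (j - 3) = 0 →
      (j ^ 2 + P * j - Q) * (e - c * j) = -(j ^ 2 - α * j + β) ^ 2 := by
    intro j hj
    linear_combination -r0 + j * r1 + (-j ^ 3) * hc + j ^ 2 * he + hj
  obtain ⟨δ, hδ⟩ : ∃ δ : ℚ, δ = g ^ 2 + P * g * h - Q * h ^ 2 := ⟨_, rfl⟩
  rw [← hδ] at hnd hnorm
  have hsq : ∀ (x : K) (j : ℚ), j * (j - 1) * (j - 2) * (j - 3) = 0 → x ^ 2 = d * (t + j) →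
      ∃ z : ℚ, z ^ 2 = (e - c * j) * (-δ) := by
    intro x j hj hx
    obtain ⟨n, hn⟩ := hnorm x j hx
    have hn0 : n ≠ 0 := by
      rintro rfl
      exact (mul_ne_zero hnd (hNj j)) (by rw [← hn]; norm_num)
    refine ⟨δ * (j ^ 2 - α * j + β) / n, ?_⟩
    rw [div_pow, div_eq_iff (pow_ne_zero 2 hn0), hn]
    linear_combination δ ^ 2 * hev j hj
  obtain ⟨z0, k0⟩ := hsq x0 0 (by norm_num) (by simpa using h0)
  obtain ⟨z1, k1⟩ := hsq x1 1 (by norm_num) (by simpa using h1)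
  obtain ⟨z2, k2⟩ := hsq x2 2 (by norm_num) (by simpa using h2)
  obtain ⟨z3, k3⟩ := hsq x3 3 (by norm_num) (by simpa using h3)
  have hcd : c * δ = 0 := fourAP k0 (by rw [k1]; ring) (by rw [k2]; ring) (by rw [k3]; ring)
  have hc0 : c = 0 := (mul_eq_zero.1 hcd).resolve_right hnd
  have ha3 : α = 3 := by linarith
  rw [hc0] at he r1
  rw [ha3] at he r1
  have he2 : e = 2 * (1 - β) := by linarith
  have hP : (1 - β) * (P + 3) = 0 := by rw [he2] at r1; linarith
  rcases mul_eq_zero.1 hP with hh | hh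
  · exfalso
    have hb1 : β = 1 := by linarith
    rw [he2, hb1] at r0; norm_num at r0
  · refine ⟨Q, ?_⟩
    have : P = -3 := by linarith
    rw [hPQ, this]; push_cast; ring

lemma basis_of_not_rat {K : Type*} [Field K] [CharZero K] [Algebra ℚ K]
    (hdeg : Module.finrank ℚ K = 2) (t : K) (ht : ∀ q : ℚ, t ≠ q) :
    (∀ x : K, ∃ a b : ℚ, x = a + b * t) ∧
      (∀ a b : ℚ, (a : K) + b * t = 0 → a = 0 ∧ b = 0) := by
  have hi : ∀ a b : ℚ, (a : K) + b * t = 0 → a = 0 ∧ b = 0 := by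
    intro a b hab
    by_cases hb : b = 0
    · subst hb; simpa using hab
    · exfalso
      have hb' : (b : K) ≠ 0 := by exact_mod_cast hb
      apply ht (-a / b)
      push_cast
      field_simp
      linear_combination hab
  refine ⟨?_, hi⟩
  have hli : LinearIndependent ℚ ![(1 : K), t] := by
    rw [LinearIndependent.pair_iff]
    intro a b hab
    apply hi
    simpa [Algebra.smul_def] using hab
  have hspan := hli.span_eq_top_of_card_eq_finrank (by simp [hdeg])
  intro x
  have hx : x ∈ Submodule.span ℚ (Set.range ![(1 : K), t]) := by rw [hspan]; trivial
  rw [Matrix.range_cons, Matrix.range_cons, Matrix.range_empty, Set.union_empty,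
    Set.singleton_union, Submodule.mem_span_pair] at hx
  obtain ⟨a, b, hab⟩ := hx
  exact ⟨a, b, by rw [← hab]; simp [Algebra.smul_def]⟩

/-- The part with rational `t`. -/
lemma rat_part {D : ℚ} (hD0 : D ≠ 0) {t c : ℚ} (hc : c ≠ 0)
    (h : ∀ i : Fin 5, ∃ q : ℚ, t + (i : ℕ) = c * q ^ 2 ∨ t + (i : ℕ) = c * D * q ^ 2) :
    ∃ X : Fin 5 → ℚ, X ≠ 0 ∧
        X 0 ^ 2 - 2 * X 1 ^ 2 + X 2 ^ 2 = 0 ∧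
        X 1 ^ 2 - 2 * X 2 ^ 2 + D * X 3 ^ 2 = 0 ∧
        X 2 ^ 2 - 2 * D * X 3 ^ 2 + X 4 ^ 2 = 0 := by
  have h' : ∀ i : Fin 5, ∃ (q : ℚ) (ε : Bool), t + (i : ℕ) = c * (bif ε then D else 1) * q ^ 2 := by
    intro i
    obtain ⟨q, hq | hq⟩ := h i
    · exact ⟨q, false, by simpa using hq⟩
    · exact ⟨q, true, by simpa using hq⟩
  choose q ε hq using h'
  have e0 := hq 0
  have e1 := hq 1
  have e2 := hq 2
  have e3 := hq 3
  have e4 := hq 4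
  norm_num at e0 e1 e2 e3 e4
  clear hq h
  generalize q 0 = q0 at *
  generalize q 1 = q1 at *
  generalize q 2 = q2 at *
  generalize q 3 = q3 at *
  generalize q 4 = q4 at *
  generalize ε 0 = ε0 at *
  generalize ε 1 = ε1 at *
  generalize ε 2 = ε2 at *
  generalize ε 3 = ε3 at *
  generalize ε 4 = ε4 at *
  -- three pairwise inequivalent classes are impossible
  have tri : ∀ {u v w a b e : ℚ} {i j k : Bool}, u = c * (bif i then D else 1) * a ^ 2 →
      v = c * (bif j then D else 1) * b ^ 2 → w = c * (bif k then D else 1) * e ^ 2 →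
      ¬ IsSquare (u * v) → ¬ IsSquare (v * w) → ¬ IsSquare (u * w) → False := by
    intro u v w a b e i j k hu hv hw h1 h2 h3
    have key : ∀ {i j : Bool} {u v a b : ℚ}, u = c * (bif i then D else 1) * a ^ 2 →
      v = c * (bif j then D else 1) * b ^ 2 → i = j → IsSquare (u * v) := by
      intro i j u v a b hu hv hij
      subst hij
      refine ⟨c * (bif i then D else 1) * a * b, ?_⟩
      rw [hu, hv]; ring
    by_cases hij : i = j
    · exact h1 (key hu hv hij)
    by_cases hjk : j = k
    · exact h2 (key hv hw hjk)
    · have : i = k := by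
        cases i <;> cases j <;> cases k <;> simp_all
      exact h3 (key hu hw this)
  have s0 : t ≠ 0 := by
    rintro rfl
    exact tri e1 e2 e3 (by norm_num) (by norm_num) (by norm_num)
  have s1 : t ≠ -1 := by
    rintro rfl
    exact tri e0 e2 e3 (by norm_num) (by norm_num) (by norm_num)
  have s2 : t ≠ -2 := by
    rintro rfl
    exact tri e0 e1 e3 (by norm_num) (by norm_num) (by norm_num)
  have s3 : t ≠ -3 := by
    rintro rfl
    exact tri e1 e2 e4 (by norm_num) (by norm_num) (by norm_num)
  have s4 : t ≠ -4 := by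
    rintro rfl
    exact tri e1 e2 e3 (by norm_num) (by norm_num) (by norm_num)
  have s5 : t ≠ -3/2 := by
    rintro rfl
    exact tri e1 e2 e3 (by norm_num) (by norm_num) (by norm_num)
  have s6 : t ≠ -5/2 := by
    rintro rfl
    exact tri e1 e2 e3 (by norm_num) (by norm_num) (by norm_num)
  have nA : ¬ IsSquare (t * (t + 1) * (t + 2) * (t + 3)) := by
    rintro ⟨y, hy⟩
    rcases ptsA (t := t) (y := y) (by rw [hy]; ring) with h | h | h | h | h <;> contradiction
  have nB : ¬ IsSquare (t * (t + 1) * (t + 3) * (t + 4)) := by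
    rintro ⟨y, hy⟩
    rcases ptsB (t := t) (y := y) (by rw [hy]; ring) with h | h | h | h | h <;> contradiction
  have nC : ¬ IsSquare ((t + 1) * (t + 2) * (t + 3) * (t + 4)) := by
    rintro ⟨y, hy⟩
    rcases ptsA (t := t + 1) (y := y) (by rw [sq, ← hy]; ring) with h | h | h | h | h
    · apply s1; linarith
    · apply s2; linarith
    · apply s3; linarith
    · apply s4; linarith
    · apply s6; linarith
  have four : ∀ {u v w z a b e f : ℚ} {i j k l : Bool}, u = c * (bif i then D else 1) * a ^ 2 →
      v = c * (bif j then D else 1) * b ^ 2 → w = c * (bif k then D else 1) * e ^ 2 →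
      z = c * (bif l then D else 1) * f ^ 2 →
      ¬ IsSquare (u * v * w * z) → (xor (xor i j) (xor k l)) = true := by
    intro u v w z a b e f i j k l hu hv hw hz hns
    by_contra hx
    apply hns
    rw [hu, hv, hw, hz]
    cases i <;> cases j <;> cases k <;> cases l <;> simp at hx <;> simp only [cond_true, cond_false]
    · exact ⟨c ^ 2 * a * b * e * f, by ring⟩
    · exact ⟨D * c ^ 2 * a * b * e * f, by ring⟩
    · exact ⟨D * c ^ 2 * a * b * e * f, by ring⟩
    · exact ⟨D * c ^ 2 * a * b * e * f, by ring⟩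
    · exact ⟨D * c ^ 2 * a * b * e * f, by ring⟩
    · exact ⟨D * c ^ 2 * a * b * e * f, by ring⟩
    · exact ⟨D * c ^ 2 * a * b * e * f, by ring⟩
    · exact ⟨D ^ 2 * c ^ 2 * a * b * e * f, by ring⟩
  have xA := four e0 e1 e2 e3 nA
  have xB := four e0 e1 e3 e4 nB
  have xC := four e1 e2 e3 e4 nC
  -- normalise the classes
  have fin : ∀ {b p0 p1 p2 p3 p4 : ℚ}, b ≠ 0 → t = b * p0 ^ 2 → t + 1 = b * p1 ^ 2 →
      t + 2 = b * p2 ^ 2 → t + 3 = b * D * p3 ^ 2 → t + 4 = b * p4 ^ 2 →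
      ∃ X : Fin 5 → ℚ, X ≠ 0 ∧
        X 0 ^ 2 - 2 * X 1 ^ 2 + X 2 ^ 2 = 0 ∧
        X 1 ^ 2 - 2 * X 2 ^ 2 + D * X 3 ^ 2 = 0 ∧
        X 2 ^ 2 - 2 * D * X 3 ^ 2 + X 4 ^ 2 = 0 := by
    intro b p0 p1 p2 p3 p4 hb f0 f1 f2 f3 f4
    refine ⟨![p0, p1, p2, p3, p4], ?_, ?_, ?_, ?_⟩
    · intro hz
      have : p0 = 0 := by simpa using congrFun hz 0
      apply s0; rw [f0, this]; ring
    · apply mul_left_cancel₀ hb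
      change b * (p0 ^ 2 - 2 * p1 ^ 2 + p2 ^ 2) = b * 0
      linear_combination -f0 + 2 * f1 - f2
    · apply mul_left_cancel₀ hb
      change b * (p1 ^ 2 - 2 * p2 ^ 2 + D * p3 ^ 2) = b * 0
      linear_combination -f1 + 2 * f2 - f3
    · apply mul_left_cancel₀ hb
      change b * (p2 ^ 2 - 2 * D * p3 ^ 2 + p4 ^ 2) = b * 0
      linear_combination -f2 + 2 * f3 - f4
  have fin' : ∀ {b p0 p1 p2 p3 p4 : ℚ}, b ≠ 0 → t = b * p0 ^ 2 → t + 1 = b * D * p1 ^ 2 →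
      t + 2 = b * p2 ^ 2 → t + 3 = b * p3 ^ 2 → t + 4 = b * p4 ^ 2 →
      ∃ X : Fin 5 → ℚ, X ≠ 0 ∧
        X 0 ^ 2 - 2 * X 1 ^ 2 + X 2 ^ 2 = 0 ∧
        X 1 ^ 2 - 2 * X 2 ^ 2 + D * X 3 ^ 2 = 0 ∧
        X 2 ^ 2 - 2 * D * X 3 ^ 2 + X 4 ^ 2 = 0 := by
    intro b p0 p1 p2 p3 p4 hb f0 f1 f2 f3 f4
    refine ⟨![p4, p3, p2, p1, p0], ?_, ?_, ?_, ?_⟩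
    · intro hz
      have : p0 = 0 := by simpa using congrFun hz 4
      apply s0; rw [f0, this]; ring
    · apply mul_left_cancel₀ hb
      change b * (p4 ^ 2 - 2 * p3 ^ 2 + p2 ^ 2) = b * 0
      linear_combination -f4 + 2 * f3 - f2
    · apply mul_left_cancel₀ hb
      change b * (p3 ^ 2 - 2 * p2 ^ 2 + D * p1 ^ 2) = b * 0
      linear_combination -f3 + 2 * f2 - f1
    · apply mul_left_cancel₀ hb
      change b * (p2 ^ 2 - 2 * D * p1 ^ 2 + p0 ^ 2) = b * 0
      linear_combination -f2 + 2 * f1 - f0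
  have hcD : c * D ≠ 0 := mul_ne_zero hc hD0
  have flip : ∀ {u a : ℚ}, u = c * 1 * a ^ 2 → u = c * D * D * (a / D) ^ 2 := by
    intro u a h
    rw [h]; field_simp
  cases ε0 <;> cases ε1 <;> cases ε2 <;> cases ε3 <;> cases ε4 <;> simp at xA xB xC <;>
    simp only [cond_true, cond_false] at e0 e1 e2 e3 e4
  · rw [mul_one] at e0 e1 e2 e4
    exact fin hc e0 e1 e2 e3 e4
  · rw [mul_one] at e0 e2 e3 e4
    exact fin' hc e0 e1 e2 e3 e4
  · exact fin' hcD e0 (flip e1) e2 e3 e4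
  · exact fin hcD e0 e1 e2 (flip e3) e4

theorem five_squares_AP_iff_CD_has_rational_point
    (D : ℤ) (hD : Squarefree D) (hD1 : D ≠ 1)
    (K : Type*) [Field K] [Algebra ℚ K] (hdeg : Module.finrank ℚ K = 2)
    (s : K) (hs : s ^ 2 = (D : K)) :
    (∃ x : Fin 5 → K, (∃ d : K, d ≠ 0 ∧ ∀ i : Fin 4,
        x i.succ ^ 2 - x i.castSucc ^ 2 = d)) ↔
      (∃ X : Fin 5 → ℚ, X ≠ 0 ∧
        X 0 ^ 2 - 2 * X 1 ^ 2 + X 2 ^ 2 = 0 ∧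
        X 1 ^ 2 - 2 * X 2 ^ 2 + (D : ℚ) * X 3 ^ 2 = 0 ∧
        X 2 ^ 2 - 2 * (D : ℚ) * X 3 ^ 2 + X 4 ^ 2 = 0) := by
  have : CharZero K := algebraRat.charZero K
  have hD0 : (D : ℚ) ≠ 0 := by exact_mod_cast hD.ne_zero
  have hDsq : ¬ IsSquare (D : ℚ) := by
    intro h
    obtain ⟨n, hn⟩ := Rat.isSquare_intCast_iff.1 h
    rcases Int.isUnit_iff.1 (hD n ⟨1, by rw [hn]; ring⟩) with h | h <;> subst h <;> exact hD1 (by rw [hn]; norm_num)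
  have hsq : ∀ q : ℚ, s ≠ q := by
    intro q hq
    rw [hq] at hs
    have : q ^ 2 = (D : ℚ) := by exact_mod_cast hs
    exact hDsq ⟨q, by rw [← this]; ring⟩
  constructor
  · rintro ⟨x, d, hd, hx⟩
    have a0 := hx 0
    have a1 := hx 1
    have a2 := hx 2
    have a3 := hx 3
    simp only [Fin.isValue, Fin.succ_zero_eq_one, Fin.castSucc_zero] at a0
    change x 2 ^ 2 - x 1 ^ 2 = d at a1
    change x 3 ^ 2 - x 2 ^ 2 = d at a2
    change x 4 ^ 2 - x 3 ^ 2 = d at a3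
    obtain ⟨t, ht⟩ : ∃ t : K, t = x 0 ^ 2 / d := ⟨_, rfl⟩
    have b0 : x 0 ^ 2 = d * t := by rw [ht]; field_simp
    have b1 : x 1 ^ 2 = d * (t + 1) := by linear_combination b0 + a0
    have b2 : x 2 ^ 2 = d * (t + 2) := by linear_combination b1 + a1
    have b3 : x 3 ^ 2 = d * (t + 3) := by linear_combination b2 + a2
    have b4 : x 4 ^ 2 = d * (t + 4) := by linear_combination b3 + a3
    have hrat : ∃ q : ℚ, t = q := by
      by_contra! hnr
      obtain ⟨hb, hi⟩ := basis_of_not_rat hdeg t hnr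
      have hnr' : ∀ q : ℚ, t + 1 ≠ q := by
        intro q hq; apply hnr (q - 1); push_cast; linear_combination hq
      obtain ⟨hb', hi'⟩ := basis_of_not_rat hdeg (t + 1) hnr'
      obtain ⟨q, hq⟩ := K1 t hb hi hd b0 b1 b2 b3
      obtain ⟨q', hq'⟩ := K1 (t + 1) hb' hi' hd b1 (by rw [b2]; ring) (by rw [b3]; ring)
        (by rw [b4]; ring)
      apply hnr ((q' - q - 4) / 2)
      push_cast
      linear_combination (hq' - hq) / 2
    obtain ⟨r, hr⟩ := hrat
    obtain ⟨hb, hi⟩ := basis_of_not_rat hdeg s hsq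
    have bi : ∀ i : Fin 5, x i ^ 2 = d * (((r + (i : ℕ) : ℚ)) : K) := by
      intro i
      rw [hr] at b0 b1 b2 b3 b4
      fin_cases i
      · simpa using b0
      · simpa using b1
      · simpa using b2
      · simpa using b3
      · simpa using b4
    -- reference index
    obtain ⟨i0, hi0⟩ : ∃ i0 : Fin 5, r + (i0 : ℕ) ≠ 0 := by
      by_contra! hall
      have h0 := hall 0
      have h1 := hall 1
      norm_num at h0 h1
      linarith
    refine rat_part hD0 hi0 (t := r) ?_
    intro i
    obtain ⟨a, b, hab⟩ := hb (x i * x i0 / (d * ((r + (i0 : ℕ) : ℚ) : K)))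
    have hi0' : ((r + (i0 : ℕ) : ℚ) : K) ≠ 0 := by exact_mod_cast hi0
    have hsqr : (x i * x i0 / (d * ((r + (i0 : ℕ) : ℚ) : K))) ^ 2
        * ((r + (i0 : ℕ) : ℚ) : K) = ((r + (i : ℕ) : ℚ) : K) := by
      rw [div_pow, mul_pow, bi i, bi i0]; field_simp
    rw [hab] at hsqr
    have := hi ((a ^ 2 + D * b ^ 2) * (r + (i0 : ℕ)) - (r + (i : ℕ))) (2 * a * b * (r + (i0 : ℕ))) (by
      push_cast at hsqr ⊢
      linear_combination hsqr - (b : K) ^ 2 * (r + (i0 : ℕ)) * hs)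
    obtain ⟨p1, p2⟩ := this
    have hab0 : a = 0 ∨ b = 0 := by
      have := (mul_eq_zero.1 p2).resolve_right hi0
      rcases mul_eq_zero.1 this with h | h
      · left; linarith
      · exact Or.inr h
    rcases hab0 with rfl | rfl
    · exact ⟨b, Or.inr (by linear_combination -p1)⟩
    · exact ⟨a, Or.inl (by linear_combination -p1)⟩
  · rintro ⟨X, hX, h1, h2, h3⟩
    have c1 : (X 0 : K) ^ 2 - 2 * X 1 ^ 2 + X 2 ^ 2 = 0 := by exact_mod_cast h1
    have c2 : (X 1 : K) ^ 2 - 2 * X 2 ^ 2 + D * X 3 ^ 2 = 0 := by exact_mod_cast h2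
    have c3 : (X 2 : K) ^ 2 - 2 * D * X 3 ^ 2 + X 4 ^ 2 = 0 := by exact_mod_cast h3
    refine ⟨![(X 0 : K), X 1, X 2, s * X 3, X 4], (X 1 : K) ^ 2 - X 0 ^ 2, ?_, ?_⟩
    · intro h
      have h' : X 1 ^ 2 - X 0 ^ 2 = 0 := by exact_mod_cast h
      have e3 : D * X 3 ^ 2 = X 0 ^ 2 := by linarith
      have hX3 : X 3 = 0 := by
        by_contra h3
        apply hDsq
        refine ⟨X 0 / X 3, ?_⟩
        field_simp
        linarith
      rw [hX3] at h2 h3 e3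
      have z0 : X 0 = 0 := by
        apply (pow_eq_zero_iff two_ne_zero).1; linarith
      have z1 : X 1 = 0 := by
        apply (pow_eq_zero_iff two_ne_zero).1; rw [z0] at h'; linarith
      have z2 : X 2 = 0 := by
        apply (pow_eq_zero_iff two_ne_zero).1; rw [z1] at h2; linarith
      have z4 : X 4 = 0 := by
        apply (pow_eq_zero_iff two_ne_zero).1; rw [z2] at h3; linarith
      apply hX
      funext i
      fin_cases i <;> assumption
    · intro i
      fin_cases i
      · simp
      · simp; linear_combination c1
      · simp; linear_combination c1 + c2 + (X 3 : K) ^ 2 * hs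
      · simp; linear_combination c1 + c2 + c3 - (X 3 : K) ^ 2 * hs
end

section
/- Let D be a squarefree integer and let K be one of the fields ℝ, ℚ₂, ℚ₃, ℚ₅ (the reals or the p-adic numbers for p = 2, 3, 5). Then there exists a nonzero tuple (x₀,…,x₄) ∈ K⁵ satisfying x₀² − 2x₁² + x₂² = 0, x₁² − 2x₂² + D·x₃² = 0 and x₂² − 2D·x₃² + x₄² = 0 if and only if the image of D in K is a square in K (explicitly: D > 0 for K = ℝ, and D a square in ℚ_p for p = 2, 3, 5). -/
/-- The curve `C_D` has a point over a field `F`: there is a nonzero tuple `(x₀,…,x₄) ∈ F⁵`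
satisfying `x₀² − 2x₁² + x₂² = 0`, `x₁² − 2x₂² + D·x₃² = 0` and `x₂² − 2D·x₃² + x₄² = 0`. -/
def CDHasPoint (F : Type*) [Field F] (D : ℤ) : Prop :=
  ∃ x : Fin 5 → F, x ≠ 0 ∧
    x 0 ^ 2 - 2 * x 1 ^ 2 + x 2 ^ 2 = 0 ∧
    x 1 ^ 2 - 2 * x 2 ^ 2 + (D : F) * x 3 ^ 2 = 0 ∧
    x 2 ^ 2 - 2 * (D : F) * x 3 ^ 2 + x 4 ^ 2 = 0

lemma CD_padic_core (p : ℕ) [Fact p.Prime] (k n : ℕ) (hn : n = p ^ k) (D : ℤ)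
    (hD : Squarefree D) (hk : (p : ℝ) ^ (-(k : ℤ)) < ‖(2 : ℤ_[p])‖ ^ 2)
    (H : ∀ x0 x1 x2 x4 : ZMod n, x0 ^ 2 - 2 * x1 ^ 2 + x2 ^ 2 = 0 →
      x4 ^ 2 = 3 * x2 ^ 2 - 2 * x1 ^ 2 →
      ((∃ b, x2 * b = 1) ∧ x1 ^ 2 = x2 ^ 2) ∨
      ((∀ b, x0 * b ≠ 1) ∧ (∀ b, x1 * b ≠ 1) ∧ (∀ b, x2 * b ≠ 1) ∧ (∀ b, x4 * b ≠ 1)))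
    (h : CDHasPoint ℚ_[p] D) : IsSquare (D : ℚ_[p]) := by
  subst hn
  obtain ⟨x, hx, e1, e2, e3⟩ := h
  have c2 : ((2 : ℤ_[p]) : ℚ_[p]) = 2 := rfl
  obtain ⟨i, -, hi⟩ := Finset.exists_max_image Finset.univ (fun j => ‖x j‖) ⟨0, Finset.mem_univ _⟩
  have hi0 : x i ≠ 0 := by
    intro h0
    apply hx
    funext j
    have := hi j (Finset.mem_univ _)
    simpa [h0] using this
  have hle : ∀ j, ‖x j / x i‖ ≤ 1 := by
    intro j
    rw [norm_div, div_le_one (norm_pos_iff.mpr hi0)]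
    exact hi j (Finset.mem_univ _)
  let y : Fin 5 → ℤ_[p] := fun j => ⟨x j / x i, hle j⟩
  have hy : ∀ j, ((y j : ℤ_[p]) : ℚ_[p]) = x j / x i := fun j => rfl
  have hyi : y i = 1 := by
    apply Subtype.ext
    simp [y, hi0]
  have f1 : y 0 ^ 2 - 2 * y 1 ^ 2 + y 2 ^ 2 = 0 := by
    apply Subtype.ext
    push_cast
    rw [hy, hy, hy, c2]
    field_simp
    linear_combination e1
  have f2 : y 1 ^ 2 - 2 * y 2 ^ 2 + (D : ℤ_[p]) * y 3 ^ 2 = 0 := by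
    apply Subtype.ext
    push_cast
    rw [hy, hy, hy, c2]
    field_simp
    linear_combination e2
  have f3 : y 2 ^ 2 - 2 * (D : ℤ_[p]) * y 3 ^ 2 + y 4 ^ 2 = 0 := by
    apply Subtype.ext
    push_cast
    rw [hy, hy, hy, c2]
    field_simp
    linear_combination e3
  clear_value y
  let φ := PadicInt.toZModPow (p := p) k
  have g1 : φ (y 0) ^ 2 - 2 * φ (y 1) ^ 2 + φ (y 2) ^ 2 = 0 := by
    simpa [map_ofNat φ] using congrArg φ f1
  have f4 : y 4 ^ 2 = 3 * y 2 ^ 2 - 2 * y 1 ^ 2 := by linear_combination f3 + 2 * f2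
  have g4 : φ (y 4) ^ 2 = 3 * φ (y 2) ^ 2 - 2 * φ (y 1) ^ 2 := by
    simpa [map_ofNat φ] using congrArg φ f4
  have hunit : ∀ z : ℤ_[p], (∀ b, φ z * b ≠ 1) → (p : ℤ_[p]) ∣ z := by
    intro z hz
    by_contra hnd
    have hu : IsUnit z := by
      by_contra hu
      exact hnd ((PadicInt.norm_lt_one_iff_dvd z).1 (PadicInt.mem_nonunits.1 hu))
    obtain ⟨c, hc⟩ := hu.exists_right_inv
    exact hz (φ c) (by rw [← map_mul, hc, map_one])
  have hk1 : (p : ℝ) ^ (-(k : ℤ)) < 1 := hk.trans_le (by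
    have := PadicInt.norm_le_one (2 : ℤ_[p])
    have h0 := norm_nonneg (2 : ℤ_[p])
    nlinarith)
  have hk0 : k ≠ 0 := by
    rintro rfl
    simp at hk1
  rcases H _ _ _ _ g1 g4 with ⟨⟨b, hb⟩, hs⟩ | ⟨h0, h1, h2, h4⟩
  · have hu2 : ‖y 2‖ = 1 := by
      by_contra hne
      have hlt : ‖y 2‖ < 1 := lt_of_le_of_ne (PadicInt.norm_le_one _) hne
      obtain ⟨c, hc⟩ := (PadicInt.norm_lt_one_iff_dvd _).1 hlt
      have hpu : IsUnit ((p : ℕ) : ZMod (p ^ k)) := by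
        apply IsUnit.of_mul_eq_one (φ c * b)
        rw [← hb, hc]
        simp [mul_assoc]
      rw [ZMod.isUnit_iff_coprime] at hpu
      have := (Nat.coprime_pow_right_iff (Nat.pos_of_ne_zero hk0) _ _).1 hpu
      rw [Nat.coprime_self] at this
      exact (Fact.out : p.Prime).one_lt.ne' this
    have hker : y 2 ^ 2 - (D : ℤ_[p]) * y 3 ^ 2 ∈ RingHom.ker φ := by
      have : y 2 ^ 2 - (D : ℤ_[p]) * y 3 ^ 2 = y 1 ^ 2 - y 2 ^ 2 := by linear_combination -f2
      rw [this, RingHom.mem_ker, map_sub, map_pow, map_pow, hs, sub_self]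
    rw [PadicInt.ker_toZModPow, ← PadicInt.norm_le_pow_iff_mem_span_pow] at hker
    have hh := hensels_lemma (p := p)
      (F := (Polynomial.X ^ 2 - Polynomial.C ((D : ℤ_[p]) * y 3 ^ 2) : Polynomial ℤ_[p]))
      (a := y 2) (by
        have e : (Polynomial.aeval (y 2)) (Polynomial.X ^ 2 - Polynomial.C ((D : ℤ_[p]) * y 3 ^ 2) : Polynomial ℤ_[p]) = y 2 ^ 2 - (D : ℤ_[p]) * y 3 ^ 2 := by
          simp
        have e' : (Polynomial.aeval (y 2)) (Polynomial.derivative (Polynomial.X ^ 2 - Polynomial.C ((D : ℤ_[p]) * y 3 ^ 2) : Polynomial ℤ_[p])) = 2 * y 2 := by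
          rw [Polynomial.derivative_sub, Polynomial.derivative_C, Polynomial.derivative_X_pow]
          simp
        rw [e, e', norm_mul, hu2, mul_one]
        exact hker.trans_lt hk)
    obtain ⟨z, hz, -⟩ := hh
    have hz' : z ^ 2 = (D : ℤ_[p]) * y 3 ^ 2 := by
      have : z ^ 2 - (D : ℤ_[p]) * y 3 ^ 2 = 0 := by simpa using hz
      linear_combination this
    have hy3 : y 3 ≠ 0 := by
      intro h3
      rw [h3] at hker
      simp [hu2] at hker
      simp at hk1
      linarith
    have hy3' : ((y 3 : ℤ_[p]) : ℚ_[p]) ≠ 0 := by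
      exact fun h => hy3 (Subtype.ext h)
    refine ⟨(z : ℚ_[p]) / (y 3 : ℚ_[p]), ?_⟩
    have hq : (z : ℚ_[p]) ^ 2 = (D : ℚ_[p]) * (y 3 : ℚ_[p]) ^ 2 := by exact_mod_cast congrArg (fun t : ℤ_[p] => (t : ℚ_[p])) hz'
    field_simp
    linear_combination -hq
  · exfalso
    have d0 := hunit _ h0
    have d1 := hunit _ h1
    have d2 := hunit _ h2
    have d4 := hunit _ h4
    have hp1 : ¬ (p : ℤ_[p]) ∣ 1 := fun h => PadicInt.prime_p.not_isUnit (isUnit_of_dvd_one h)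
    have d3 : ¬ (p : ℤ_[p]) ∣ y 3 := by
      intro d3
      apply hp1
      rw [← hyi]
      fin_cases i
      exacts [d0, d1, d2, d3, d4]
    have hu3 : IsUnit (y 3) := by
      by_contra hu
      exact d3 ((PadicInt.norm_lt_one_iff_dvd _).1 (PadicInt.mem_nonunits.1 hu))
    have hd : (p : ℤ_[p]) ^ 2 ∣ (D : ℤ_[p]) * y 3 ^ 2 := by
      obtain ⟨c1, hc1⟩ := d1
      obtain ⟨c2, hc2⟩ := d2
      refine ⟨2 * c2 ^ 2 - c1 ^ 2, ?_⟩
      rw [hc1, hc2] at f2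
      linear_combination f2
    have hd' : (p : ℤ_[p]) ^ 2 ∣ (D : ℤ_[p]) := (hu3.pow 2).dvd_mul_right.1 hd
    have hn := (PadicInt.norm_le_pow_iff_mem_span_pow (D : ℤ_[p]) 2).2
      (Ideal.mem_span_singleton.2 hd')
    rw [PadicInt.norm_int_le_pow_iff_dvd] at hn
    have hu := hD (p : ℤ) (by rw [← sq]; exact_mod_cast hn)
    exact (Nat.prime_iff_prime_int.1 (Fact.out : p.Prime)).not_isUnit hu

lemma CD_of_isSquare (F : Type*) [Field F] (D : ℤ) (hD : (D : F) ≠ 0)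
    (h : IsSquare (D : F)) : CDHasPoint F D := by
  obtain ⟨r, hr⟩ := h
  have hr0 : r ≠ 0 := by
    rintro rfl
    simp at hr
    exact hD hr
  refine ⟨![1, 1, 1, 1 / r, 1], ?_, ?_, ?_, ?_⟩
  · intro h
    simpa using congrFun h 0
  · simp; ring
  · simp [hr]; field_simp; ring
  · simp [hr]; field_simp; ring

/-- **Local solubility of `C_D` at `∞`, `2`, `3` and `5`.**
For a squarefree integer `D`, the curve `C_D` has points in `K`, for `K = ℝ, ℚ₂, ℚ₃, ℚ₅`,
if and only if `D` is a square in `K`. -/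
theorem CD_local_points_R_Q2_Q3_Q5 (D : ℤ) (hD : Squarefree D) :
    (CDHasPoint ℝ D ↔ IsSquare (D : ℝ)) ∧
      (∀ (p : ℕ) [Fact p.Prime], (p = 2 ∨ p = 3 ∨ p = 5) →
        (CDHasPoint ℚ_[p] D ↔ IsSquare (D : ℚ_[p]))) := by
  refine ⟨⟨?_, CD_of_isSquare _ _ (by exact_mod_cast hD.ne_zero)⟩, fun p _ hp =>
    ⟨?_, CD_of_isSquare _ _ (by exact_mod_cast hD.ne_zero)⟩⟩
  · rintro ⟨x, hx, e1, e2, e3⟩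
    rw [Real.isSquare_iff]
    by_contra hneg
    push Not at hneg
    have h3 : (D : ℝ) * x 3 ^ 2 ≤ 0 := mul_nonpos_of_nonpos_of_nonneg hneg.le (sq_nonneg _)
    have s0 := sq_nonneg (x 0)
    have s1 := sq_nonneg (x 1)
    have s2 := sq_nonneg (x 2)
    have s4 := sq_nonneg (x 4)
    have z2 : x 2 ^ 2 = 0 := by linarith
    have z4 : x 4 ^ 2 = 0 := by linarith
    have z3 : (D : ℝ) * x 3 ^ 2 = 0 := by linarith
    have z1 : x 1 ^ 2 = 0 := by linarith
    have z0 : x 0 ^ 2 = 0 := by linarith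
    have z3' : x 3 ^ 2 = 0 := (mul_eq_zero.1 z3).resolve_left hneg.ne
    apply hx
    funext j
    fin_cases j
    exacts [pow_eq_zero_iff two_ne_zero |>.1 z0, pow_eq_zero_iff two_ne_zero |>.1 z1,
      pow_eq_zero_iff two_ne_zero |>.1 z2, pow_eq_zero_iff two_ne_zero |>.1 z3',
      pow_eq_zero_iff two_ne_zero |>.1 z4]
  · have hodd : ∀ q : ℕ, ∀ [Fact q.Prime], q ≠ 2 → ‖(2 : ℤ_[q])‖ = 1 := by
      intro q _ hq
      have := (PadicInt.norm_natCast_eq_one_iff (p := q) (n := 2)).2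
        ((Nat.coprime_primes Fact.out Nat.prime_two).2 hq)
      exact_mod_cast this
    rcases hp with rfl | rfl | rfl
    · apply CD_padic_core 2 3 8 (by norm_num) D hD
      · have : ‖(2 : ℤ_[2])‖ = 2⁻¹ := by
          simpa using PadicInt.norm_p (p := 2)
        rw [this]
        norm_num
      · decide +kernel
    · apply CD_padic_core 3 1 3 (by norm_num) D hD
      · rw [hodd 3 (by norm_num)]
        norm_num
      · decide +kernel
    · apply CD_padic_core 5 1 5 (by norm_num) D hD
      · rw [hodd 5 (by norm_num)]
        norm_num
      · decide +kernel
end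

section
/- Let D be an integer and p > 3 a prime not dividing D. Then the reduction of C_D modulo p is smooth: for every nonzero tuple (x₀,…,x₄) ∈ 𝔽_p⁵ satisfying x₀² − 2x₁² + x₂² = 0, x₁² − 2x₂² + D·x₃² = 0 and x₂² − 2D·x₃² + x₄² = 0, the 3×5 Jacobian matrix with rows (2x₀, −4x₁, 2x₂, 0, 0), (0, 2x₁, −4x₂, 2D·x₃, 0), (0, 0, 2x₂, −4D·x₃, 2x₄) has rank 3 over 𝔽_p. -/
theorem aux_ap {F : Type*} [Field F] (t2 : (2:F) ≠ 0) (t3 : (3:F) ≠ 0)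
    (y0 y1 y2 y3 y4 a b c : F)
    (h1 : y0 - 2 * y1 + y2 = 0) (h2 : y1 - 2 * y2 + y3 = 0) (h3 : y2 - 2 * y3 + y4 = 0)
    (hy : ¬ (y0 = 0 ∧ y1 = 0))
    (e0 : y0 = 0 ∨ a = 0) (e1 : y1 = 0 ∨ b = 2 * a) (e2 : y2 = 0 ∨ a - 2 * b + c = 0)
    (e3 : y3 = 0 ∨ b = 2 * c) (e4 : y4 = 0 ∨ c = 0) : a = 0 ∧ b = 0 ∧ c = 0 := by
  have q2 : y2 = 2 * y1 - y0 := by linear_combination h1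
  have q3 : y3 = 3 * y1 - 2 * y0 := by linear_combination h2 + 2 * h1
  have q4 : y4 = 4 * y1 - 3 * y0 := by linear_combination h3 + 2 * h2 + 3 * h1
  have t4 : (4:F) ≠ 0 := by
    have := mul_ne_zero t2 t2
    norm_num at this
    exact this
  subst q2 q3 q4
  clear h1 h2 h3
  rcases e0 with e0 | e0 <;> rcases e1 with e1 | e1 <;> rcases e2 with e2 | e2 <;>
    rcases e3 with e3 | e3 <;> rcases e4 with e4 | e4 <;> grind

/-- **Good reduction of `C_D` modulo primes `p > 3` not dividing `D`.**
For a prime `p > 3` not dividing `D`, the reduction of `C_D` modulo `p` is smooth: at every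
nonzero tuple `(x₀,…,x₄) ∈ 𝔽_p⁵` satisfying the three defining equations, the `3 × 5` Jacobian
matrix of the system has rank `3`. -/
theorem CD_good_reduction_jacobian_rank
    (D : ℤ) (p : ℕ) [Fact p.Prime] (hp : 3 < p) (hpD : ¬ (p : ℤ) ∣ D)
    (x : Fin 5 → ZMod p) (hx : x ≠ 0)
    (h1 : x 0 ^ 2 - 2 * x 1 ^ 2 + x 2 ^ 2 = 0)
    (h2 : x 1 ^ 2 - 2 * x 2 ^ 2 + (D : ZMod p) * x 3 ^ 2 = 0)
    (h3 : x 2 ^ 2 - 2 * (D : ZMod p) * x 3 ^ 2 + x 4 ^ 2 = 0) :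
    (Matrix.of
      ![![2 * x 0, -4 * x 1, 2 * x 2, 0, 0],
        ![0, 2 * x 1, -4 * x 2, 2 * (D : ZMod p) * x 3, 0],
        ![0, 0, 2 * x 2, -4 * (D : ZMod p) * x 3, 2 * x 4]] :
      Matrix (Fin 3) (Fin 5) (ZMod p)).rank = 3 := by
  have hpp : p.Prime := Fact.out
  have t2 : (2 : ZMod p) ≠ 0 := by
    intro h
    have h' : ((2 : ℕ) : ZMod p) = 0 := by exact_mod_cast h
    rw [ZMod.natCast_eq_zero_iff] at h'
    have := Nat.le_of_dvd (by norm_num) h'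
    omega
  have t3 : (3 : ZMod p) ≠ 0 := by
    intro h
    have h' : ((3 : ℕ) : ZMod p) = 0 := by exact_mod_cast h
    rw [ZMod.natCast_eq_zero_iff] at h'
    have := Nat.le_of_dvd (by norm_num) h'
    omega
  have hD : (D : ZMod p) ≠ 0 := by
    rwa [Ne, ZMod.intCast_zmod_eq_zero_iff_dvd]
  rw [LinearIndependent.rank_matrix, Fintype.card_fin]
  rw [Fintype.linearIndependent_iff]
  intro g hg
  have k0 := congrFun hg 0
  have k1 := congrFun hg 1
  have k2 := congrFun hg 2
  have k3 := congrFun hg 3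
  have k4 := congrFun hg 4
  simp [Fin.sum_univ_three, Matrix.row] at k0 k1 k2 k3 k4
  have key := aux_ap t2 t3 (x 0 ^ 2) (x 1 ^ 2) (x 2 ^ 2) ((D : ZMod p) * x 3 ^ 2) (x 4 ^ 2)
    (g 0) (g 1) (g 2) h1 h2 (by linear_combination h3)
    (by
      rintro ⟨z0, z1⟩
      have z2 : x 2 ^ 2 = 0 := by linear_combination h1 - z0 + 2 * z1
      have z3 : (D : ZMod p) * x 3 ^ 2 = 0 := by linear_combination h2 - z1 + 2 * z2
      have z4 : x 4 ^ 2 = 0 := by linear_combination h3 - z2 + 2 * z3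
      apply hx
      funext i
      fin_cases i
      · simpa using z0
      · simpa using z1
      · simpa using z2
      · simpa [hD] using z3
      · simpa using z4)
    (by grind) (by grind) (by grind) (by grind) (by grind)
  intro i
  fin_cases i
  · exact key.1
  · exact key.2.1
  · exact key.2.2
end
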